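/- arXiv:1301.3436 — 6 statements merged into one kernel-verified Lean document; each statement's English description precedes it below -/
import Mathlib

section
/- Let n ≥ 1, ℓ > 0, and let Ω ⊂ ℝ³ be an open ball of radius ℓ. Let ξ be the smallest positive root of the equation (d²/dx²)(sin x / x) = 0 (numerically ξ ≈ 2.082). Then for every smooth function ψ : (ℝ³)ⁿ → ℂ that is antisymmetric under permutations of its n ℝ³-arguments, ∫_{Ωⁿ} ∑_{j=1}ⁿ ‖∇_j ψ‖² dx ≥ (n−1)·(ξ²/ℓ²)·∫_{Ωⁿ} |ψ|² dx. -/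
open MeasureTheory

section Auxiliary

open Real Set

/-- The numerator of the spherical Bessel function `j₁`. -/
noncomputable def besselNum (r : ℝ) : ℝ := sin r - r * cos r

lemma hasDerivAt_besselNum (r : ℝ) : HasDerivAt besselNum (r * sin r) r := by
  have h := (hasDerivAt_sin r).sub ((hasDerivAt_id r).mul (hasDerivAt_cos r))
  refine h.congr_deriv ?_
  simp

lemma continuous_besselNum : Continuous besselNum := by unfold besselNum; fun_prop

lemma besselNum_pos {r : ℝ} (h0 : 0 < r) (hπ : r < π) : 0 < besselNum r := by
  have hm : StrictMonoOn besselNum (Icc 0 π) := by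
    apply strictMonoOn_of_deriv_pos (convex_Icc _ _) continuous_besselNum.continuousOn
    intro x hx
    rw [interior_Icc] at hx
    rw [(hasDerivAt_besselNum x).deriv]
    exact mul_pos hx.1 (sin_pos_of_mem_Ioo hx)
  have := hm ⟨le_rfl, pi_pos.le⟩ ⟨h0.le, hπ.le⟩ h0
  simpa [besselNum] using this

lemma cube_div_six_le_besselNum {r : ℝ} (h0 : 0 ≤ r) (h1 : r ≤ 1) :
    r ^ 3 / 6 ≤ besselNum r := by
  have hm : MonotoneOn (fun x => besselNum x - x ^ 3 / 6) (Icc 0 1) := by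
    have hd : ∀ x : ℝ, HasDerivAt (fun x => besselNum x - x ^ 3 / 6) (x * sin x - x ^ 2 / 2) x := by
      intro x
      refine ((hasDerivAt_besselNum x).sub ((hasDerivAt_pow 3 x).div_const 6)).congr_deriv ?_
      norm_num; ring
    apply monotoneOn_of_deriv_nonneg (convex_Icc _ _)
    · exact fun x _ => (hd x).continuousAt.continuousWithinAt
    · exact fun x _ => (hd x).differentiableAt.differentiableWithinAt
    intro x hx
    rw [interior_Icc] at hx
    rw [(hd x).deriv]
    have := sin_gt_sub_cube hx.1
    nlinarith [mul_pos hx.1 hx.1, mul_pos hx.1 (sub_pos.2 hx.2), hx.1, hx.2,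
      mul_pos (mul_pos hx.1 hx.1) (sub_pos.2 hx.2), mul_pos hx.1 (sub_pos.2 this)]
  have := hm ⟨le_rfl, zero_le_one⟩ ⟨h0, h1⟩ h0
  simp [besselNum] at this ⊢
  linarith

/-- A quotient by `besselNum` whose numerator is `O(r⁴)` is continuous up to the origin. -/
lemma continuousOn_div_besselNum {R C : ℝ} (hR : R < π) {N : ℝ → ℝ}
    (hN : ContinuousOn N (Icc 0 R)) (hb : ∀ r ∈ Icc 0 R, |N r| ≤ C * r ^ 4) :
    ContinuousOn (fun r => N r / besselNum r) (Icc 0 R) := by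
  intro r hr
  rcases hr.1.eq_or_lt with rfl | h0
  · have hz : besselNum 0 = 0 := by simp [besselNum]
    rw [ContinuousWithinAt, hz, div_zero]
    apply squeeze_zero_norm' (a := fun r => 6 * |C| * r)
    · have : ∀ᶠ x in nhdsWithin (0:ℝ) (Icc 0 R), x ≤ 1 :=
        mem_nhdsWithin_of_mem_nhds (Iic_mem_nhds one_pos)
      filter_upwards [this, self_mem_nhdsWithin] with x hx hx'
      rcases hx'.1.eq_or_lt with rfl | hx0
      · simp [hz]
      have h1 := cube_div_six_le_besselNum hx'.1 hx
      have h2 : 0 < x ^ 3 := by positivity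
      rw [norm_div, Real.norm_eq_abs, Real.norm_eq_abs, abs_of_pos (a := besselNum x) (by linarith),
        div_le_iff₀ (by linarith)]
      calc |N x| ≤ C * x ^ 4 := hb x hx'
        _ ≤ |C| * x ^ 4 := by gcongr; exact le_abs_self C
        _ = 6 * |C| * x * (x ^ 3 / 6) := by ring
        _ ≤ _ := by gcongr
    · have : ContinuousWithinAt (fun r => 6 * |C| * r) (Icc 0 R) 0 := by fun_prop
      simpa [ContinuousWithinAt] using this
  · exact (hN r hr).div continuous_besselNum.continuousWithinAt
      (besselNum_pos h0 (hr.2.trans_lt hR)).ne'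

lemma radial_hardy {R : ℝ} (h0 : 0 < R) (hR : R < π)
    (hroot : R ^ 2 * sin R = 2 * besselNum R) {g g' : ℝ → ℝ}
    (hg : ∀ r, HasDerivAt g (g' r) r) (hg' : Continuous g') :
    ∫ r in (0:ℝ)..R, r ^ 2 * g r ^ 2 ≤ ∫ r in (0:ℝ)..R, (r ^ 2 * g' r ^ 2 + 2 * g r ^ 2) := by
  have hgc : Continuous g := continuous_iff_continuousAt.2 fun r => (hg r).continuousAt
  have key := intervalIntegral.sub_le_integral_of_hasDeriv_right_of_le h0.le
    (g := fun r => ((r ^ 3 * sin r) / besselNum r - 2 * r) * g r ^ 2)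
    (g' := fun r => (2 - r ^ 2 - (r ^ 2 * sin r / besselNum r - 2) ^ 2) * g r ^ 2 +
      ((r ^ 3 * sin r) / besselNum r - 2 * r) * (2 * g r * g' r))
    (φ := fun r => r ^ 2 * g' r ^ 2 + 2 * g r ^ 2 - r ^ 2 * g r ^ 2) ?_ ?_ ?_ ?_
  · rw [intervalIntegral.integral_sub (Continuous.intervalIntegrable (by fun_prop) _ _)
      (Continuous.intervalIntegrable (by fun_prop) _ _)] at key
    have hD := besselNum_pos h0 hR
    have : (R ^ 3 * sin R) / besselNum R - 2 * R = 0 := by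
      rw [sub_eq_zero, div_eq_iff hD.ne']
      linear_combination R * hroot
    rw [this] at key
    simp only [zero_mul, mul_zero, sub_zero, zero_div, ne_eq, OfNat.ofNat_ne_zero,
      not_false_eq_true, zero_pow] at key
    linarith
  · refine ContinuousOn.mul (ContinuousOn.sub ?_ (by fun_prop)) (by fun_prop)
    apply continuousOn_div_besselNum (C := 1) hR (by fun_prop)
    intro r hr
    have := abs_sin_le_one r
    have h2 : |sin r| ≤ r := (abs_sin_le_abs).trans (abs_of_nonneg hr.1).le
    rw [abs_mul, abs_of_nonneg (pow_nonneg hr.1 3)]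
    nlinarith [pow_nonneg hr.1 3]
  · intro r hr
    have hD := besselNum_pos hr.1 (hr.2.trans hR)
    apply HasDerivAt.hasDerivWithinAt
    refine (((((hasDerivAt_pow 3 r).mul (hasDerivAt_sin r)).div (hasDerivAt_besselNum r) hD.ne').sub
      ((hasDerivAt_id r).const_mul 2)).mul ((hg r).pow 2)).congr_deriv ?_
    have : cos r = (sin r - besselNum r) / r := by
      rw [eq_div_iff hr.1.ne', besselNum]; ring
    have hr0 := hr.1.ne'
    simp only [Pi.mul_apply, Pi.sub_apply, Pi.div_apply, Pi.pow_apply, this]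
    field_simp
    norm_num
    ring
  · exact Continuous.integrableOn_Icc (by fun_prop)
  · intro r hr
    have h : (r ^ 3 * sin r) / besselNum r - 2 * r = r * (r ^ 2 * sin r / besselNum r - 2) := by
      ring
    rw [h]
    nlinarith [sq_nonneg (r * g' r - (r ^ 2 * sin r / besselNum r - 2) * g r)]

lemma radial_neumann {R : ℝ} (h0 : 0 < R) (hR : R < π) {g g' : ℝ → ℝ}
    (hg : ∀ r, HasDerivAt g (g' r) r) (hg' : Continuous g')
    (hmean : ∫ r in (0:ℝ)..R, r ^ 2 * g r = 0) :
    ∫ r in (0:ℝ)..R, r ^ 2 * g r ^ 2 ≤ ∫ r in (0:ℝ)..R, r ^ 2 * g' r ^ 2 := by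
  have hgc : Continuous g := continuous_iff_continuousAt.2 fun r => (hg r).continuousAt
  set K : ℝ → ℝ := fun r => ∫ s in (0:ℝ)..r, s ^ 2 * g s with hK
  have hKd : ∀ r, HasDerivAt K (r ^ 2 * g r) r := fun r =>
    (show Continuous fun s => s ^ 2 * g s by fun_prop).integral_hasStrictDerivAt 0 r |>.hasDerivAt
  have hKc : Continuous K := continuous_iff_continuousAt.2 fun r => (hKd r).continuousAt
  obtain ⟨C, hC⟩ := isCompact_Icc.exists_bound_of_continuousOn (s := Icc 0 R) hgc.continuousOn
  have hC0 : 0 ≤ C := (norm_nonneg _).trans (hC 0 ⟨le_rfl, h0.le⟩)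
  have hKb : ∀ r ∈ Icc 0 R, |K r| ≤ C * r ^ 3 := by
    intro r hr
    have := intervalIntegral.norm_integral_le_of_norm_le_const (a := 0) (b := r)
      (f := fun s => s ^ 2 * g s) (C := r ^ 2 * C) ?_
    · simp only [sub_zero, abs_of_nonneg hr.1, Real.norm_eq_abs] at this
      calc |K r| ≤ _ := this
        _ = _ := by ring
    · intro s hs
      rw [uIoc_of_le hr.1] at hs
      rw [norm_mul, norm_pow, Real.norm_eq_abs s, abs_of_pos hs.1]
      have := hC s ⟨hs.1.le, hs.2.trans hr.2⟩
      have := hs.1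
      have := hs.2
      gcongr
  have key := intervalIntegral.sub_le_integral_of_hasDeriv_right_of_le h0.le
    (g := fun r => (sin r / r * K r ^ 2) / besselNum r - 2 * (g r * K r))
    (g' := fun r => (- 1 / r ^ 2 - r ^ 2 * (sin r / (r * besselNum r)) ^ 2) * K r ^ 2 +
      (sin r / (r * besselNum r)) * (2 * K r * (r ^ 2 * g r)) -
        2 * (g' r * K r + g r * (r ^ 2 * g r)))
    (φ := fun r => r ^ 2 * g' r ^ 2 - r ^ 2 * g r ^ 2) ?_ ?_ ?_ ?_
  · rw [intervalIntegral.integral_sub (Continuous.intervalIntegrable (by fun_prop) _ _)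
      (Continuous.intervalIntegrable (by fun_prop) _ _)] at key
    have h1 : K R = 0 := hmean
    have h2 : K 0 = 0 := by simp [hK]
    simp [h1, h2] at key
    linarith
  · have hb : ∀ r ∈ Icc 0 R, |sin r / r * K r ^ 2| ≤ (C ^ 2 * R ^ 2) * r ^ 4 := by
      intro r hr
      have h2 : |sin r / r| ≤ 1 := by
        rcases eq_or_ne r 0 with rfl | h
        · simp
        rw [abs_div, div_le_one (abs_pos.2 h)]
        exact abs_sin_le_abs
      rw [abs_mul, abs_pow]
      calc |sin r / r| * |K r| ^ 2 ≤ 1 * (C * r ^ 3) ^ 2 := by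
            gcongr; exact hKb r hr
        _ = C ^ 2 * r ^ 2 * r ^ 4 := by ring
        _ ≤ _ := by
          have := hr.1
          have := hr.2
          gcongr
    refine ContinuousOn.sub (continuousOn_div_besselNum hR ?_ hb) (by fun_prop)
    intro r hr
    rcases hr.1.eq_or_lt with rfl | hr0
    · have h2 : K 0 = 0 := by simp [hK]
      rw [ContinuousWithinAt]
      simp only [div_zero, zero_mul]
      apply squeeze_zero_norm' (a := fun r => (C ^ 2 * R ^ 2) * r ^ 4)
      · filter_upwards [self_mem_nhdsWithin] with x hx using hb x hx
      · have : ContinuousWithinAt (fun r => (C ^ 2 * R ^ 2) * r ^ 4) (Icc 0 R) 0 := by fun_prop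
        simpa [ContinuousWithinAt] using this
    · apply ContinuousAt.continuousWithinAt
      have := hr0.ne'
      fun_prop (disch := assumption)
  · intro r hr
    have hD := besselNum_pos hr.1 (hr.2.trans hR)
    have hr0 := hr.1.ne'
    apply HasDerivAt.hasDerivWithinAt
    refine ((((((hasDerivAt_sin r).div (hasDerivAt_id r) hr0).mul ((hKd r).pow 2)).div
      (hasDerivAt_besselNum r) hD.ne')).sub (((hg r).mul (hKd r)).const_mul 2)).congr_deriv ?_
    have : cos r = (sin r - besselNum r) / r := by
      rw [eq_div_iff hr.1.ne', besselNum]; ring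
    simp only [Pi.mul_apply, Pi.div_apply, Pi.pow_apply, this, id]
    field_simp
    norm_num
    ring
  · exact Continuous.integrableOn_Icc (by fun_prop)
  · intro r hr
    have hr0 := hr.1.ne'
    have h1 := sq_nonneg (r * g' r + K r / r)
    have h2 := sq_nonneg (r * g r - r * (sin r / (r * besselNum r)) * K r)
    have h3 : (r * g' r + K r / r) ^ 2 =
        r ^ 2 * g' r ^ 2 + 2 * g' r * K r - (- 1 / r ^ 2) * K r ^ 2 := by
      field_simp; ring
    rw [h3] at h1
    nlinarith

lemma polar_neumann {g g' : ℝ → ℝ}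
    (hg : ∀ r, HasDerivAt g (g' r) r) (hg' : Continuous g')
    (hmean : ∫ r in (0:ℝ)..π, sin r * g r = 0) :
    2 * ∫ r in (0:ℝ)..π, sin r * g r ^ 2 ≤ ∫ r in (0:ℝ)..π, sin r * g' r ^ 2 := by
  have hgc : Continuous g := continuous_iff_continuousAt.2 fun r => (hg r).continuousAt
  have hcont : Continuous fun s => sin s * g s := by fun_prop
  set K : ℝ → ℝ := fun r => ∫ s in (0:ℝ)..r, sin s * g s with hK
  have hKd : ∀ r, HasDerivAt K (sin r * g r) r := fun r =>
    hcont.integral_hasStrictDerivAt 0 r |>.hasDerivAt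
  have hKc : Continuous K := continuous_iff_continuousAt.2 fun r => (hKd r).continuousAt
  have hK0 : K 0 = 0 := by simp [hK]
  have hKπ : K π = 0 := hmean
  obtain ⟨C, hC⟩ := isCompact_Icc.exists_bound_of_continuousOn (s := Icc 0 π) hgc.continuousOn
  have hC0 : 0 ≤ C := (norm_nonneg _).trans (hC 0 ⟨le_rfl, pi_pos.le⟩)
  have hint : ∀ a b, a ∈ Icc 0 π → b ∈ Icc 0 π → a ≤ b →
      |∫ s in a..b, sin s * g s| ≤ C * (cos a - cos b) := by
    intro a b ha hb hab
    have := intervalIntegral.norm_integral_le_of_norm_le (a := a) (b := b)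
      (f := fun s => sin s * g s) (g := fun s => C * sin s) hab ?_
      ((continuous_const.mul continuous_sin).intervalIntegrable (μ := volume) _ _)
    · simpa using this
    · refine Filter.Eventually.of_forall fun s hs => ?_
      have hs' : s ∈ Icc 0 π := ⟨ha.1.trans hs.1.le, hs.2.trans hb.2⟩
      have h1 := sin_nonneg_of_mem_Icc hs'
      rw [norm_mul, Real.norm_eq_abs (sin s), abs_of_nonneg h1, mul_comm]
      exact mul_le_mul_of_nonneg_right (hC s hs') h1
  have hKb : ∀ r ∈ Icc 0 π, |K r| ≤ C * sin r ^ 2 := by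
    intro r hr
    have h1 := hint 0 r ⟨le_rfl, pi_pos.le⟩ hr hr.1
    have h2 := hint r π hr ⟨pi_pos.le, le_rfl⟩ hr.2
    have h3 : ∫ s in r..π, sin s * g s = - K r := by
      have := intervalIntegral.integral_add_adjacent_intervals
        (hcont.intervalIntegrable (μ := volume) 0 r) (hcont.intervalIntegrable r π)
      rw [hmean] at this
      linarith
    rw [h3, abs_neg, cos_pi] at h2
    rw [cos_zero] at h1
    rw [sin_sq]
    rcases le_total 0 (cos r) with hc | hc
    · refine h1.trans (mul_le_mul_of_nonneg_left ?_ hC0)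
      nlinarith [cos_le_one r]
    · refine h2.trans (mul_le_mul_of_nonneg_left ?_ hC0)
      nlinarith [neg_one_le_cos r]
  have key := intervalIntegral.sub_le_integral_of_hasDeriv_right_of_le pi_pos.le
    (g := fun r => 4 * cos r * (K r ^ 2 / sin r ^ 2) - 4 * (g r * K r))
    (g' := fun r => (- 4 / sin r - 8 * cos r ^ 2 / sin r ^ 3) * K r ^ 2 +
      (4 * cos r / sin r ^ 2) * (2 * K r * (sin r * g r)) -
        4 * (g' r * K r + g r * (sin r * g r)))
    (φ := fun r => sin r * g' r ^ 2 - 2 * (sin r * g r ^ 2)) ?_ ?_ ?_ ?_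
  · rw [intervalIntegral.integral_sub (Continuous.intervalIntegrable (by fun_prop) _ _)
      (Continuous.intervalIntegrable (by fun_prop) _ _),
      intervalIntegral.integral_const_mul] at key
    simp [hKπ, hK0] at key
    linarith
  · refine ContinuousOn.sub (ContinuousOn.mul (by fun_prop) ?_) (by fun_prop)
    intro r hr
    by_cases hs : sin r = 0
    · rw [ContinuousWithinAt, hs]
      simp only [ne_eq, OfNat.ofNat_ne_zero, not_false_eq_true, zero_pow, div_zero]
      apply squeeze_zero_norm' (a := fun r => C ^ 2 * sin r ^ 2)
      · filter_upwards [self_mem_nhdsWithin] with x hx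
        rw [norm_div, norm_pow, norm_pow, Real.norm_eq_abs, Real.norm_eq_abs, sq_abs (sin x)]
        apply div_le_of_le_mul₀ (by positivity) (by positivity)
        calc |K x| ^ 2 ≤ (C * sin x ^ 2) ^ 2 := by gcongr; exact hKb x hx
          _ = _ := by ring
      · have : ContinuousWithinAt (fun r => C ^ 2 * sin r ^ 2) (Icc 0 π) r := by fun_prop
        simpa [ContinuousWithinAt, hs] using this
    · apply ContinuousAt.continuousWithinAt
      have : sin r ^ 2 ≠ 0 := by positivity
      fun_prop (disch := assumption)
  · intro r hr
    have hs := (sin_pos_of_mem_Ioo hr).ne'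
    apply HasDerivAt.hasDerivWithinAt
    refine ((((hasDerivAt_cos r).const_mul 4).mul (((hKd r).pow 2).div ((hasDerivAt_sin r).pow 2)
      (pow_ne_zero 2 hs))).sub (((hg r).mul (hKd r)).const_mul 4)).congr_deriv ?_
    simp only [Pi.div_apply, Pi.pow_apply]
    field_simp
    norm_num
    ring
  · exact Continuous.integrableOn_Icc (by fun_prop)
  · intro r hr
    have hs := sin_pos_of_mem_Ioo hr
    have h1 := mul_nonneg hs.le (sq_nonneg (g' r + 2 * K r / sin r))
    have h2 := mul_nonneg hs.le (sq_nonneg (g r - 2 * cos r * K r / sin r ^ 2))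
    rw [← sub_nonneg]
    refine (add_nonneg h1 (mul_nonneg zero_le_two h2)).trans_eq ?_
    field_simp
    ring

lemma wirtinger_of_periodic {g g' : ℝ → ℝ} (hg : ∀ r, HasDerivAt g (g' r) r) (hg' : Continuous g')
    (hper : g (-π) = g π) (hmean : ∫ r in (-π)..π, g r = 0) :
    ∫ r in (-π)..π, g r ^ 2 ≤ ∫ r in (-π)..π, g' r ^ 2 := by
  have hgc : Continuous g := continuous_iff_continuousAt.2 fun r => (hg r).continuousAt
  have hab : -π < π := by linarith [pi_pos]
  have hL : ∀ u : ℝ → ℝ, Continuous u →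
      MemLp (fun x => (u x : ℂ)) 2 (volume.restrict (Ioc (-π) π)) := by
    intro u hu
    obtain ⟨C, hC⟩ := isCompact_Icc.exists_bound_of_continuousOn (s := Icc (-π) π) hu.continuousOn
    refine MemLp.of_bound (by fun_prop) C ?_
    filter_upwards [ae_restrict_mem measurableSet_Ioc] with x hx
    simpa using hC x (Ioc_subset_Icc_self hx)
  have hsum : ∀ u : ℝ → ℝ, Continuous u →
      HasSum (fun n => ‖fourierCoeffOn hab (fun x => (u x : ℂ)) n‖ ^ 2)
        ((π - -π)⁻¹ * ∫ x in (-π)..π, u x ^ 2) := by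
    intro u hu
    simpa using hasSum_sq_fourierCoeffOn hab (hL u hu)
  have h1 := hsum g hgc
  have h2 := hsum g' hg'
  have hle := hasSum_le (fun n => ?_) h1 h2
  · exact le_of_mul_le_mul_left hle (by rw [inv_pos]; linarith)
  rcases eq_or_ne n 0 with rfl | hn
  · rw [fourierCoeffOn_eq_integral]
    simp [intervalIntegral.integral_ofReal, hmean]
  · rw [fourierCoeffOn_of_hasDerivAt hab hn (fun x _ => (hg x).ofReal_comp)
      (Continuous.intervalIntegrable (by fun_prop) _ _)]
    have hn1 : (1 : ℝ) ≤ |(n : ℝ)| := by exact_mod_cast Int.one_le_abs hn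
    rw [hper, sub_self, mul_zero, zero_sub, norm_mul, norm_neg, norm_mul, norm_div]
    have e1 : ‖(π : ℂ) - ((-π : ℝ) : ℂ)‖ = 2 * π := by
      rw [← Complex.ofReal_sub, Complex.norm_real, Real.norm_eq_abs, abs_of_pos (by linarith)]
      ring
    have e2 : ‖-2 * (π : ℂ) * Complex.I * n‖ = 2 * π * |(n : ℝ)| := by
      simp [abs_of_pos pi_pos]
    rw [e1, e2, norm_one]
    have : 1 / (2 * π * |(n : ℝ)|) * (2 * π * ‖fourierCoeffOn hab (fun x => (g' x : ℂ)) n‖) =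
        ‖fourierCoeffOn hab (fun x => (g' x : ℂ)) n‖ / |(n : ℝ)| := by
      field_simp
    rw [this]
    gcongr
    exact div_le_self (norm_nonneg _) hn1
open Function in
lemma hasDerivAt_setIntegral_of_continuous {X : Type*} [TopologicalSpace X] [MeasurableSpace X]
    [OpensMeasurableSpace X] [SecondCountableTopology X] {ν : Measure X}
    [IsFiniteMeasureOnCompacts ν] {K : Set X} (hK : IsCompact K) (hKm : MeasurableSet K)
    {u u' : ℝ → X → ℝ} (hu : Continuous (uncurry u))
    (hu' : Continuous (uncurry u')) (hd : ∀ t x, HasDerivAt (fun s => u s x) (u' t x) t) (t : ℝ) :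
    HasDerivAt (fun s => ∫ x in K, u s x ∂ν) (∫ x in K, u' t x ∂ν) t := by
  obtain ⟨C, hC⟩ := ((isCompact_Icc (a := t - 1) (b := t + 1)).prod hK).exists_bound_of_continuousOn
    hu'.continuousOn
  have : IsFiniteMeasure (ν.restrict K) := ⟨by simpa using hK.measure_lt_top⟩
  have hux : ∀ s, Continuous (u s) := fun s => hu.comp (by fun_prop : Continuous fun x => (s, x))
  have hux' : ∀ s, Continuous (u' s) := fun s => hu'.comp (by fun_prop : Continuous fun x => (s, x))
  refine (hasDerivAt_integral_of_dominated_loc_of_deriv_le (F := u) (F' := u') (bound := fun _ => C)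
    (Icc_mem_nhds (by linarith : t - 1 < t) (by linarith : t < t + 1))
    (Filter.Eventually.of_forall fun s => (hux s).aestronglyMeasurable) ?_
    (hux' t).aestronglyMeasurable ?_ (integrable_const C) ?_).2
  · exact (hux t).continuousOn.integrableOn_compact' hK hKm
  · filter_upwards [ae_restrict_mem hKm] with x hx s hs using hC (s, x) ⟨hs, hx⟩
  · exact Filter.Eventually.of_forall fun x s _ => hd s x

lemma continuous_intervalIntegral_of_continuous {u : ℝ → ℝ → ℝ}
    (hu : Continuous (Function.uncurry u))
    (a b : ℝ) : Continuous fun t => ∫ x in a..b, u t x :=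
  intervalIntegral.continuous_parametric_intervalIntegral_of_continuous' hu a b

lemma hasDerivAt_intervalIntegral_of_continuous {u u' : ℝ → ℝ → ℝ}
    (hu : Continuous (Function.uncurry u)) (hu' : Continuous (Function.uncurry u'))
    (hd : ∀ t x, HasDerivAt (fun s => u s x) (u' t x) t) {a b : ℝ} (hab : a ≤ b) (t : ℝ) :
    HasDerivAt (fun s => ∫ x in a..b, u s x) (∫ x in a..b, u' t x) t := by
  simp only [intervalIntegral.integral_of_le hab, ← integral_Icc_eq_integral_Ioc]
  exact hasDerivAt_setIntegral_of_continuous isCompact_Icc measurableSet_Icc hu hu' hd t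

/-- The sharp Poincaré inequality on the unit sphere, in spherical coordinates. -/
lemma sphere_poincare {g β γ : ℝ → ℝ → ℝ} (hg : Continuous (Function.uncurry g))
    (hβ : Continuous (Function.uncurry β)) (hγ : Continuous (Function.uncurry γ))
    (hgθ : ∀ θ φ, HasDerivAt (fun s => g s φ) (β θ φ) θ)
    (hgφ : ∀ θ φ, HasDerivAt (g θ) (sin θ * γ θ φ) φ)
    (hper : ∀ θ, g θ (-π) = g θ π)
    (hmean : ∫ θ in (0:ℝ)..π, sin θ * ∫ φ in (-π)..π, g θ φ = 0) :
    2 * ∫ θ in (0:ℝ)..π, sin θ * ∫ φ in (-π)..π, g θ φ ^ 2 ≤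
      ∫ θ in (0:ℝ)..π, sin θ * ∫ φ in (-π)..π, (β θ φ ^ 2 + γ θ φ ^ 2) := by
  have hab : -π ≤ π := by linarith [pi_pos]
  have h2π : (0:ℝ) < 2 * π := by positivity
  set A : ℝ → ℝ := fun θ => (2 * π)⁻¹ * ∫ φ in (-π)..π, g θ φ with hA
  set A' : ℝ → ℝ := fun θ => (2 * π)⁻¹ * ∫ φ in (-π)..π, β θ φ with hA'
  have hAd : ∀ θ, HasDerivAt A (A' θ) θ := fun θ =>
    (hasDerivAt_intervalIntegral_of_continuous hg hβ hgθ hab θ).const_mul _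
  have hAc : Continuous A := continuous_iff_continuousAt.2 fun r => (hAd r).continuousAt
  have hA'c : Continuous A' :=
    continuous_const.mul (continuous_intervalIntegral_of_continuous hβ _ _)
  have hgx : ∀ θ, Continuous (g θ) := fun θ => hg.comp (by fun_prop : Continuous fun x => (θ, x))
  have hβx : ∀ θ, Continuous (β θ) := fun θ => hβ.comp (by fun_prop : Continuous fun x => (θ, x))
  have hγx : ∀ θ, Continuous (γ θ) := fun θ => hγ.comp (by fun_prop : Continuous fun x => (θ, x))
  set H : ℝ → ℝ → ℝ := fun θ φ => g θ φ - A θ with hH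
  set H' : ℝ → ℝ → ℝ := fun θ φ => β θ φ - A' θ with hH'
  have hHc : Continuous (Function.uncurry H) := hg.sub (hAc.comp continuous_fst)
  have hH'c : Continuous (Function.uncurry H') := hβ.sub (hA'c.comp continuous_fst)
  have hHx : ∀ θ, Continuous (H θ) := fun θ => hHc.comp (by fun_prop : Continuous fun x => (θ, x))
  have hH'x : ∀ θ, Continuous (H' θ) := fun θ =>
    hH'c.comp (by fun_prop : Continuous fun x => (θ, x))
  have hHd : ∀ θ φ, HasDerivAt (fun s => H s φ) (H' θ φ) θ := fun θ φ => (hgθ θ φ).sub (hAd θ)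
  have hH0 : ∀ θ, ∫ φ in (-π)..π, H θ φ = 0 := by
    intro θ
    rw [intervalIntegral.integral_sub ((hgx θ).intervalIntegrable _ _)
      (continuous_const.intervalIntegrable _ _), intervalIntegral.integral_const, hA]
    simp only [smul_eq_mul]
    field_simp
    ring
  have hH'0 : ∀ θ, ∫ φ in (-π)..π, H' θ φ = 0 := by
    intro θ
    rw [intervalIntegral.integral_sub ((hβx θ).intervalIntegrable _ _)
      (continuous_const.intervalIntegrable _ _), intervalIntegral.integral_const, hA']
    simp only [smul_eq_mul]
    field_simp
    ring
  have hsplit : ∀ (u : ℝ → ℝ) (c : ℝ), Continuous u → ∫ φ in (-π)..π, u φ = 0 →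
      ∫ φ in (-π)..π, (u φ + c) ^ 2 = (∫ φ in (-π)..π, u φ ^ 2) + 2 * π * c ^ 2 := by
    intro u c hu h0
    have : ∀ φ, (u φ + c) ^ 2 = u φ ^ 2 + 2 * c * u φ + c ^ 2 := fun φ => by ring
    simp_rw [this]
    rw [intervalIntegral.integral_add (Continuous.intervalIntegrable (by fun_prop) _ _)
      (Continuous.intervalIntegrable (by fun_prop) _ _),
      intervalIntegral.integral_add (Continuous.intervalIntegrable (by fun_prop) _ _)
      (Continuous.intervalIntegrable (by fun_prop) _ _), intervalIntegral.integral_const_mul, h0,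
      intervalIntegral.integral_const, smul_eq_mul]
    ring
  have hg2 : ∀ θ, ∫ φ in (-π)..π, g θ φ ^ 2 = (∫ φ in (-π)..π, H θ φ ^ 2) + 2 * π * A θ ^ 2 := by
    intro θ
    rw [← hsplit (H θ) (A θ) (hHx θ) (hH0 θ)]
    simp [hH]
  have hsq : ∀ u : ℝ → ℝ → ℝ, Continuous (Function.uncurry u) →
      Continuous (Function.uncurry fun θ φ => u θ φ ^ 2) := by
    intro u hu
    simp only [Function.uncurry_def] at *
    fun_prop
  have hβ2 : ∀ θ, ∫ φ in (-π)..π, (β θ φ ^ 2 + γ θ φ ^ 2) =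
      (∫ φ in (-π)..π, H' θ φ ^ 2) + (∫ φ in (-π)..π, γ θ φ ^ 2) + 2 * π * A' θ ^ 2 := by
    intro θ
    rw [add_right_comm, ← hsplit (H' θ) (A' θ) (hH'x θ) (hH'0 θ),
      ← intervalIntegral.integral_add (Continuous.intervalIntegrable (by fun_prop) _ _)
        (Continuous.intervalIntegrable (by fun_prop) _ _)]
    simp [hH']
  have hn : Continuous fun θ => ∫ φ in (-π)..π, H θ φ ^ 2 :=
    continuous_intervalIntegral_of_continuous (hsq _ hHc) _ _
  have hn' : Continuous fun θ => ∫ φ in (-π)..π, H' θ φ ^ 2 :=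
    continuous_intervalIntegral_of_continuous (hsq _ hH'c) _ _
  have hq : Continuous fun θ => ∫ φ in (-π)..π, γ θ φ ^ 2 :=
    continuous_intervalIntegral_of_continuous (hsq _ hγ) _ _
  have hwirt : ∀ θ, ∫ φ in (-π)..π, H θ φ ^ 2 ≤ sin θ ^ 2 * ∫ φ in (-π)..π, γ θ φ ^ 2 := by
    intro θ
    have := wirtinger_of_periodic (g := H θ) (fun φ => (hgφ θ φ).sub_const (A θ))
      (continuous_const.mul (hγx θ)) (by simp [hH, hper]) (hH0 θ)
    simpa only [mul_pow, intervalIntegral.integral_const_mul] using this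
  have hzero : ∀ θ, sin θ = 0 → ∫ φ in (-π)..π, H θ φ ^ 2 = 0 := by
    intro θ h
    apply le_antisymm ((hwirt θ).trans (by simp [h]))
    exact intervalIntegral.integral_nonneg hab fun _ _ => sq_nonneg _
  have hnd : ∀ θ, HasDerivAt (fun θ => ∫ φ in (-π)..π, H θ φ ^ 2)
      (∫ φ in (-π)..π, 2 * H θ φ * H' θ φ) θ := by
    intro θ
    refine hasDerivAt_intervalIntegral_of_continuous (u := fun θ φ => H θ φ ^ 2)
      (u' := fun θ φ => 2 * H θ φ * H' θ φ) (hsq _ hHc)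
      (by simp only [Function.uncurry_def] at *; fun_prop)
      (fun s x => ((hHd s x).fun_pow 2).congr_deriv (by norm_num)) hab θ
  have key1 := intervalIntegral.sub_le_integral_of_hasDeriv_right_of_le pi_pos.le
    (g := fun θ => cos θ * ∫ φ in (-π)..π, H θ φ ^ 2)
    (g' := fun θ => - sin θ * (∫ φ in (-π)..π, H θ φ ^ 2) +
      cos θ * ∫ φ in (-π)..π, 2 * H θ φ * H' θ φ)
    (φ := fun θ => sin θ * ((∫ φ in (-π)..π, H' θ φ ^ 2) + (∫ φ in (-π)..π, γ θ φ ^ 2)) -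
      2 * (sin θ * ∫ φ in (-π)..π, H θ φ ^ 2)) (by fun_prop)
    (fun θ _ => ((hasDerivAt_cos θ).mul (hnd θ)).hasDerivWithinAt)
    (Continuous.integrableOn_Icc (by fun_prop)) ?_
  · have key2 := polar_neumann hAd hA'c ?_
    · simp only [hzero π sin_pi, hzero 0 sin_zero, mul_zero, sub_zero] at key1
      rw [intervalIntegral.integral_sub (Continuous.intervalIntegrable (by fun_prop) _ _)
        (Continuous.intervalIntegrable (by fun_prop) _ _),
        intervalIntegral.integral_const_mul] at key1
      simp_rw [hg2, hβ2, mul_add (sin _), mul_left_comm (sin _) (2 * π)]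
      rw [intervalIntegral.integral_add (Continuous.intervalIntegrable (by fun_prop) _ _)
        (Continuous.intervalIntegrable (by fun_prop) _ _),
        intervalIntegral.integral_add (Continuous.intervalIntegrable (by fun_prop) _ _)
        (Continuous.intervalIntegrable (by fun_prop) _ _),
        intervalIntegral.integral_const_mul, intervalIntegral.integral_const_mul]
      simp_rw [mul_add (sin _)] at key1
      have := mul_le_mul_of_nonneg_left key2 h2π.le
      linarith
    · simp_rw [hA, mul_left_comm (sin _), intervalIntegral.integral_const_mul, hmean, mul_zero]
  · intro θ hθ
    have hs := sin_pos_of_mem_Ioo hθ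
    have h1 : (∫ φ in (-π)..π, H θ φ ^ 2) / sin θ ≤ sin θ * ∫ φ in (-π)..π, γ θ φ ^ 2 := by
      rw [div_le_iff₀ hs]
      linarith [hwirt θ]
    have h2 : cos θ * (∫ φ in (-π)..π, 2 * H θ φ * H' θ φ) ≤
        sin θ * (∫ φ in (-π)..π, H' θ φ ^ 2) +
          (1 / sin θ - sin θ) * ∫ φ in (-π)..π, H θ φ ^ 2 := by
      have hHθ := hHx θ
      have hH'θ := hH'x θ
      simp_rw [← intervalIntegral.integral_const_mul]
      rw [← intervalIntegral.integral_add (Continuous.intervalIntegrable (by fun_prop) _ _)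
        (Continuous.intervalIntegrable (by fun_prop) _ _)]
      apply intervalIntegral.integral_mono_on hab (Continuous.intervalIntegrable (by fun_prop) _ _)
        (Continuous.intervalIntegrable (by fun_prop) _ _)
      intro φ _
      rw [← sub_nonneg]
      refine (mul_nonneg hs.le (sq_nonneg (H' θ φ - cos θ / sin θ * H θ φ))).trans_eq ?_
      field_simp
      linear_combination H θ φ ^ 2 * sin_sq_add_cos_sq θ
    have h3 : (1 / sin θ - sin θ) * (∫ φ in (-π)..π, H θ φ ^ 2) =
      (∫ φ in (-π)..π, H θ φ ^ 2) / sin θ - sin θ * ∫ φ in (-π)..π, H θ φ ^ 2 := by ring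
    linarith

/-- The Poincaré inequality on a ball, from the one on spheres: `X` is the sphere, with weight `w`
on the compact set `K`, and `P` is the squared angular part of the gradient. -/
lemma poincare_of_angular {X : Type*} [TopologicalSpace X] [MeasurableSpace X]
    [OpensMeasurableSpace X] [SecondCountableTopology X] {ν : Measure X} [IsLocallyFiniteMeasure ν]
    [SFinite ν]
    {K : Set X} (hK : IsCompact K) (hKm : MeasurableSet K) {w : X → ℝ} (hw : Continuous w)
    (hw0 : ∀ x ∈ K, 0 ≤ w x) {W : ℝ} (hW : ∫ x in K, w x ∂ν = W) (hWpos : 0 < W)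
    {R : ℝ} (h0 : 0 < R) (hR : R < π) (hroot : R ^ 2 * sin R = 2 * besselNum R)
    {F a P : ℝ → X → ℝ} (hF : Continuous (Function.uncurry F))
    (ha : Continuous (Function.uncurry a)) (hP : Continuous (Function.uncurry P))
    (hd : ∀ r x, HasDerivAt (fun s => F s x) (a r x) r)
    (hang : ∀ r ∈ Ioo 0 R, 2 * ∫ x in K, w x * (F r x - W⁻¹ * ∫ y in K, w y * F r y ∂ν) ^ 2 ∂ν ≤
      r ^ 2 * ∫ x in K, w x * P r x ∂ν) :
    (∫ r in (0:ℝ)..R, r ^ 2 * ∫ x in K, w x * F r x ^ 2 ∂ν) -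
        3 / (W * R ^ 3) * (∫ r in (0:ℝ)..R, r ^ 2 * ∫ x in K, w x * F r x ∂ν) ^ 2 ≤
      ∫ r in (0:ℝ)..R, r ^ 2 * ∫ x in K, w x * (a r x ^ 2 + P r x) ∂ν := by
  have hpar : ∀ u : ℝ → X → ℝ, Continuous (Function.uncurry u) →
      Continuous fun r => ∫ x in K, w x * u r x ∂ν := by
    intro u hu
    refine continuous_parametric_integral_of_continuous (f := fun r x => w x * u r x) ?_ hK
    simp only [Function.uncurry_def] at *
    fun_prop
  have hslice : ∀ u : ℝ → X → ℝ, Continuous (Function.uncurry u) → ∀ r, Continuous (u r) :=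
    fun u hu r => hu.comp (by fun_prop : Continuous fun x => (r, x))
  have hint : ∀ u : X → ℝ, Continuous u → Integrable u (ν.restrict K) :=
    fun u hu => hu.continuousOn.integrableOn_compact' hK hKm
  have hswap : ∀ u : ℝ → X → ℝ, Continuous (Function.uncurry u) →
      ∫ x in K, w x * (∫ r in (0:ℝ)..R, u r x) ∂ν = ∫ r in (0:ℝ)..R, ∫ x in K, w x * u r x ∂ν := by
    intro u hu
    simp_rw [← intervalIntegral.integral_const_mul, intervalIntegral.integral_of_le h0.le,
      ← integral_Icc_eq_integral_Ioc]
    refine integral_integral_swap (f := fun x r => w x * u r x) ?_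
    rw [Measure.prod_restrict]
    refine ContinuousOn.integrableOn_compact' (hK.prod isCompact_Icc)
      (hKm.prod measurableSet_Icc) ?_
    simp only [Function.uncurry_def] at *
    have : Continuous fun p : X × ℝ => u p.2 p.1 := hu.comp continuous_swap
    fun_prop
  set m : ℝ → ℝ := fun r => W⁻¹ * ∫ x in K, w x * F r x ∂ν with hm
  set m' : ℝ → ℝ := fun r => W⁻¹ * ∫ x in K, w x * a r x ∂ν with hm'
  have hm'c : Continuous m' := continuous_const.mul (hpar a ha)
  have hmd : ∀ r, HasDerivAt m (m' r) r := by
    intro r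
    refine (hasDerivAt_setIntegral_of_continuous hK hKm (u := fun r x => w x * F r x)
      (u' := fun r x => w x * a r x) ?_ ?_ (fun t x => (hd t x).const_mul _) r).const_mul _
    all_goals
      simp only [Function.uncurry_def] at *
      fun_prop
  have hmc : Continuous m := continuous_iff_continuousAt.2 fun r => (hmd r).continuousAt
  have hmW : ∀ r, ∫ x in K, w x * F r x ∂ν = W * m r := fun r => by
    simp only [hm]; field_simp
  have hmW' : ∀ r, ∫ x in K, w x * a r x ∂ν = W * m' r := fun r => by
    simp only [hm']; field_simp
  have hvar : ∀ (u : X → ℝ) (c : ℝ), Continuous u → ∫ x in K, w x * u x ∂ν = W * c →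
      ∫ x in K, w x * u x ^ 2 ∂ν = (∫ x in K, w x * (u x - c) ^ 2 ∂ν) + W * c ^ 2 := by
    intro u c hu hc
    have : ∀ x, w x * (u x - c) ^ 2 = w x * u x ^ 2 - 2 * c * (w x * u x) + c ^ 2 * w x :=
      fun x => by ring
    simp_rw [this]
    rw [integral_add (hint _ (by fun_prop)) (hint _ (by fun_prop)),
      integral_sub (hint _ (by fun_prop)) (hint _ (by fun_prop)), integral_const_mul,
      integral_const_mul, hc, hW]
    ring
  set G : ℝ → X → ℝ := fun r x => F r x - m r with hG
  set G' : ℝ → X → ℝ := fun r x => a r x - m' r with hG'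
  have hGc : Continuous (Function.uncurry G) := hF.sub (hmc.comp continuous_fst)
  have hG'c : Continuous (Function.uncurry G') := ha.sub (hm'c.comp continuous_fst)
  have hsq : ∀ u : ℝ → X → ℝ, Continuous (Function.uncurry u) →
      Continuous (Function.uncurry fun θ φ => u θ φ ^ 2) := by
    intro u hu
    simp only [Function.uncurry_def] at *
    fun_prop
  have hcG := hpar _ (hsq _ hGc)
  have hcG' := hpar _ (hsq _ hG'c)
  have hcP := hpar _ hP
  -- the angular part
  have key1 : (∫ r in (0:ℝ)..R, 2 * ∫ x in K, w x * G r x ^ 2 ∂ν) ≤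
      ∫ r in (0:ℝ)..R, r ^ 2 * ∫ x in K, w x * P r x ∂ν :=
    intervalIntegral.integral_mono_on_of_le_Ioo h0.le
      (Continuous.intervalIntegrable (by fun_prop) _ _)
      (Continuous.intervalIntegrable (by fun_prop) _ _) hang
  -- the radial operator on the nonradial part
  have key2 : (∫ r in (0:ℝ)..R, r ^ 2 * ∫ x in K, w x * G r x ^ 2 ∂ν) ≤
      (∫ r in (0:ℝ)..R, r ^ 2 * ∫ x in K, w x * G' r x ^ 2 ∂ν) +
        ∫ r in (0:ℝ)..R, 2 * ∫ x in K, w x * G r x ^ 2 ∂ν := by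
    have hle : (∫ x in K, w x * (∫ r in (0:ℝ)..R, r ^ 2 * G r x ^ 2) ∂ν) ≤
        ∫ x in K, w x * (∫ r in (0:ℝ)..R, (r ^ 2 * G' r x ^ 2 + 2 * G r x ^ 2)) ∂ν := by
      have hc : ∀ u : ℝ → X → ℝ, Continuous (Function.uncurry u) →
          Continuous fun x => w x * ∫ r in (0:ℝ)..R, u r x := fun u hu =>
        hw.mul (intervalIntegral.continuous_parametric_intervalIntegral_of_continuous'
          (f := fun x r => u r x) (hu.comp continuous_swap) _ _)
      apply setIntegral_mono_on (hint _ (hc _ ?_)) (hint _ (hc _ ?_)) hKm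
      · intro x hx
        refine mul_le_mul_of_nonneg_left ?_ (hw0 x hx)
        refine radial_hardy h0 hR hroot (g := fun r => G r x) (g' := fun r => G' r x)
          (fun r => (hd r x).sub (hmd r)) (hG'c.comp (by fun_prop : Continuous fun r => (r, x)))
      all_goals
        simp only [Function.uncurry_def] at *
        fun_prop
    have e1 := hswap (fun r x => r ^ 2 * G r x ^ 2) (by
      simp only [Function.uncurry_def] at *
      fun_prop)
    have e2 := hswap (fun r x => r ^ 2 * G' r x ^ 2 + 2 * G r x ^ 2) (by
      simp only [Function.uncurry_def] at *
      fun_prop)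
    rw [e1, e2] at hle
    rw [← intervalIntegral.integral_add (Continuous.intervalIntegrable (by fun_prop) _ _)
      (Continuous.intervalIntegrable (by fun_prop) _ _)]
    refine le_trans (le_of_eq ?_) (hle.trans (le_of_eq ?_))
    · simp_rw [mul_left_comm (w _), integral_const_mul]
    · congr 1 with r
      have hGr := hslice _ hGc r
      have hGr' := hslice _ hG'c r
      rw [← integral_const_mul, ← integral_const_mul, ← integral_add (hint _ (by fun_prop))
        (hint _ (by fun_prop))]
      congr 1 with x
      ring
  -- the radial part
  set M : ℝ := 3 / R ^ 3 * ∫ r in (0:ℝ)..R, r ^ 2 * m r with hM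
  have hMint : ∫ r in (0:ℝ)..R, r ^ 2 * m r = R ^ 3 / 3 * M := by
    rw [hM]; field_simp
  have hr2 : ∫ r in (0:ℝ)..R, r ^ 2 = R ^ 3 / 3 := by
    rw [integral_pow]; norm_num
  have hcM : ∫ r in (0:ℝ)..R, r ^ 2 * (m r - M) ^ 2 =
      (∫ r in (0:ℝ)..R, r ^ 2 * m r ^ 2) - R ^ 3 / 3 * M ^ 2 := by
    have : ∀ r, r ^ 2 * (m r - M) ^ 2 = r ^ 2 * m r ^ 2 - 2 * M * (r ^ 2 * m r) + M ^ 2 * r ^ 2 :=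
      fun r => by ring
    simp_rw [this]
    rw [intervalIntegral.integral_add (Continuous.intervalIntegrable (by fun_prop) _ _)
      (Continuous.intervalIntegrable (by fun_prop) _ _),
      intervalIntegral.integral_sub (Continuous.intervalIntegrable (by fun_prop) _ _)
      (Continuous.intervalIntegrable (by fun_prop) _ _), intervalIntegral.integral_const_mul,
      intervalIntegral.integral_const_mul, hMint, hr2]
    ring
  have key3 := radial_neumann h0 hR (g := fun r => m r - M) (fun r => (hmd r).sub_const M) hm'c (by
    simp_rw [mul_sub]
    rw [intervalIntegral.integral_sub (Continuous.intervalIntegrable (by fun_prop) _ _)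
      (Continuous.intervalIntegrable (by fun_prop) _ _), intervalIntegral.integral_mul_const,
      hMint, hr2]
    ring)
  rw [hcM] at key3
  have eF : ∫ r in (0:ℝ)..R, r ^ 2 * ∫ x in K, w x * F r x ^ 2 ∂ν =
      (∫ r in (0:ℝ)..R, r ^ 2 * ∫ x in K, w x * G r x ^ 2 ∂ν) +
        W * ∫ r in (0:ℝ)..R, r ^ 2 * m r ^ 2 := by
    rw [← intervalIntegral.integral_const_mul,
      ← intervalIntegral.integral_add (Continuous.intervalIntegrable (by fun_prop) _ _)
      (Continuous.intervalIntegrable (by fun_prop) _ _)]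
    congr 1 with r
    rw [hvar (F r) (m r) (hslice _ hF r) (hmW r)]
    ring
  have ea : ∫ r in (0:ℝ)..R, r ^ 2 * ∫ x in K, w x * (a r x ^ 2 + P r x) ∂ν =
      (∫ r in (0:ℝ)..R, r ^ 2 * ∫ x in K, w x * G' r x ^ 2 ∂ν) +
        W * (∫ r in (0:ℝ)..R, r ^ 2 * m' r ^ 2) +
        ∫ r in (0:ℝ)..R, r ^ 2 * ∫ x in K, w x * P r x ∂ν := by
    rw [← intervalIntegral.integral_const_mul,
      ← intervalIntegral.integral_add (Continuous.intervalIntegrable (by fun_prop) _ _)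
      (Continuous.intervalIntegrable (by fun_prop) _ _),
      ← intervalIntegral.integral_add (Continuous.intervalIntegrable (by fun_prop) _ _)
      (Continuous.intervalIntegrable (by fun_prop) _ _)]
    congr 1 with r
    have har := hslice _ ha r
    have hPr := hslice _ hP r
    simp_rw [mul_add (w _)]
    rw [integral_add (hint _ (by fun_prop)) (hint _ (by fun_prop)),
      hvar (a r) (m' r) har (hmW' r)]
    ring
  have em : 3 / (W * R ^ 3) * (∫ r in (0:ℝ)..R, r ^ 2 * ∫ x in K, w x * F r x ∂ν) ^ 2 =
      W * (R ^ 3 / 3 * M ^ 2) := by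
    simp_rw [hmW, mul_left_comm _ W, intervalIntegral.integral_const_mul, hMint]
    field_simp
  rw [eF, ea, em]
  have := mul_le_mul_of_nonneg_left key3 hWpos.le
  linarith

/-- Spherical coordinates `(r, (θ, φ))` on `ℝ³`, the polar axis being the coordinate `0`. -/
noncomputable def sphericalMap (r : ℝ) (ω : ℝ × ℝ) : EuclideanSpace ℝ (Fin 3) :=
  !₂[r * cos ω.1, r * sin ω.1 * cos ω.2, r * sin ω.1 * sin ω.2]

lemma continuous_sphericalMap : Continuous fun p : ℝ × ℝ × ℝ => sphericalMap p.1 p.2 := by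
  unfold sphericalMap
  refine (PiLp.continuous_toLp 2 _).comp (continuous_pi fun i => ?_)
  fin_cases i <;> simp <;> fun_prop

lemma norm_sphericalMap {r : ℝ} (hr : 0 ≤ r) (ω : ℝ × ℝ) : ‖sphericalMap r ω‖ = r := by
  rw [EuclideanSpace.norm_eq, Real.sqrt_eq_iff_mul_self_eq (by positivity) hr]
  simp only [sphericalMap, Fin.sum_univ_three, Real.norm_eq_abs, sq_abs]
  simp
  linear_combination (r ^ 2 * sin ω.1 ^ 2) * sin_sq_add_cos_sq ω.2 + r ^ 2 * sin_sq_add_cos_sq ω.1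

lemma lintegral_spherical {h : ℝ × ℝ × ℝ → ENNReal} (hh : Measurable h) :
    ∫⁻ p, h p = ∫⁻ p in Ioi (0:ℝ) ×ˢ (Ioo 0 π ×ˢ Ioo (-π) π),
      ENNReal.ofReal (p.1 ^ 2 * sin p.2.1) *
        h (p.1 * cos p.2.1, p.1 * sin p.2.1 * cos p.2.2, p.1 * sin p.2.1 * sin p.2.2) := by
  set k : ℝ × ℝ → ENNReal := (univ ×ˢ Ioi (0:ℝ)).indicator fun q =>
    ∫⁻ φ in Ioo (-π) π, ENNReal.ofReal q.2 * h (q.1, q.2 * cos φ, q.2 * sin φ) with hk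
  have hkm : Measurable k := by
    refine Measurable.indicator ?_ (MeasurableSet.univ.prod measurableSet_Ioi)
    refine Measurable.lintegral_prod_right' (f := fun p : (ℝ × ℝ) × ℝ =>
      ENNReal.ofReal p.1.2 * h (p.1.1, p.1.2 * cos p.2, p.1.2 * sin p.2)) ?_
    fun_prop
  have e1 : ∫⁻ p, h p = ∫⁻ q, k q := by
    rw [Measure.volume_eq_prod, lintegral_prod _ hh.aemeasurable, Measure.volume_eq_prod,
      lintegral_prod _ hkm.aemeasurable]
    congr 1 with z
    rw [← Measure.volume_eq_prod, ← lintegral_comp_polarCoord_symm, polarCoord_target,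
      Measure.volume_eq_prod, setLIntegral_prod _ (by
        simp only [polarCoord_symm_apply, smul_eq_mul]
        fun_prop), ← lintegral_indicator measurableSet_Ioi]
    congr 1 with ρ
    simp [hk, indicator, polarCoord_symm_apply]
  rw [e1, ← lintegral_comp_polarCoord_symm, polarCoord_target,
    Measure.volume_eq_prod, setLIntegral_prod _ (by
        simp only [polarCoord_symm_apply, smul_eq_mul]
        fun_prop), Measure.volume_eq_prod, setLIntegral_prod _ (by fun_prop)]
  refine setLIntegral_congr_fun measurableSet_Ioi fun r (hr : 0 < r) => ?_
  have hpi := pi_pos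
  rw [Measure.volume_eq_prod, setLIntegral_prod _ (by fun_prop),
    ← lintegral_indicator measurableSet_Ioo, ← lintegral_indicator measurableSet_Ioo]
  congr 1 with θ
  have hmem : θ ∈ Ioo (-π) π → (0 < sin θ ↔ θ ∈ Ioo 0 π) := by
    intro hθ
    refine ⟨fun hs => ⟨?_, hθ.2⟩, fun hs => sin_pos_of_pos_of_lt_pi hs.1 hs.2⟩
    by_contra hneg
    exact absurd (sin_nonpos_of_nonpos_of_neg_pi_le (not_lt.1 hneg) hθ.1.le) (not_le.2 hs)
  by_cases h1 : θ ∈ Ioo (-π) π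
  · by_cases h2 : θ ∈ Ioo 0 π
    · have hs := (hmem h1).2 h2
      have hrs : 0 < r * sin θ := by positivity
      simp only [indicator_of_mem h1, indicator_of_mem h2, hk, polarCoord_symm_apply]
      rw [indicator_of_mem (by simpa using hrs), smul_eq_mul, ← lintegral_const_mul _ (by fun_prop)]
      congr 1 with φ
      rw [← mul_assoc, ← ENNReal.ofReal_mul hr.le]
      ring_nf
    · have hs : ¬ 0 < r * sin θ := fun hc => h2 ((hmem h1).1 (by
        exact (pos_iff_pos_of_mul_pos hc).1 hr))
      simp only [indicator_of_mem h1, indicator_of_notMem h2, hk, polarCoord_symm_apply]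
      rw [indicator_of_notMem (by simpa using hs)]
      simp
  · rw [indicator_of_notMem h1, indicator_of_notMem]
    exact fun h2 => h1 ⟨by linarith [h2.1], h2.2⟩

lemma measurePreserving_vec3 :
    MeasurePreserving fun p : ℝ × ℝ × ℝ => (!₂[p.1, p.2.1, p.2.2] : EuclideanSpace ℝ (Fin 3)) := by
  have h1 := (MeasurePreserving.id (volume : Measure ℝ)).prod
    (volume_preserving_finTwoArrow ℝ).symm
  have h2 := (volume_preserving_piFinSuccAbove (fun _ : Fin 3 => ℝ) 0).symm
  have h3 := (PiLp.volume_preserving_toLp (Fin 3)).comp (h2.comp h1)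
  convert h3 using 1
  · ext p i
    fin_cases i <;> rfl
  · rfl

lemma lintegral_sphericalMap {h : EuclideanSpace ℝ (Fin 3) → ENNReal} (hh : Measurable h) :
    ∫⁻ x, h x = ∫⁻ p in Ioi (0:ℝ) ×ˢ (Ioo 0 π ×ˢ Ioo (-π) π),
      ENNReal.ofReal (p.1 ^ 2 * sin p.2.1) * h (sphericalMap p.1 p.2) := by
  rw [← measurePreserving_vec3.lintegral_comp hh,
    lintegral_spherical (h := fun p => h !₂[p.1, p.2.1, p.2.2])
      (hh.comp measurePreserving_vec3.measurable)]
  rfl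

lemma integral_ball_eq_spherical {h : EuclideanSpace ℝ (Fin 3) → ℝ} (hh : Continuous h) {R : ℝ}
    (hR : 0 ≤ R) :
    ∫ x in Metric.ball 0 R, h x = ∫ r in (0:ℝ)..R, r ^ 2 *
      ∫ ω in Icc (0:ℝ) π ×ˢ Icc (-π) π, sin ω.1 * h (sphericalMap r ω) := by
  have hpi := pi_pos
  set T : Set (ℝ × ℝ × ℝ) := Ioi (0:ℝ) ×ˢ (Ioo 0 π ×ˢ Ioo (-π) π) with hT
  have hTm : MeasurableSet T :=
    measurableSet_Ioi.prod (measurableSet_Ioo.prod measurableSet_Ioo)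
  set d : ℝ × ℝ × ℝ → ENNReal := fun p => ENNReal.ofReal (p.1 ^ 2 * sin p.2.1) with hd
  have hdm : Measurable d := by fun_prop
  have hS : Measurable fun p : ℝ × ℝ × ℝ => sphericalMap p.1 p.2 :=
    continuous_sphericalMap.measurable
  have hmap : ((volume.restrict T).withDensity d).map (fun p => sphericalMap p.1 p.2) = volume := by
    refine Measure.ext_of_lintegral _ fun g hg => ?_
    rw [lintegral_map hg hS, lintegral_sphericalMap hg]
    rw [lintegral_withDensity_eq_lintegral_mul _ hdm
      (g := fun p : ℝ × ℝ × ℝ => g (sphericalMap p.1 p.2)) (hg.comp hS)]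
    rfl
  have hind : Measurable ((Metric.ball 0 R).indicator h) :=
    hh.measurable.indicator measurableSet_ball
  rw [← integral_indicator measurableSet_ball]
  conv_lhs => rw [← hmap]
  rw [integral_map hS.aemeasurable hind.aestronglyMeasurable,
    integral_withDensity_eq_integral_toReal_smul hdm (by simp [hd])]
  have e1 : ∀ p ∈ T, (d p).toReal • (Metric.ball 0 R).indicator h (sphericalMap p.1 p.2) =
      (Iio R ×ˢ univ).indicator
        (fun p : ℝ × ℝ × ℝ => p.1 ^ 2 * (sin p.2.1 * h (sphericalMap p.1 p.2))) p := by
    rintro ⟨r, θ, φ⟩ ⟨hr : 0 < r, hθ : θ ∈ Ioo 0 π, -⟩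
    have hs := sin_pos_of_pos_of_lt_pi hθ.1 hθ.2
    simp only [hd, indicator, Metric.mem_ball, dist_zero_right, norm_sphericalMap hr.le]
    rw [ENNReal.toReal_ofReal (by positivity)]
    by_cases hrR : r < R <;> simp [hrR, mul_assoc]
  rw [setIntegral_congr_fun hTm e1, setIntegral_indicator (measurableSet_Iio.prod .univ),
    intervalIntegral.integral_of_le hR]
  have e2 : T ∩ Iio R ×ˢ univ = Ioo 0 R ×ˢ (Ioo 0 π ×ˢ Ioo (-π) π) := by
    rw [hT, prod_inter_prod, inter_univ]
    rfl
  have hc : Continuous fun p : ℝ × ℝ × ℝ => p.1 ^ 2 * (sin p.2.1 * h (sphericalMap p.1 p.2)) := by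
    have := hh.comp continuous_sphericalMap
    exact (by fun_prop : Continuous fun p : ℝ × ℝ × ℝ => p.1 ^ 2).mul
      ((by fun_prop : Continuous fun p : ℝ × ℝ × ℝ => sin p.2.1).mul this)
  rw [e2, Measure.volume_eq_prod, setIntegral_prod, ← integral_Ioc_eq_integral_Ioo]
  · congr 1 with r
    simp only
    rw [integral_const_mul]
    congr 1
    refine setIntegral_congr_set ?_
    rw [Measure.volume_eq_prod]
    exact Measure.set_prod_ae_eq Ioo_ae_eq_Icc Ioo_ae_eq_Icc
  · refine IntegrableOn.mono_set (t := Icc 0 R ×ˢ (Icc 0 π ×ˢ Icc (-π) π))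
      (hc.continuousOn.integrableOn_compact
        (isCompact_Icc.prod (isCompact_Icc.prod isCompact_Icc))) ?_
    exact prod_mono Ioo_subset_Icc_self (prod_mono Ioo_subset_Icc_self Ioo_subset_Icc_self)

lemma vec3_eq_sum (a b c : ℝ) : (!₂[a, b, c] : EuclideanSpace ℝ (Fin 3)) =
    a • EuclideanSpace.single 0 1 + b • EuclideanSpace.single 1 1 +
      c • EuclideanSpace.single 2 1 := by
  ext i
  fin_cases i <;> simp

lemma map_vec3 (L : EuclideanSpace ℝ (Fin 3) →L[ℝ] ℝ) (a b c : ℝ) : L !₂[a, b, c] =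
    a * L (EuclideanSpace.single 0 1) + b * L (EuclideanSpace.single 1 1) +
      c * L (EuclideanSpace.single 2 1) := by
  simp [vec3_eq_sum]

lemma hasDerivAt_vec3 {a b c : ℝ → ℝ} {a' b' c' t : ℝ} (ha : HasDerivAt a a' t)
    (hb : HasDerivAt b b' t) (hc : HasDerivAt c c' t) :
    HasDerivAt (fun s => (!₂[a s, b s, c s] : EuclideanSpace ℝ (Fin 3))) !₂[a', b', c'] t := by
  simp only [vec3_eq_sum]
  exact ((ha.smul_const _).add (hb.smul_const _)).add (hc.smul_const _)

lemma continuous_vec3 {X : Type*} [TopologicalSpace X] {a b c : X → ℝ} (ha : Continuous a)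
    (hb : Continuous b) (hc : Continuous c) :
    Continuous fun s => (!₂[a s, b s, c s] : EuclideanSpace ℝ (Fin 3)) := by
  simp only [vec3_eq_sum]
  fun_prop

lemma setIntegral_box_eq {u : ℝ × ℝ → ℝ} (hu : Continuous u) :
    ∫ ω in Icc (0:ℝ) π ×ˢ Icc (-π) π, sin ω.1 * u ω =
      ∫ θ in (0:ℝ)..π, sin θ * ∫ φ in (-π)..π, u (θ, φ) := by
  have hpi := pi_pos
  rw [Measure.volume_eq_prod, setIntegral_prod, integral_Icc_eq_integral_Ioc,
    ← intervalIntegral.integral_of_le hpi.le]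
  · congr 1 with θ
    rw [integral_Icc_eq_integral_Ioc, ← intervalIntegral.integral_of_le (by linarith)]
    exact intervalIntegral.integral_const_mul (sin θ) (fun φ => u (θ, φ))
  · exact ContinuousOn.integrableOn_compact (isCompact_Icc.prod isCompact_Icc)
      (by fun_prop : Continuous fun ω : ℝ × ℝ => sin ω.1 * u ω).continuousOn

lemma setIntegral_box_sin : ∫ ω in Icc (0:ℝ) π ×ˢ Icc (-π) π, sin ω.1 = 4 * π := by
  have := setIntegral_box_eq (u := fun _ => 1) continuous_const
  simp only [mul_one] at this
  rw [this]
  simp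
  ring

/-- The Poincaré inequality on the ball of radius `R`, where `R` is the first
critical point of the spherical Bessel function `j₁`. -/
lemma poincare_ball_zero {R : ℝ} (h0 : 0 < R) (hR : R < π)
    (hroot : R ^ 2 * sin R = 2 * besselNum R)
    {f : EuclideanSpace ℝ (Fin 3) → ℝ} (hf : ContDiff ℝ 1 f) :
    (∫ x in Metric.ball 0 R, f x ^ 2) -
        3 / (4 * π * R ^ 3) * (∫ x in Metric.ball 0 R, f x) ^ 2 ≤
      ∫ x in Metric.ball 0 R, ∑ i, fderiv ℝ f x (EuclideanSpace.single i 1) ^ 2 := by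
  have hpi := pi_pos
  have hfc := hf.continuous
  have hfd : Continuous (fderiv ℝ f) := hf.continuous_fderiv (by norm_num)
  have hdiff : ∀ x, HasFDerivAt f (fderiv ℝ f x) x := fun x =>
    ((hf.differentiable (by norm_num)) x).hasFDerivAt
  set eθ : ℝ × ℝ → EuclideanSpace ℝ (Fin 3) := fun ω =>
    !₂[-sin ω.1, cos ω.1 * cos ω.2, cos ω.1 * sin ω.2] with heθ
  set eφ : ℝ × ℝ → EuclideanSpace ℝ (Fin 3) := fun ω => !₂[0, -sin ω.2, cos ω.2] with heφ
  have ceθ : Continuous eθ := continuous_vec3 (by fun_prop) (by fun_prop) (by fun_prop)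
  have ceφ : Continuous eφ := continuous_vec3 (by fun_prop) (by fun_prop) (by fun_prop)
  set F : ℝ → ℝ × ℝ → ℝ := fun r ω => f (sphericalMap r ω) with hF
  set a : ℝ → ℝ × ℝ → ℝ := fun r ω => fderiv ℝ f (sphericalMap r ω) (sphericalMap 1 ω) with ha
  set b : ℝ → ℝ × ℝ → ℝ := fun r ω => fderiv ℝ f (sphericalMap r ω) (eθ ω) with hb
  set c : ℝ → ℝ × ℝ → ℝ := fun r ω => fderiv ℝ f (sphericalMap r ω) (eφ ω) with hc
  have hD : Continuous fun p : ℝ × ℝ × ℝ => fderiv ℝ f (sphericalMap p.1 p.2) :=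
    hfd.comp continuous_sphericalMap
  have cF : Continuous (Function.uncurry F) := hfc.comp continuous_sphericalMap
  have ca : Continuous (Function.uncurry a) := hD.clm_apply
    (continuous_sphericalMap.comp (by fun_prop : Continuous fun p : ℝ × ℝ × ℝ => ((1:ℝ), p.2)))
  have cb : Continuous (Function.uncurry b) := hD.clm_apply (ceθ.comp continuous_snd)
  have cc : Continuous (Function.uncurry c) := hD.clm_apply (ceφ.comp continuous_snd)
  have hr : ∀ r ω, HasDerivAt (fun s => F s ω) (a r ω) r := by
    intro r ω
    refine (hdiff _).comp_hasDerivAt r (f := fun s => sphericalMap s ω) ?_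
    unfold sphericalMap
    refine hasDerivAt_vec3 ?_ ?_ ?_
    · simpa using (hasDerivAt_id r).mul_const (cos ω.1)
    · simpa using ((hasDerivAt_id r).mul_const (sin ω.1)).mul_const (cos ω.2)
    · simpa using ((hasDerivAt_id r).mul_const (sin ω.1)).mul_const (sin ω.2)
  have hθ : ∀ r θ φ, HasDerivAt (fun s => F r (s, φ)) (r * b r (θ, φ)) θ := by
    intro r θ φ
    have h1 : HasDerivAt (fun s => sphericalMap r (s, φ)) (r • eθ (θ, φ)) θ := by
      unfold sphericalMap
      have : r • eθ (θ, φ) = !₂[r * -sin θ, r * cos θ * cos φ, r * cos θ * sin φ] := by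
        ext i
        fin_cases i <;> simp [heθ, mul_assoc]
      rw [this]
      exact hasDerivAt_vec3 ((hasDerivAt_cos θ).const_mul r)
        (((hasDerivAt_sin θ).const_mul r).mul_const (cos φ))
        (((hasDerivAt_sin θ).const_mul r).mul_const (sin φ))
    have := (hdiff _).comp_hasDerivAt θ h1
    rwa [map_smul] at this
  have hφ : ∀ r θ φ, HasDerivAt (fun s => F r (θ, s)) (sin θ * (r * c r (θ, φ))) φ := by
    intro r θ φ
    have h1 : HasDerivAt (fun s => sphericalMap r (θ, s)) ((sin θ * r) • eφ (θ, φ)) φ := by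
      unfold sphericalMap
      have : (sin θ * r) • eφ (θ, φ) = !₂[0, r * sin θ * -sin φ, r * sin θ * cos φ] := by
        ext i
        fin_cases i <;> simp [heφ, mul_comm r]
      rw [this]
      exact hasDerivAt_vec3 (hasDerivAt_const φ (r * cos θ))
        ((hasDerivAt_cos φ).const_mul (r * sin θ))
        ((hasDerivAt_sin φ).const_mul (r * sin θ))
    have := (hdiff _).comp_hasDerivAt φ h1
    rwa [map_smul, smul_eq_mul, mul_assoc] at this
  have hgrad : ∀ r ω, ∑ i, fderiv ℝ f (sphericalMap r ω) (EuclideanSpace.single i 1) ^ 2 =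
      a r ω ^ 2 + (b r ω ^ 2 + c r ω ^ 2) := by
    intro r ω
    simp only [ha, hb, hc, heθ, heφ]
    generalize fderiv ℝ f (sphericalMap r ω) = L
    simp only [sphericalMap, map_vec3, Fin.sum_univ_three, one_mul]
    have h1 := sin_sq_add_cos_sq ω.1
    have h2 := sin_sq_add_cos_sq ω.2
    generalize L (EuclideanSpace.single 0 1) = x
    generalize L (EuclideanSpace.single 1 1) = y
    generalize L (EuclideanSpace.single 2 1) = z
    generalize sin ω.1 = s at *
    generalize cos ω.1 = k at *
    generalize sin ω.2 = t at *
    generalize cos ω.2 = q at *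
    have e : (k * x + s * q * y + s * t * z) ^ 2 + ((-s * x + k * q * y + k * t * z) ^ 2 +
      (0 * x + -t * y + q * z) ^ 2) = (s ^ 2 + k ^ 2) * (x ^ 2 + (q * y + t * z) ^ 2) +
        (q * z - t * y) ^ 2 := by ring
    rw [e, h1]
    linear_combination (-(y ^ 2 + z ^ 2)) * h2
  have hslice : ∀ u : ℝ → ℝ × ℝ → ℝ, Continuous (Function.uncurry u) → ∀ r, Continuous (u r) :=
    fun u hu r => hu.comp (by fun_prop : Continuous fun x => (r, x))
  have key := poincare_of_angular (ν := volume) (K := Icc (0:ℝ) π ×ˢ Icc (-π) π)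
    (isCompact_Icc.prod isCompact_Icc) (measurableSet_Icc.prod measurableSet_Icc)
    (w := fun ω => sin ω.1) (by fun_prop)
    (fun x hx => sin_nonneg_of_nonneg_of_le_pi hx.1.1 hx.1.2) setIntegral_box_sin (by positivity)
    h0 hR hroot (F := F) (a := a) (P := fun r ω => b r ω ^ 2 + c r ω ^ 2) cF ca
    (by simp only [Function.uncurry_def] at *; fun_prop) hr (by
      intro r hr0
      set m : ℝ := (4 * π)⁻¹ * ∫ y in Icc (0:ℝ) π ×ˢ Icc (-π) π, sin y.1 * F r y with hm
      have cFr := hslice F cF r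
      have cbr := hslice b cb r
      have ccr := hslice c cc r
      have hsp := sphere_poincare (g := fun θ φ => F r (θ, φ) - m) (β := fun θ φ => r * b r (θ, φ))
        (γ := fun θ φ => r * c r (θ, φ)) (by simp only [Function.uncurry_def]; fun_prop)
        (by simp only [Function.uncurry_def]; fun_prop)
        (by simp only [Function.uncurry_def]; fun_prop) (fun θ φ => (hθ r θ φ).sub_const m)
        (fun θ φ => (hφ r θ φ).sub_const m) (fun θ => by simp [hF, sphericalMap]) (by
          rw [← setIntegral_box_eq (u := fun ω => F r ω - m) (by fun_prop)]
          simp_rw [mul_sub]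
          rw [integral_sub, integral_mul_const, setIntegral_box_sin, hm]
          · field_simp
            ring
          · exact ContinuousOn.integrableOn_compact (isCompact_Icc.prod isCompact_Icc)
              (by fun_prop : Continuous fun ω : ℝ × ℝ => sin ω.1 * F r ω).continuousOn
          · exact ContinuousOn.integrableOn_compact (isCompact_Icc.prod isCompact_Icc)
              (by fun_prop : Continuous fun ω : ℝ × ℝ => sin ω.1 * m).continuousOn)
      rw [← setIntegral_box_eq (u := fun ω => (F r ω - m) ^ 2) (by fun_prop),
        ← setIntegral_box_eq (u := fun ω => (r * b r ω) ^ 2 + (r * c r ω) ^ 2) (by fun_prop)] at hsp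
      refine hsp.trans (le_of_eq ?_)
      rw [← integral_const_mul]
      congr 1 with ω
      ring)
  rw [integral_ball_eq_spherical (h := fun x => f x ^ 2) (by fun_prop) h0.le,
    integral_ball_eq_spherical hfc h0.le, integral_ball_eq_spherical
      (h := fun x => ∑ i, fderiv ℝ f x (EuclideanSpace.single i 1) ^ 2) (by fun_prop) h0.le]
  simp_rw [hgrad]
  exact key

lemma deriv_deriv_sin_div {y : ℝ} (hy : 0 < y) :
    deriv (deriv fun x : ℝ => sin x / x) y = (2 * besselNum y - y ^ 2 * sin y) / y ^ 3 := by
  have h1 : ∀ x : ℝ, 0 < x →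
      HasDerivAt (fun x : ℝ => sin x / x) ((cos x * x - sin x * 1) / x ^ 2) x := fun x hx =>
    (hasDerivAt_sin x).div (hasDerivAt_id x) hx.ne'
  have h2 : deriv (fun x : ℝ => sin x / x) =ᶠ[nhds y] fun x => (cos x * x - sin x * 1) / x ^ 2 := by
    filter_upwards [lt_mem_nhds hy] with x hx using (h1 x hx).deriv
  rw [h2.deriv_eq]
  have h3 := ((((hasDerivAt_cos y).mul (hasDerivAt_id y)).sub
    ((hasDerivAt_sin y).mul_const 1)).div ((hasDerivAt_id y).pow 2) (by simpa using hy.ne'))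
  refine (HasDerivAt.deriv h3).trans ?_
  simp [besselNum]
  field_simp
  ring

lemma root_lt_pi {ξ : ℝ}
    (hmin : ∀ y : ℝ, 0 < y → deriv (deriv (fun x : ℝ => sin x / x)) y = 0 → ξ ≤ y) : ξ < π := by
  have hpi := pi_gt_three
  have hc : ContinuousOn (fun y => 2 * besselNum y - y ^ 2 * sin y) (Icc (π / 2) π) := by
    have := continuous_besselNum
    fun_prop
  obtain ⟨y, hy, hy0⟩ := intermediate_value_Icc (by linarith) hc (show (0:ℝ) ∈ Icc _ _ by
    constructor
    · simp [besselNum]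
      nlinarith
    · simp [besselNum]
      linarith)
  refine (hmin y (by linarith [hy.1]) ?_).trans_lt (lt_of_le_of_ne hy.2 ?_)
  · rw [deriv_deriv_sin_div (by linarith [hy.1])]
    simp only at hy0
    rw [hy0, zero_div]
  · rintro rfl
    simp [besselNum] at hy0

lemma root_equation {ξ : ℝ} (h0 : 0 < ξ)
    (hroot : deriv (deriv (fun x : ℝ => sin x / x)) ξ = 0) : ξ ^ 2 * sin ξ = 2 * besselNum ξ := by
  rw [deriv_deriv_sin_div h0, div_eq_zero_iff] at hroot
  rcases hroot with h | h
  · linarith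
  · exact absurd h (by positivity)

lemma setIntegral_ball_comp_affine (h : EuclideanSpace ℝ (Fin 3) → ℝ)
    (c : EuclideanSpace ℝ (Fin 3)) {s R : ℝ} (hs : 0 < s) :
    ∫ x in Metric.ball 0 R, h (c + s • x) = (s ^ 3)⁻¹ * ∫ x in Metric.ball c (s * R), h x := by
  have h1 := Measure.setIntegral_comp_smul_of_pos (volume : Measure (EuclideanSpace ℝ (Fin 3)))
    (fun x => h (c + x)) (Metric.ball 0 R) hs
  rw [smul_ball hs.ne', smul_zero, Real.norm_of_nonneg hs.le, finrank_euclideanSpace_fin,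
    smul_eq_mul] at h1
  rw [h1, ← (measurePreserving_add_left volume c).setIntegral_preimage_emb
    (measurableEmbedding_addLeft c) h (Metric.ball c (s * R))]
  congr 2
  ext x
  simp

lemma poincare_ball {ξ : ℝ} (h0 : 0 < ξ) (hξπ : ξ < π)
    (hroot : ξ ^ 2 * sin ξ = 2 * besselNum ξ) {ℓ : ℝ} (hℓ : 0 < ℓ)
    (c : EuclideanSpace ℝ (Fin 3)) {f : EuclideanSpace ℝ (Fin 3) → ℝ} (hf : ContDiff ℝ 1 f) :
    (∫ x in Metric.ball c ℓ, f x ^ 2) -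
        (volume.real (Metric.ball c ℓ))⁻¹ * (∫ x in Metric.ball c ℓ, f x) ^ 2 ≤
      ℓ ^ 2 / ξ ^ 2 *
        ∫ x in Metric.ball c ℓ, ∑ i, fderiv ℝ f x (EuclideanSpace.single i 1) ^ 2 := by
  have hpi := pi_pos
  set s : ℝ := ℓ / ξ with hs
  have hs0 : 0 < s := by positivity
  have hsξ : s * ξ = ℓ := by rw [hs]; field_simp
  have key := poincare_ball_zero h0 hξπ hroot (f := fun x => f (c + s • x))
    (hf.comp (by fun_prop))
  have hfd : ∀ x v, fderiv ℝ (fun x => f (c + s • x)) x v = s * fderiv ℝ f (c + s • x) v := by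
    intro x v
    have h1 : HasFDerivAt (fun x : EuclideanSpace ℝ (Fin 3) => c + s • x)
        (s • ContinuousLinearMap.id ℝ _) x := ((hasFDerivAt_id x).const_smul s).const_add c
    have h2 := ((hf.differentiable (by norm_num)) (c + s • x)).hasFDerivAt.comp x h1
    rw [show (fun x => f (c + s • x)) = f ∘ fun x => c + s • x from rfl, h2.fderiv]
    simp
  simp_rw [hfd, mul_pow, ← Finset.mul_sum] at key
  rw [integral_const_mul, setIntegral_ball_comp_affine (fun x => f x ^ 2) c hs0,
    setIntegral_ball_comp_affine f c hs0, setIntegral_ball_comp_affine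
      (fun x => ∑ i, fderiv ℝ f x (EuclideanSpace.single i 1) ^ 2) c hs0, hsξ] at key
  have hvol : volume.real (Metric.ball c ℓ) = 4 * π * ℓ ^ 3 / 3 := by
    rw [Measure.real, EuclideanSpace.volume_ball_fin_three, ENNReal.toReal_mul,
      ENNReal.toReal_pow, ENNReal.toReal_ofReal hℓ.le, ENNReal.toReal_ofReal (by positivity)]
    ring
  rw [hvol]
  have := mul_le_mul_of_nonneg_left key (pow_pos hs0 3).le
  refine (le_of_eq ?_).trans (this.trans (le_of_eq ?_))
  · rw [← hsξ]
    field_simp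
  · rw [hs]
    field_simp

section Projection

variable {E : Type*} [MeasurableSpace E] {μ : Measure E} {n : ℕ}

/-- Averaging over the `j`-th variable. -/
noncomputable def averageAt (μ : Measure E) (j : Fin n) (u : (Fin n → E) → ℝ) (x : Fin n → E) : ℝ :=
  ∫ y, u (Function.update x j y) ∂μ

lemma averageAt_update (j : Fin n) (u : (Fin n → E) → ℝ) (x : Fin n → E) (y : E) :
    averageAt μ j u (Function.update x j y) = averageAt μ j u x := by
  simp [averageAt]

variable [IsProbabilityMeasure μ]

lemma measurePreserving_update (j : Fin n) :
    MeasurePreserving (fun p : (Fin n → E) × E => Function.update p.1 j p.2)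
      ((Measure.pi fun _ => μ).prod μ) (Measure.pi fun _ => μ) := by
  have hm : Measurable fun p : (Fin n → E) × E => Function.update p.1 j p.2 := by
    refine measurable_pi_lambda _ fun i => ?_
    by_cases hij : i = j
    · subst hij
      simpa using measurable_snd
    · simp only [Function.update_of_ne hij]
      fun_prop
  refine ⟨hm, (Measure.pi_eq fun s hs => ?_).symm⟩
  rw [Measure.map_apply hm (MeasurableSet.univ_pi hs)]
  have hpre : (fun p : (Fin n → E) × E => Function.update p.1 j p.2) ⁻¹' univ.pi s =
      (univ.pi (Function.update s j univ)) ×ˢ s j := by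
    ext ⟨x, y⟩
    simp only [mem_preimage, mem_univ_pi, mem_prod]
    constructor
    · refine fun h => ⟨fun i => ?_, by simpa using h j⟩
      by_cases hij : i = j
      · subst hij
        simp
      · simpa [hij] using h i
    · rintro ⟨h, hy⟩ i
      by_cases hij : i = j
      · subst hij
        simpa using hy
      · simpa [hij] using h i
  rw [hpre, Measure.prod_prod, Measure.pi_pi, ← Finset.prod_erase_mul _ _ (Finset.mem_univ j),
    ← Finset.prod_erase_mul _ (fun i => μ (s i)) (Finset.mem_univ j)]
  simp only [Function.update_self, measure_univ, mul_one]
  congr 1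
  refine Finset.prod_congr rfl fun i hi => ?_
  rw [Function.update_of_ne (Finset.ne_of_mem_erase hi)]

variable [NormedAddCommGroup E] [BorelSpace E] [SecondCountableTopology E] {K : Set E}

lemma integrable_pi_of_continuous (hK : IsCompact K) (hμ : μ Kᶜ = 0) {u : (Fin n → E) → ℝ}
    (hu : Continuous u) : Integrable u (Measure.pi fun _ => μ) := by
  have hr : μ.restrict K = μ := Measure.restrict_eq_self_of_ae_mem (mem_ae_iff.2 hμ)
  have hp : (Measure.pi fun _ : Fin n => μ).restrict (univ.pi fun _ => K) =
      Measure.pi fun _ => μ := by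
    rw [Measure.restrict_pi_pi, hr]
  rw [← hp]
  exact hu.continuousOn.integrableOn_compact (isCompact_univ_pi fun _ => hK)

lemma integral_averageAt (hK : IsCompact K) (hμ : μ Kᶜ = 0) (j : Fin n)
    {u : (Fin n → E) → ℝ} (hu : Continuous u) :
    ∫ x, averageAt μ j u x ∂(Measure.pi fun _ => μ) = ∫ x, u x ∂(Measure.pi fun _ => μ) := by
  have hmp := measurePreserving_update (μ := μ) j
  have hi := integrable_pi_of_continuous hK hμ hu
  have h2 : Integrable (fun p : (Fin n → E) × E => u (Function.update p.1 j p.2))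
      ((Measure.pi fun _ => μ).prod μ) := hmp.integrable_comp_of_integrable hi
  calc _ = ∫ p, u (Function.update p.1 j p.2) ∂((Measure.pi fun _ => μ).prod μ) :=
        (integral_prod _ h2).symm
    _ = _ := by
        conv_rhs => rw [← hmp.map_eq]
        rw [integral_map hmp.measurable.aemeasurable hu.aestronglyMeasurable]

lemma integral_mul_of_update (hK : IsCompact K) (hμ : μ Kᶜ = 0) (j : Fin n)
    {u v : (Fin n → E) → ℝ} (hu : Continuous u) (hv : Continuous v)
    (hvj : ∀ x y, v (Function.update x j y) = v x) :
    ∫ x, u x * v x ∂(Measure.pi fun _ => μ) =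
      ∫ x, averageAt μ j u x * v x ∂(Measure.pi fun _ => μ) := by
  rw [← integral_averageAt hK hμ j (by fun_prop : Continuous fun x => u x * v x)]
  congr 1 with x
  simp only [averageAt, hvj, integral_mul_const]

lemma averageAt_averageAt_of_antisymm (hK : IsCompact K) (hμ : μ Kᶜ = 0) {i j : Fin n}
    (hij : i ≠ j) {u : (Fin n → E) → ℝ} (hu : Continuous u)
    (hanti : ∀ x, u (x ∘ Equiv.swap i j) = -u x) (x : Fin n → E) :
    averageAt μ j (averageAt μ i u) x = 0 := by
  set g : E → E → ℝ := fun y z => u (Function.update (Function.update x j y) i z) with hg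
  have hgc : Continuous (Function.uncurry g) := by
    simp only [hg, Function.uncurry_def]
    fun_prop
  have hasymm : ∀ y z, g y z = -g z y := by
    intro y z
    rw [hg]
    simp only
    rw [← hanti]
    congr 1
    ext k
    by_cases hki : k = i
    · subst hki
      simp [hij.symm]
    · by_cases hkj : k = j
      · subst hkj
        simp [hki]
      · simp [Function.update_of_ne, hki, hkj, Equiv.swap_apply_of_ne_of_ne]
  have hr : μ.restrict K = μ := Measure.restrict_eq_self_of_ae_mem (mem_ae_iff.2 hμ)
  have hint : Integrable (Function.uncurry g) (μ.prod μ) := by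
    rw [← hr, Measure.prod_restrict]
    exact hgc.continuousOn.integrableOn_compact (hK.prod hK)
  have h1 : ∫ y, ∫ z, g y z ∂μ ∂μ = -∫ y, ∫ z, g y z ∂μ ∂μ := by
    conv_lhs => rw [integral_integral_swap hint]
    simp_rw [← integral_neg, ← hasymm]
  change ∫ y, ∫ z, g y z ∂μ ∂μ = 0
  linarith

variable [LocallyCompactSpace E]

lemma continuous_averageAt (hK : IsCompact K) (hμ : μ Kᶜ = 0) (j : Fin n)
    {u : (Fin n → E) → ℝ} (hu : Continuous u) : Continuous (averageAt μ j u) := by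
  have hr : μ.restrict K = μ := Measure.restrict_eq_self_of_ae_mem (mem_ae_iff.2 hμ)
  have h := continuous_parametric_integral_of_continuous (μ := μ)
    (f := fun (x : Fin n → E) (y : E) => u (Function.update x j y))
    (by simp only [Function.uncurry_def]; fun_prop) hK
  rwa [hr] at h

/-- For an antisymmetric function the averages in the different variables are orthogonal, whence
a Bessel inequality. -/
lemma sum_integral_averageAt_sq_le (hK : IsCompact K) (hμ : μ Kᶜ = 0)
    {u : (Fin n → E) → ℝ} (hu : Continuous u)
    (hanti : ∀ i j, i ≠ j → ∀ x, u (x ∘ Equiv.swap i j) = -u x) :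
    ∑ j, ∫ x, averageAt μ j u x ^ 2 ∂(Measure.pi fun _ => μ) ≤
      ∫ x, u x ^ 2 ∂(Measure.pi fun _ => μ) := by
  have hc := fun j => continuous_averageAt hK hμ j hu
  have hint : ∀ v : (Fin n → E) → ℝ, Continuous v → Integrable v (Measure.pi fun _ => μ) :=
    fun v hv => integrable_pi_of_continuous hK hμ hv
  have hdiag : ∀ j, ∫ x, u x * averageAt μ j u x ∂(Measure.pi fun _ => μ) =
      ∫ x, averageAt μ j u x ^ 2 ∂(Measure.pi fun _ => μ) := by
    intro j
    rw [integral_mul_of_update hK hμ j hu (hc j) (averageAt_update j u)]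
    simp_rw [sq]
  have hoff : ∀ i j, i ≠ j →
      ∫ x, averageAt μ i u x * averageAt μ j u x ∂(Measure.pi fun _ => μ) = 0 := by
    intro i j hij
    rw [integral_mul_of_update hK hμ j (hc i) (hc j) (averageAt_update j u)]
    simp [averageAt_averageAt_of_antisymm hK hμ hij hu (hanti i j hij)]
  have hpos : 0 ≤ ∫ x, (u x - ∑ j, averageAt μ j u x) ^ 2 ∂(Measure.pi fun _ => μ) :=
    integral_nonneg fun x => sq_nonneg _
  have hexp : ∀ x, (u x - ∑ j, averageAt μ j u x) ^ 2 = u x ^ 2 -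
      2 * ∑ j, u x * averageAt μ j u x + ∑ i, ∑ j, averageAt μ i u x * averageAt μ j u x := by
    intro x
    rw [← Finset.mul_sum, ← Finset.sum_mul_sum]
    ring
  simp_rw [hexp] at hpos
  rw [integral_add (hint _ (by fun_prop)) (hint _ (by fun_prop)),
    integral_sub (hint _ (by fun_prop)) (hint _ (by fun_prop)), integral_const_mul,
    integral_finsetSum _ (fun j _ => hint _ (by fun_prop)),
    integral_finsetSum _ (fun j _ => hint _ (by fun_prop))] at hpos
  simp_rw [hdiag] at hpos
  have hdd : ∀ i, ∫ x, ∑ j, averageAt μ i u x * averageAt μ j u x ∂(Measure.pi fun _ => μ) =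
      ∫ x, averageAt μ i u x ^ 2 ∂(Measure.pi fun _ => μ) := by
    intro i
    rw [integral_finsetSum _ (fun j _ => hint _ (by fun_prop)),
      Finset.sum_eq_single i (fun j _ hj => hoff i j hj.symm) (by simp)]
    simp_rw [sq]
  simp_rw [hdd] at hpos
  linarith

end Projection

/-- A Poincaré inequality for one particle gives an exclusion bound for `n` fermions. -/
lemma exclusion_of_poincare {E ι : Type*} [Fintype ι] [NormedAddCommGroup E] [NormedSpace ℝ E]
    [MeasurableSpace E] [BorelSpace E]
    [SecondCountableTopology E] [LocallyCompactSpace E] {μ : Measure E} [IsProbabilityMeasure μ]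
    {n : ℕ} {K : Set E} (hK : IsCompact K) (hμ : μ Kᶜ = 0) (e : ι → E) {κ : ℝ}
    (hP : ∀ f : E → ℝ, ContDiff ℝ 1 f →
      (∫ y, f y ^ 2 ∂μ) - (∫ y, f y ∂μ) ^ 2 ≤ κ * ∫ y, ∑ i, fderiv ℝ f y (e i) ^ 2 ∂μ)
    {u : (Fin n → E) → ℝ} (hu : ContDiff ℝ 1 u)
    (hanti : ∀ i j, i ≠ j → ∀ x, u (x ∘ Equiv.swap i j) = -u x) :
    ((n : ℝ) - 1) * ∫ x, u x ^ 2 ∂(Measure.pi fun _ => μ) ≤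
      κ * ∫ x, ∑ j, ∑ i, fderiv ℝ u x (Pi.single j (e i)) ^ 2 ∂(Measure.pi fun _ => μ) := by
  have huc := hu.continuous
  have hud : Continuous (fderiv ℝ u) := hu.continuous_fderiv (by norm_num)
  have hc := fun j => continuous_averageAt hK hμ j huc
  have hint : ∀ v : (Fin n → E) → ℝ, Continuous v → Integrable v (Measure.pi fun _ => μ) :=
    fun v hv => integrable_pi_of_continuous hK hμ hv
  have hj : ∀ j, (∫ x, u x ^ 2 ∂(Measure.pi fun _ => μ)) -
      ∫ x, averageAt μ j u x ^ 2 ∂(Measure.pi fun _ => μ) ≤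
        κ * ∫ x, ∑ i, fderiv ℝ u x (Pi.single j (e i)) ^ 2 ∂(Measure.pi fun _ => μ) := by
    intro j
    have c1 : Continuous fun x => u x ^ 2 := by fun_prop
    have c2 : Continuous fun x => ∑ i, fderiv ℝ u x (Pi.single j (e i)) ^ 2 := by fun_prop
    rw [← integral_averageAt hK hμ j c1, ← integral_averageAt hK hμ j c2,
      ← integral_sub (hint _ (continuous_averageAt hK hμ j c1)) (hint _ (by fun_prop)),
      ← integral_const_mul]
    refine integral_mono ((hint _ (continuous_averageAt hK hμ j c1)).sub (hint _ (by fun_prop)))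
      ((hint _ (continuous_averageAt hK hμ j c2)).const_mul κ) fun x => ?_
    have h := hP (fun y => u (Function.update x j y)) (hu.comp (contDiff_update 1 x j))
    have hfd : ∀ y v, fderiv ℝ (fun y => u (Function.update x j y)) y v =
        fderiv ℝ u (Function.update x j y) (Pi.single j v) := by
      intro y v
      have h2 := ((hu.differentiable (by norm_num)) (Function.update x j y)).hasFDerivAt.comp y
        (hasFDerivAt_update x y)
      rw [show (fun y => u (Function.update x j y)) = u ∘ Function.update x j from rfl, h2.fderiv]
      simp only [ContinuousLinearMap.comp_apply]
      congr 1
      ext k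
      by_cases hk : k = j
      · subst hk
        simp
      · simp [hk]
    simp_rw [hfd] at h
    exact h
  have hsum := Finset.sum_le_sum fun j (_ : j ∈ Finset.univ) => hj j
  rw [Finset.sum_sub_distrib, ← Finset.mul_sum] at hsum
  rw [integral_finsetSum _ (fun j _ => hint _ (by fun_prop))]
  simp only [Finset.sum_const, Finset.card_univ, Fintype.card_fin, nsmul_eq_mul] at hsum
  have hb := sum_integral_averageAt_sq_le hK hμ huc hanti
  linarith

lemma volume_restrict_pi_eq_smul {n : ℕ} {B : Set (EuclideanSpace ℝ (Fin 3))}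
    (h0 : volume B ≠ 0) (htop : volume B ≠ ⊤) :
    (volume : Measure (Fin n → EuclideanSpace ℝ (Fin 3))).restrict (univ.pi fun _ => B) =
      volume B ^ n • Measure.pi fun _ => (volume B)⁻¹ • volume.restrict B := by
  have : IsFiniteMeasure ((volume B)⁻¹ • volume.restrict B) := by
    constructor
    simpa using ENNReal.mul_lt_top (ENNReal.inv_lt_top.2 h0.bot_lt) htop.lt_top
  rw [volume_pi, Measure.restrict_pi_pi]
  refine (Measure.pi_eq fun s hs => ?_)
  simp only [Measure.smul_apply, Measure.pi_pi, smul_eq_mul]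
  rw [Finset.prod_mul_distrib, Finset.prod_const, Finset.card_univ, Fintype.card_fin, ← mul_assoc,
    ← mul_pow, ENNReal.mul_inv_cancel h0 htop, one_pow, one_mul]

/-- The exclusion bound for real antisymmetric functions on a ball. -/
lemma exclusion_real {n : ℕ} {ℓ : ℝ} (hℓ : 0 < ℓ) (c : EuclideanSpace ℝ (Fin 3)) {ξ : ℝ}
    (h0 : 0 < ξ) (hξπ : ξ < π) (hroot : ξ ^ 2 * sin ξ = 2 * besselNum ξ)
    {u : (Fin n → EuclideanSpace ℝ (Fin 3)) → ℝ} (hu : ContDiff ℝ 1 u)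
    (hanti : ∀ i j, i ≠ j → ∀ x, u (x ∘ Equiv.swap i j) = -u x) :
    ((n : ℝ) - 1) * (ξ ^ 2 / ℓ ^ 2) * ∫ x in univ.pi fun _ => Metric.ball c ℓ, u x ^ 2 ≤
      ∫ x in univ.pi fun _ => Metric.ball c ℓ,
        ∑ j, ∑ i, fderiv ℝ u x (Pi.single j (EuclideanSpace.single i 1)) ^ 2 := by
  set B := Metric.ball c ℓ with hB
  have hB0 : volume B ≠ 0 := (Metric.measure_ball_pos volume c hℓ).ne'
  have hBt : volume B ≠ ⊤ := measure_ball_lt_top.ne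
  set μ : Measure (EuclideanSpace ℝ (Fin 3)) := (volume B)⁻¹ • volume.restrict B with hμdef
  have : IsProbabilityMeasure μ := ⟨by simp [hμdef, ENNReal.inv_mul_cancel hB0 hBt]⟩
  have hV : 0 < volume.real B := ENNReal.toReal_pos hB0 hBt
  have hμint : ∀ f : EuclideanSpace ℝ (Fin 3) → ℝ,
      ∫ y, f y ∂μ = (volume.real B)⁻¹ * ∫ y in B, f y := fun f => by
    rw [hμdef, integral_smul_measure, ENNReal.toReal_inv, smul_eq_mul, Measure.real]
  have hμK : μ (Metric.closedBall c ℓ)ᶜ = 0 := by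
    rw [hμdef, Measure.smul_apply, Measure.restrict_apply measurableSet_closedBall.compl]
    have : (Metric.closedBall c ℓ)ᶜ ∩ B = ∅ :=
      (disjoint_compl_left_iff_subset.2 Metric.ball_subset_closedBall).inter_eq
    simp [this]
  have key := exclusion_of_poincare (μ := μ) (n := n) (isCompact_closedBall c ℓ) hμK
    (fun i : Fin 3 => EuclideanSpace.single i (1:ℝ)) (κ := ℓ ^ 2 / ξ ^ 2) (fun f hf => by
      rw [hμint, hμint, hμint]
      have h := mul_le_mul_of_nonneg_left (poincare_ball h0 hξπ hroot hℓ c hf) (inv_pos.2 hV).le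
      rw [← hB] at h
      refine (le_of_eq ?_).trans (h.trans (le_of_eq ?_)) <;> ring) hu hanti
  rw [volume_restrict_pi_eq_smul hB0 hBt, ← hμdef, integral_smul_measure, integral_smul_measure,
    smul_eq_mul, smul_eq_mul, mul_left_comm]
  refine mul_le_mul_of_nonneg_left ?_ ENNReal.toReal_nonneg
  have h := mul_le_mul_of_nonneg_left key (by positivity : 0 ≤ ξ ^ 2 / ℓ ^ 2)
  refine (le_of_eq ?_).trans (h.trans (le_of_eq ?_))
  · ring
  · field_simp

end Auxiliary

/-- **Local exclusion for fermions in 3D** (Dyson–Lenard).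
For `n` fermions (antisymmetric wave function) on a ball `Ω ⊆ ℝ³` of radius `ℓ`,
the local kinetic energy is bounded below by `(n-1) ξ²/ℓ²` times the local mass,
where `ξ ≈ 2.082` is the smallest positive root of `(sin x / x)'' = 0`. -/
theorem local_exclusion_fermions_3d
    (n : ℕ) (hn : 1 ≤ n) (ℓ : ℝ) (hℓ : 0 < ℓ)
    (c : EuclideanSpace ℝ (Fin 3)) (ξ : ℝ) (hξpos : 0 < ξ)
    (hξroot : deriv (deriv (fun x : ℝ => Real.sin x / x)) ξ = 0)
    (hξmin : ∀ y : ℝ, 0 < y → deriv (deriv (fun x : ℝ => Real.sin x / x)) y = 0 → ξ ≤ y)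
    (ψ : (Fin n → EuclideanSpace ℝ (Fin 3)) → ℂ) (hψ : ContDiff ℝ (⊤ : ℕ∞) ψ)
    (hanti : ∀ (σ : Equiv.Perm (Fin n)) (x : Fin n → EuclideanSpace ℝ (Fin 3)),
      ψ (x ∘ σ) = (Equiv.Perm.sign σ : ℤ) • ψ x) :
    (∫ x in Set.univ.pi fun _ : Fin n => Metric.ball c ℓ,
        ∑ j : Fin n, ∑ i : Fin 3,
          ‖fderiv ℝ ψ x (Pi.single j (EuclideanSpace.single i (1 : ℝ)))‖ ^ 2)
      ≥ ((n : ℝ) - 1) * (ξ ^ 2 / ℓ ^ 2) *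
        ∫ x in Set.univ.pi fun _ : Fin n => Metric.ball c ℓ, ‖ψ x‖ ^ 2 := by
  have hroot := root_equation hξpos hξroot
  have hlt := root_lt_pi hξmin
  have hψ1 : ContDiff ℝ 1 ψ := hψ.of_le (by exact_mod_cast le_top)
  have hψd : Continuous (fderiv ℝ ψ) := hψ1.continuous_fderiv (by norm_num)
  have hsw : ∀ i j, i ≠ j → ∀ x, ψ (x ∘ Equiv.swap i j) = -ψ x := fun i j hij x => by
    rw [hanti, Equiv.Perm.sign_swap hij]
    simp
  have hfd : ∀ (L : ℂ →L[ℝ] ℝ) x v, fderiv ℝ (fun x => L (ψ x)) x v = L (fderiv ℝ ψ x v) := by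
    intro L x v
    have h := L.hasFDerivAt.comp x ((hψ1.differentiable (by norm_num)) x).hasFDerivAt
    rw [show (fun x => L (ψ x)) = L ∘ ψ from rfl, h.fderiv]
    rfl
  have hL : ∀ L : ℂ →L[ℝ] ℝ, _ := fun L => exclusion_real hℓ c hξpos hlt hroot
    (u := fun x => L (ψ x)) (L.contDiff.comp hψ1) (fun i j hij x => by rw [hsw i j hij, map_neg])
  have hre := hL Complex.reCLM
  have him := hL Complex.imCLM
  simp only [hfd] at hre him
  simp only [Complex.reCLM_apply, Complex.imCLM_apply] at hre him
  have hint : ∀ u : (Fin n → EuclideanSpace ℝ (Fin 3)) → ℝ, Continuous u →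
      IntegrableOn u (Set.univ.pi fun _ => Metric.ball c ℓ) := fun u hu =>
    (hu.continuousOn.integrableOn_compact
      (isCompact_univ_pi fun _ => isCompact_closedBall c ℓ)).mono_set
      (Set.pi_mono fun _ _ => Metric.ball_subset_closedBall)
  have hψc := hψ1.continuous
  have hnorm : ∀ z : ℂ, ‖z‖ ^ 2 = z.re ^ 2 + z.im ^ 2 := fun z => by
    rw [Complex.sq_norm, Complex.normSq_apply]
    ring
  simp only [hnorm, Finset.sum_add_distrib]
  rw [integral_add (hint _ (by fun_prop)) (hint _ (by fun_prop)),
    integral_add (hint _ (by fun_prop)) (hint _ (by fun_prop))]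
  linarith
end

section
/- Fix N ≥ 1 and let Δ := {x ∈ (ℝ²)^N : x_j = x_k for some j ≠ k} be the diagonal set. For every u ∈ C_c^∞((ℝ²)^N; ℂ) and every ε > 0 there exists φ ∈ C_c^∞((ℝ²)^N; ℂ) whose support is disjoint from Δ and such that ∫_{(ℝ²)^N} |u − φ|² dx + ∫_{(ℝ²)^N} ‖∇u − ∇φ‖² dx < ε. Moreover, if u is symmetric (respectively antisymmetric) under permutations of the N ℝ²-coordinates, then φ may be chosen symmetric (respectively antisymmetric). In particular, C_c^∞ functions supported away from Δ are dense in the Sobolev space H¹((ℝ²)^N), so H¹((ℝ²)^N) = H¹₀((ℝ²)^N \ Δ), and likewise for the symmetric and antisymmetric subspaces. -/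
open MeasureTheory

/-- The derivative of the smooth transition vanishes to the right of `1`. -/
lemma deriv_smoothTransition_eq_zero_of_one_lt {s : ℝ} (hs : 1 < s) :
    deriv Real.smoothTransition s = 0 := by
  have h : Real.smoothTransition =ᶠ[nhds s] fun _ => (1 : ℝ) := by
    filter_upwards [lt_mem_nhds hs] with t ht
    exact Real.smoothTransition.one_of_one_le ht.le
  rw [h.deriv_eq, deriv_const]

/-- The derivative of the smooth transition is bounded. -/
lemma exists_bound_deriv_smoothTransition :
    ∃ C : ℝ, ∀ s, |deriv Real.smoothTransition s| ≤ C := by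
  refine Continuous.bounded_above_of_compact_support
    ((Real.smoothTransition.contDiff (n := 1)).continuous_deriv (by simp))
    (HasCompactSupport.intro (isCompact_Icc (a := (0 : ℝ)) (b := 1)) fun s hs => ?_)
  rw [Set.mem_Icc, not_and_or, not_le, not_le] at hs
  rcases hs with hs | hs
  · have h : Real.smoothTransition =ᶠ[nhds s] fun _ => (0 : ℝ) := by
      filter_upwards [gt_mem_nhds hs] with t ht
      exact Real.smoothTransition.zero_of_nonpos ht.le
    rw [h.deriv_eq, deriv_const]
  · exact deriv_smoothTransition_eq_zero_of_one_lt hs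

/-- The regularized inverse square is integrable on the unit disc, with logarithmic growth of its
integral in the regularization parameter. -/
lemma lintegral_closedBall_inv_norm_sq_add {δ : ℝ} (hδ : 0 < δ) :
    ∫⁻ y : EuclideanSpace ℝ (Fin 2) in Metric.closedBall 0 1, ENNReal.ofReal (‖y‖ ^ 2 + δ)⁻¹ =
      ENNReal.ofReal (Real.pi * (Real.log (1 + δ) - Real.log δ)) := by
  have hpos : ∀ r : ℝ, 0 < r ^ 2 + δ := fun r => by positivity
  have hcont : Continuous fun y : EuclideanSpace ℝ (Fin 2) => (‖y‖ ^ 2 + δ)⁻¹ :=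
    Continuous.inv₀ (by fun_prop) fun y => (hpos _).ne'
  rw [← ofReal_integral_eq_lintegral_ofReal
    (hcont.continuousOn.integrableOn_compact (isCompact_closedBall _ _))
    (ae_of_all _ fun y => (inv_pos.2 (hpos _)).le)]
  congr 1
  have hind : ∀ y : EuclideanSpace ℝ (Fin 2),
      (Metric.closedBall 0 1).indicator (fun y => (‖y‖ ^ 2 + δ)⁻¹) y =
        (Set.Iic (1 : ℝ)).indicator (fun r => (r ^ 2 + δ)⁻¹) ‖y‖ := fun y => by
    classical simp [Set.indicator_apply]
  have hvol : (volume : Measure (EuclideanSpace ℝ (Fin 2))).real (Metric.ball 0 1) = Real.pi := by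
    simp [Measure.real, EuclideanSpace.volume_ball_fin_two, Real.pi_nonneg]
  have hcalc : ∫ r in (0 : ℝ)..1, r * (r ^ 2 + δ)⁻¹ =
      Real.log (1 + δ) / 2 - Real.log δ / 2 := by
    rw [intervalIntegral.integral_eq_sub_of_hasDerivAt
      (f := fun r => Real.log (r ^ 2 + δ) / 2)]
    · norm_num
    · intro r _
      refine ((((hasDerivAt_pow 2 r).add_const δ).log (hpos r).ne').div_const 2).congr_deriv ?_
      push_cast
      ring
    · refine Continuous.intervalIntegrable (continuous_id.mul ?_) _ _
      exact Continuous.inv₀ (by fun_prop) fun y => (hpos _).ne'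
  rw [← integral_indicator Metric.isClosed_closedBall.measurableSet]
  simp_rw [hind]
  rw [integral_fun_norm_addHaar volume, hvol, finrank_euclideanSpace_fin]
  have hset : ∫ r in Set.Ioi (0 : ℝ), r ^ (2 - 1) •
      (Set.Iic (1 : ℝ)).indicator (fun r => (r ^ 2 + δ)⁻¹) r =
      ∫ r in (0 : ℝ)..1, r * (r ^ 2 + δ)⁻¹ := by
    rw [intervalIntegral.integral_of_le zero_le_one, ← Set.Ioi_inter_Iic,
      ← setIntegral_indicator measurableSet_Iic]
    refine integral_congr_ae (ae_of_all _ fun r => ?_)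
    by_cases hr : r ≤ 1 <;> simp [hr]
  rw [hset, hcalc]
  simp only [smul_eq_mul, nsmul_eq_mul]
  push_cast
  ring

/-- A logarithmic cutoff on the plane vanishing near the origin, at scale `exp (-n)`. -/
noncomputable def logCutoff (n : ℝ) (y : EuclideanSpace ℝ (Fin 2)) : ℝ :=
  Real.smoothTransition (2 + Real.log (‖y‖ ^ 2 + Real.exp (-3 * n)) / n)

lemma norm_sq_add_exp_pos (n : ℝ) (y : EuclideanSpace ℝ (Fin 2)) :
    0 < ‖y‖ ^ 2 + Real.exp (-3 * n) := by positivity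

lemma contDiff_logCutoff (n : ℝ) : ContDiff ℝ (⊤ : ℕ∞) (logCutoff n) := by
  refine Real.smoothTransition.contDiff.comp (contDiff_const.add (ContDiff.div_const ?_ _))
  exact ((contDiff_norm_sq ℝ).add contDiff_const).log fun y => (norm_sq_add_exp_pos n y).ne'

lemma logCutoff_eventually_eq_zero {n : ℝ} (hn : 1 ≤ n) : ∀ᶠ y in nhds 0, logCutoff n y = 0 := by
  have hn0 : 0 < n := by linarith
  have hc : ContinuousAt (fun y : EuclideanSpace ℝ (Fin 2) =>
      2 + Real.log (‖y‖ ^ 2 + Real.exp (-3 * n)) / n) 0 := by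
    refine continuousAt_const.add (ContinuousAt.div_const ?_ _)
    exact ContinuousAt.log (by fun_prop) (norm_sq_add_exp_pos n 0).ne'
  have h0 : 2 + Real.log (‖(0 : EuclideanSpace ℝ (Fin 2))‖ ^ 2 + Real.exp (-3 * n)) / n < 0 := by
    have : -3 * n / n = -3 := by field_simp
    rw [norm_zero, zero_pow two_ne_zero, zero_add, Real.log_exp, this]
    norm_num
  filter_upwards [hc.eventually_lt continuousAt_const h0] with y hy
  exact Real.smoothTransition.zero_of_nonpos hy.le

lemma norm_fderiv_logCutoff_le (n : ℝ) (hn : 1 ≤ n) (y : EuclideanSpace ℝ (Fin 2)) :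
    ‖fderiv ℝ (logCutoff n) y‖ ≤
      |deriv Real.smoothTransition (2 + Real.log (‖y‖ ^ 2 + Real.exp (-3 * n)) / n)| *
        (2 * ‖y‖ / (n * (‖y‖ ^ 2 + Real.exp (-3 * n)))) := by
  have hn0 : 0 < n := by linarith
  have ht := norm_sq_add_exp_pos n y
  have h1 := ((((hasFDerivAt_id (𝕜 := ℝ) y).norm_sq.add_const (Real.exp (-3 * n))).log
    ht.ne').mul_const n⁻¹).const_add 2
  have h2 := (((Real.smoothTransition.contDiff (n := 1)).differentiable (by simp)).differentiableAt
    (x := 2 + Real.log (‖y‖ ^ 2 + Real.exp (-3 * n)) / n)).hasDerivAt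
  have h3 := h2.comp_hasFDerivAt y h1
  have h4 : fderiv ℝ (logCutoff n) y = _ := h3.fderiv
  rw [h4, norm_smul, Real.norm_eq_abs]
  gcongr
  refine ContinuousLinearMap.opNorm_le_bound _ (by positivity) fun v => ?_
  have h5 : |inner ℝ y v| ≤ ‖y‖ * ‖v‖ := abs_real_inner_le_norm y v
  change ‖n⁻¹ • (‖y‖ ^ 2 + Real.exp (-3 * n))⁻¹ • 2 • inner ℝ y v‖ ≤ _
  rw [norm_smul, norm_smul, nsmul_eq_mul, norm_mul, Real.norm_of_nonneg (inv_pos.2 hn0).le,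
    Real.norm_of_nonneg (inv_pos.2 ht).le, Real.norm_eq_abs (inner ℝ y v)]
  calc _ ≤ n⁻¹ * ((‖y‖ ^ 2 + Real.exp (-3 * n))⁻¹ * (2 * (‖y‖ * ‖v‖))) := by
        gcongr
        norm_num
    _ = _ := by field_simp

/-- Pointwise control of the logarithmic cutoff by a multiple of a regularized inverse square. -/
lemma logCutoff_energy_le {C : ℝ} (hC : ∀ s, |deriv Real.smoothTransition s| ≤ C) {n : ℝ}
    (hn : 1 ≤ n) (y : EuclideanSpace ℝ (Fin 2)) :
    1 - logCutoff n y + ‖fderiv ℝ (logCutoff n) y‖ ^ 2 ≤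
      (Metric.closedBall 0 1).indicator
        (fun y => (2 + 4 * C ^ 2) / n ^ 2 * (‖y‖ ^ 2 + Real.exp (-3 * n))⁻¹) y := by
  have hn0 : 0 < n := by linarith
  have ht := norm_sq_add_exp_pos n y
  have hD := norm_fderiv_logCutoff_le n hn y
  have hC0 : 0 ≤ C := (abs_nonneg _).trans (hC 0)
  rcases lt_or_ge (Real.exp (-n)) (‖y‖ ^ 2 + Real.exp (-3 * n)) with h | h
  · have hlog : -n < Real.log (‖y‖ ^ 2 + Real.exp (-3 * n)) := (Real.lt_log_iff_exp_lt ht).2 h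
    have harg : 1 < 2 + Real.log (‖y‖ ^ 2 + Real.exp (-3 * n)) / n := by
      have : -1 < Real.log (‖y‖ ^ 2 + Real.exp (-3 * n)) / n := by
        rw [lt_div_iff₀ hn0]; linarith
      linarith
    rw [deriv_smoothTransition_eq_zero_of_one_lt harg, abs_zero, zero_mul] at hD
    rw [le_antisymm hD (norm_nonneg _), logCutoff, Real.smoothTransition.one_of_one_le harg.le]
    simp only [sub_self, ne_eq, OfNat.ofNat_ne_zero, not_false_eq_true, zero_pow, add_zero]
    exact Set.indicator_nonneg (fun z _ => by positivity) _
  · set t := ‖y‖ ^ 2 + Real.exp (-3 * n) with ht_def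
    have hyt : ‖y‖ ^ 2 ≤ t := by linarith [Real.exp_pos (-3 * n)]
    have hmem : y ∈ Metric.closedBall (0 : EuclideanSpace ℝ (Fin 2)) 1 := by
      have : Real.exp (-n) ≤ 1 := Real.exp_le_one_iff.2 (by linarith)
      rw [mem_closedBall_zero_iff]
      nlinarith [norm_nonneg y]
    rw [Set.indicator_of_mem hmem]
    have h1 : 1 - logCutoff n y ≤ 2 / n ^ 2 * t⁻¹ := by
      have h2 : n ^ 2 / 2 ≤ Real.exp n := by
        linarith [Real.quadratic_le_exp_of_nonneg hn0.le]
      have h3 : t * Real.exp n ≤ 1 := by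
        calc t * Real.exp n ≤ Real.exp (-n) * Real.exp n := by gcongr
          _ = 1 := by rw [← Real.exp_add]; simp
      have h4 : n ^ 2 * t ≤ 2 := by nlinarith
      have h5 : 2 / n ^ 2 * t⁻¹ = 2 / (n ^ 2 * t) := by field_simp
      have h6 : 0 ≤ logCutoff n y := Real.smoothTransition.nonneg _
      have h7 : 1 ≤ 2 / (n ^ 2 * t) := by rw [le_div_iff₀ (by positivity)]; linarith
      linarith
    have h2 : ‖fderiv ℝ (logCutoff n) y‖ ^ 2 ≤ 4 * C ^ 2 / n ^ 2 * t⁻¹ := by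
      calc ‖fderiv ℝ (logCutoff n) y‖ ^ 2 ≤ (C * (2 * ‖y‖ / (n * t))) ^ 2 := by
            gcongr
            exact hD.trans (by gcongr; exact hC _)
        _ = 4 * C ^ 2 / n ^ 2 * (‖y‖ ^ 2 / t ^ 2) := by field_simp; ring
        _ ≤ 4 * C ^ 2 / n ^ 2 * (t / t ^ 2) := by gcongr
        _ = 4 * C ^ 2 / n ^ 2 * t⁻¹ := by field_simp
    calc _ ≤ 2 / n ^ 2 * t⁻¹ + 4 * C ^ 2 / n ^ 2 * t⁻¹ := add_le_add h1 h2
      _ = _ := by ring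

/-- Points of the plane have zero `H¹`-capacity: there are smooth cutoffs vanishing near the origin
that differ from `1` by arbitrarily little in energy. -/
lemma exists_cutoff_small_energy {δ : ℝ} (hδ : 0 < δ) :
    ∃ η : EuclideanSpace ℝ (Fin 2) → ℝ, ContDiff ℝ (⊤ : ℕ∞) η ∧ (∀ y, 0 ≤ η y) ∧
      (∀ y, η y ≤ 1) ∧ (∀ᶠ y in nhds 0, η y = 0) ∧
      ∫⁻ y, ENNReal.ofReal (1 - η y + ‖fderiv ℝ η y‖ ^ 2) ≤ ENNReal.ofReal δ := by
  obtain ⟨C, hC⟩ := exists_bound_deriv_smoothTransition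
  set A : ℝ := (2 + 4 * C ^ 2) * Real.pi * 4 with hA
  have hA0 : 0 < A := by have := Real.pi_pos; positivity
  set n : ℝ := max 1 (A / δ) with hn_def
  have hn : 1 ≤ n := le_max_left _ _
  have hn0 : 0 < n := by linarith
  refine ⟨logCutoff n, contDiff_logCutoff n, fun y => Real.smoothTransition.nonneg _,
    fun y => Real.smoothTransition.le_one _, logCutoff_eventually_eq_zero hn, ?_⟩
  calc ∫⁻ y, ENNReal.ofReal (1 - logCutoff n y + ‖fderiv ℝ (logCutoff n) y‖ ^ 2)
      ≤ ∫⁻ y : EuclideanSpace ℝ (Fin 2) in Metric.closedBall 0 1,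
          ENNReal.ofReal ((2 + 4 * C ^ 2) / n ^ 2) *
            ENNReal.ofReal (‖y‖ ^ 2 + Real.exp (-3 * n))⁻¹ := by
        rw [← lintegral_indicator Metric.isClosed_closedBall.measurableSet]
        refine lintegral_mono fun y => (ENNReal.ofReal_le_ofReal
          (logCutoff_energy_le hC hn y)).trans_eq ?_
        by_cases hy : y ∈ Metric.closedBall (0 : EuclideanSpace ℝ (Fin 2)) 1
        · rw [Set.indicator_of_mem hy, Set.indicator_of_mem hy, ENNReal.ofReal_mul (by positivity)]
        · rw [Set.indicator_of_notMem hy, Set.indicator_of_notMem hy, ENNReal.ofReal_zero]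
    _ = ENNReal.ofReal ((2 + 4 * C ^ 2) / n ^ 2 *
          (Real.pi * (Real.log (1 + Real.exp (-3 * n)) - Real.log (Real.exp (-3 * n))))) := by
        rw [lintegral_const_mul' _ _ ENNReal.ofReal_ne_top,
          lintegral_closedBall_inv_norm_sq_add (Real.exp_pos _),
          ENNReal.ofReal_mul (p := (2 + 4 * C ^ 2) / n ^ 2) (by positivity)]
    _ ≤ ENNReal.ofReal δ := by
        refine ENNReal.ofReal_le_ofReal ?_
        have h1 : Real.log (1 + Real.exp (-3 * n)) ≤ 1 := by
          have := Real.log_le_sub_one_of_pos (x := 1 + Real.exp (-3 * n)) (by positivity)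
          have h2 : Real.exp (-3 * n) ≤ 1 := Real.exp_le_one_iff.2 (by linarith)
          linarith
        calc _ ≤ (2 + 4 * C ^ 2) / n ^ 2 * (Real.pi * (4 * n)) := by
              have := Real.pi_pos
              rw [Real.log_exp]
              gcongr
              linarith
          _ = A / n := by rw [hA]; field_simp
          _ ≤ δ := by
              rw [div_le_iff₀ hn0, mul_comm, ← div_le_iff₀ hδ]
              exact le_max_right _ _

/-- Integrating a function of the difference of two coordinates over a ball costs at most a
constant times the integral of the function. -/
lemma setLIntegral_closedBall_sub_le {E : Type*} [NormedAddCommGroup E] [NormedSpace ℝ E]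
    [FiniteDimensional ℝ E] [MeasureSpace E] [BorelSpace E]
    [(volume : Measure E).IsAddHaarMeasure] {n : ℕ} {j k : Fin (n + 1)} (hjk : j ≠ k)
    {f : E → ENNReal} (hf : Measurable f) (R : ℝ) :
    ∫⁻ x : Fin (n + 1) → E in Metric.closedBall 0 R, f (x j - x k) ≤
      volume (Metric.closedBall (0 : Fin n → E) R) * ∫⁻ y, f y := by
  obtain ⟨l, rfl⟩ := Fin.exists_succAbove_eq hjk.symm
  have hball : MeasurableSet (Metric.closedBall (0 : Fin n → E) R) :=
    Metric.isClosed_closedBall.measurableSet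
  set F : E × (Fin n → E) → ENNReal := fun z =>
    (Metric.closedBall (0 : Fin n → E) R).indicator (fun w => f (z.1 - w l)) z.2 with hF
  have hFm : Measurable F := by
    have h : F = (Prod.snd ⁻¹' Metric.closedBall (0 : Fin n → E) R).indicator
        fun z => f (z.1 - z.2 l) := by
      ext z; classical simp [hF, Set.indicator_apply]
    rw [h]
    exact (hf.comp (by fun_prop)).indicator (measurable_snd hball)
  calc ∫⁻ x : Fin (n + 1) → E in Metric.closedBall 0 R, f (x j - x (j.succAbove l))
      ≤ ∫⁻ x, F (MeasurableEquiv.piFinSuccAbove (fun _ => E) j x) := by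
        rw [← lintegral_indicator Metric.isClosed_closedBall.measurableSet]
        refine lintegral_mono (Set.indicator_le fun x hx => ?_)
        have hx' : (MeasurableEquiv.piFinSuccAbove (fun _ => E) j x).2 ∈
            Metric.closedBall (0 : Fin n → E) R := by
          rw [mem_closedBall_zero_iff] at hx ⊢
          exact (pi_norm_le_iff_of_nonneg ((norm_nonneg _).trans hx)).2 fun i =>
            (norm_le_pi_norm x _).trans hx
        rw [hF]
        simp only
        rw [Set.indicator_of_mem hx']
        exact le_rfl
    _ = ∫⁻ z, F z :=
        (volume_preserving_piFinSuccAbove (fun _ => E) j).lintegral_comp hFm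
    _ = ∫⁻ w, ∫⁻ y, F (y, w) := by
        rw [Measure.volume_eq_prod, lintegral_prod_symm _ hFm.aemeasurable]
    _ = ∫⁻ w, (Metric.closedBall (0 : Fin n → E) R).indicator (fun _ => ∫⁻ y, f y) w := by
        refine lintegral_congr fun w => ?_
        by_cases hw : w ∈ Metric.closedBall (0 : Fin n → E) R
        · simp only [hF, Set.indicator_of_mem hw]
          exact lintegral_sub_right_eq_self f (w l)
        · simp [hF, Set.indicator_of_notMem hw]
    _ = _ := by rw [lintegral_indicator_const hball, mul_comm]

lemma one_sub_prod_le_sum_one_sub {ι : Type*} (s : Finset ι) {a : ι → ℝ} (h0 : ∀ i, 0 ≤ a i)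
    (h1 : ∀ i, a i ≤ 1) : 1 - ∏ i ∈ s, a i ≤ ∑ i ∈ s, (1 - a i) := by
  classical
  induction s using Finset.induction_on with
  | empty => simp
  | insert i s hi ih =>
    rw [Finset.prod_insert hi, Finset.sum_insert hi]
    have hP : ∏ i ∈ s, a i ≤ 1 := Finset.prod_le_one (fun i _ => h0 i) fun i _ => h1 i
    nlinarith [h0 i, h1 i]

section PairCutoff

variable {ι E : Type*} [Fintype ι] [NormedAddCommGroup E]

/-- The product of a one-particle cutoff over all differences of distinct coordinates. -/
noncomputable def pairCutoff (η : E → ℝ) (x : ι → E) : ℝ :=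
  ∏ p ∈ (Finset.univ : Finset ι).offDiag, η (x p.1 - x p.2)

lemma pairCutoff_comp_perm (η : E → ℝ) (σ : Equiv.Perm ι) (x : ι → E) :
    pairCutoff η (x ∘ σ) = pairCutoff η x :=
  Finset.prod_equiv (σ.prodCongr σ) (by simp) (by simp)

lemma pairCutoff_nonneg {η : E → ℝ} (h0 : ∀ y, 0 ≤ η y) (x : ι → E) : 0 ≤ pairCutoff η x :=
  Finset.prod_nonneg fun _ _ => h0 _

lemma pairCutoff_le_one {η : E → ℝ} (h0 : ∀ y, 0 ≤ η y) (h1 : ∀ y, η y ≤ 1) (x : ι → E) :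
    pairCutoff η x ≤ 1 :=
  Finset.prod_le_one (fun _ _ => h0 _) fun _ _ => h1 _

lemma pairCutoff_eventually_eq_zero {η : E → ℝ} (hη : ∀ᶠ y in nhds 0, η y = 0) {x : ι → E}
    {j k : ι} (hjk : j ≠ k) (hx : x j = x k) : ∀ᶠ z in nhds x, pairCutoff η z = 0 := by
  have hc : Filter.Tendsto (fun z : ι → E => z j - z k) (nhds x) (nhds 0) := by
    have : Continuous fun z : ι → E => z j - z k := by fun_prop
    simpa [hx] using this.tendsto x
  filter_upwards [hc.eventually hη] with z hz
  exact Finset.prod_eq_zero (i := (j, k)) (by simpa using hjk) hz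

variable [NormedSpace ℝ E]

lemma contDiff_pairCutoff {η : E → ℝ} (hη : ContDiff ℝ (⊤ : ℕ∞) η) :
    ContDiff ℝ (⊤ : ℕ∞) (pairCutoff η : (ι → E) → ℝ) :=
  contDiff_prod fun p _ => hη.comp ((contDiff_apply ℝ E p.1).sub (contDiff_apply ℝ E p.2))

lemma abs_fderiv_pairCutoff_le {η : E → ℝ} (hη : Differentiable ℝ η) (h0 : ∀ y, 0 ≤ η y)
    (h1 : ∀ y, η y ≤ 1) (x v : ι → E) :
    |fderiv ℝ (pairCutoff η) x v| ≤
      ∑ p ∈ (Finset.univ : Finset ι).offDiag, ‖fderiv ℝ η (x p.1 - x p.2)‖ * (2 * ‖v‖) := by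
  classical
  have hfac : ∀ p : ι × ι, HasFDerivAt (fun z : ι → E => η (z p.1 - z p.2))
      ((fderiv ℝ η (x p.1 - x p.2)).comp
        (ContinuousLinearMap.proj p.1 - ContinuousLinearMap.proj p.2)) x := fun p =>
    (hη (x p.1 - x p.2)).hasFDerivAt.comp x
      ((hasFDerivAt_apply p.1 x).sub (hasFDerivAt_apply p.2 x))
  have hd : HasFDerivAt (pairCutoff η) _ x := HasFDerivAt.finsetProd
    (u := (Finset.univ : Finset ι).offDiag) fun p _ => hfac p
  rw [hd.fderiv, sum_apply]
  refine (Finset.abs_sum_le_sum_abs _ _).trans (Finset.sum_le_sum fun p _ => ?_)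
  change |(∏ q ∈ (Finset.univ : Finset ι).offDiag.erase p, η (x q.1 - x q.2)) *
    fderiv ℝ η (x p.1 - x p.2) (v p.1 - v p.2)| ≤ _
  rw [abs_mul, abs_of_nonneg (Finset.prod_nonneg fun _ _ => h0 _)]
  have hv : ‖v p.1 - v p.2‖ ≤ 2 * ‖v‖ := by
    linarith [norm_sub_le (v p.1) (v p.2), norm_le_pi_norm v p.1, norm_le_pi_norm v p.2]
  calc _ ≤ 1 * |fderiv ℝ η (x p.1 - x p.2) (v p.1 - v p.2)| := by
        gcongr
        exact Finset.prod_le_one (fun _ _ => h0 _) fun _ _ => h1 _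
    _ ≤ ‖fderiv ℝ η (x p.1 - x p.2)‖ * ‖v p.1 - v p.2‖ := by
        rw [one_mul]
        exact (fderiv ℝ η (x p.1 - x p.2)).le_opNorm _
    _ ≤ _ := by gcongr

/-- The sum over pairs of distinct coordinates of the energy density of a cutoff. -/
noncomputable def pairEnergy (η : E → ℝ) (x : ι → E) : ℝ :=
  ∑ p ∈ (Finset.univ : Finset ι).offDiag,
    (1 - η (x p.1 - x p.2) + ‖fderiv ℝ η (x p.1 - x p.2)‖ ^ 2)

lemma pairEnergy_nonneg {η : E → ℝ} (h1 : ∀ y, η y ≤ 1) (x : ι → E) : 0 ≤ pairEnergy η x :=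
  Finset.sum_nonneg fun _ _ => add_nonneg (sub_nonneg.2 (h1 _)) (sq_nonneg _)

lemma one_sub_pairCutoff_sq_le {η : E → ℝ} (h0 : ∀ y, 0 ≤ η y) (h1 : ∀ y, η y ≤ 1)
    (x : ι → E) : (1 - pairCutoff η x) ^ 2 ≤ pairEnergy η x := by
  have hP0 := pairCutoff_nonneg h0 x
  have hP1 := pairCutoff_le_one h0 h1 x
  calc (1 - pairCutoff η x) ^ 2 ≤ 1 - pairCutoff η x := by nlinarith
    _ ≤ ∑ p ∈ (Finset.univ : Finset ι).offDiag, (1 - η (x p.1 - x p.2)) :=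
        one_sub_prod_le_sum_one_sub _ (fun _ => h0 _) fun _ => h1 _
    _ ≤ pairEnergy η x := Finset.sum_le_sum fun p _ => le_add_of_nonneg_right (sq_nonneg _)

lemma fderiv_pairCutoff_sq_le {η : E → ℝ} (hη : Differentiable ℝ η) (h0 : ∀ y, 0 ≤ η y)
    (h1 : ∀ y, η y ≤ 1) (x : ι → E) {v : ι → E} (hv : ‖v‖ ≤ 1) :
    (fderiv ℝ (pairCutoff η) x v) ^ 2 ≤
      4 * (Finset.univ : Finset ι).offDiag.card * pairEnergy η x := by
  rw [← sq_abs]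
  calc |fderiv ℝ (pairCutoff η) x v| ^ 2
      ≤ (∑ p ∈ (Finset.univ : Finset ι).offDiag, ‖fderiv ℝ η (x p.1 - x p.2)‖ * 2) ^ 2 := by
        gcongr
        refine (abs_fderiv_pairCutoff_le hη h0 h1 x v).trans ?_
        gcongr
        linarith
    _ ≤ ((Finset.univ : Finset ι).offDiag.card : ℝ) *
          ∑ p ∈ (Finset.univ : Finset ι).offDiag, (‖fderiv ℝ η (x p.1 - x p.2)‖ * 2) ^ 2 :=
        sq_sum_le_card_mul_sum_sq
    _ = 4 * (Finset.univ : Finset ι).offDiag.card *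
          ∑ p ∈ (Finset.univ : Finset ι).offDiag, ‖fderiv ℝ η (x p.1 - x p.2)‖ ^ 2 := by
        simp_rw [mul_pow, ← Finset.sum_mul]
        ring
    _ ≤ _ := by
        gcongr
        exact Finset.sum_le_sum fun p _ => le_add_of_nonneg_left (sub_nonneg.2 (h1 _))

lemma norm_sub_pairCutoff_smul_sq_le {F : Type*} [NormedAddCommGroup F] [NormedSpace ℝ F]
    {η : E → ℝ} (h0 : ∀ y, 0 ≤ η y) (h1 : ∀ y, η y ≤ 1) {M : ℝ} {w : F} (hw : ‖w‖ ≤ M)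
    (x : ι → E) : ‖w - pairCutoff η x • w‖ ^ 2 ≤ M ^ 2 * pairEnergy η x := by
  have h : w - pairCutoff η x • w = (1 - pairCutoff η x) • w := by rw [sub_smul, one_smul]
  rw [h, norm_smul, mul_pow, Real.norm_eq_abs, sq_abs, mul_comm]
  exact mul_le_mul (by gcongr) (one_sub_pairCutoff_sq_le h0 h1 x) (sq_nonneg _) (sq_nonneg _)

lemma norm_fderiv_sub_fderiv_pairCutoff_smul_sq_le {F : Type*} [NormedAddCommGroup F]
    [NormedSpace ℝ F] {η : E → ℝ} (hη : ContDiff ℝ (⊤ : ℕ∞) η) (h0 : ∀ y, 0 ≤ η y)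
    (h1 : ∀ y, η y ≤ 1) {u : (ι → E) → F} {M : ℝ} {x : ι → E} (hu : DifferentiableAt ℝ u x)
    (hM : ‖u x‖ ≤ M) (hM' : ‖fderiv ℝ u x‖ ≤ M) {v : ι → E} (hv : ‖v‖ ≤ 1) :
    ‖fderiv ℝ u x v - fderiv ℝ (fun z => pairCutoff η z • u z) x v‖ ^ 2 ≤
      (2 + 8 * (Finset.univ : Finset ι).offDiag.card) * M ^ 2 * pairEnergy η x := by
  have hM0 : 0 ≤ M := (norm_nonneg _).trans hM
  have hP := ((contDiff_pairCutoff (ι := ι) hη).differentiable (by simp)).differentiableAt (x := x)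
  have hd : fderiv ℝ (fun z => pairCutoff η z • u z) x v =
      pairCutoff η x • fderiv ℝ u x v + fderiv ℝ (pairCutoff η) x v • u x := by
    rw [fderiv_fun_smul hP hu]
    rfl
  have hw : ‖fderiv ℝ u x v‖ ≤ M := by
    calc ‖fderiv ℝ u x v‖ ≤ ‖fderiv ℝ u x‖ * ‖v‖ := ContinuousLinearMap.le_opNorm _ _
      _ ≤ M * 1 := by gcongr
      _ = M := mul_one M
  have ha := norm_sub_pairCutoff_smul_sq_le h0 h1 hw x
  have hb : ‖fderiv ℝ (pairCutoff η) x v • u x‖ ^ 2 ≤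
      4 * (Finset.univ : Finset ι).offDiag.card * pairEnergy η x * M ^ 2 := by
    rw [norm_smul, mul_pow, Real.norm_eq_abs, sq_abs]
    have hE := pairEnergy_nonneg h1 x
    gcongr
    exact fderiv_pairCutoff_sq_le (hη.differentiable (by simp)) h0 h1 x hv
  rw [hd, ← sub_sub]
  calc _ ≤ (‖fderiv ℝ u x v - pairCutoff η x • fderiv ℝ u x v‖ +
        ‖fderiv ℝ (pairCutoff η) x v • u x‖) ^ 2 := by
        gcongr
        exact norm_sub_le _ _
    _ ≤ 2 * (‖fderiv ℝ u x v - pairCutoff η x • fderiv ℝ u x v‖ ^ 2 +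
        ‖fderiv ℝ (pairCutoff η) x v • u x‖ ^ 2) := add_sq_le
    _ ≤ _ := by linarith

end PairCutoff

/-- A function supported in a ball and dominated by the pair energy of a cutoff has integral
controlled by the energy of the cutoff. -/
lemma integral_le_of_le_pairEnergy {n : ℕ} {η : EuclideanSpace ℝ (Fin 2) → ℝ}
    (hη : ContDiff ℝ (⊤ : ℕ∞) η) (h1 : ∀ y, η y ≤ 1) {δ : ℝ} (hδ : 0 ≤ δ)
    (hint : ∫⁻ y, ENNReal.ofReal (1 - η y + ‖fderiv ℝ η y‖ ^ 2) ≤ ENNReal.ofReal δ)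
    {g : (Fin (n + 1) → EuclideanSpace ℝ (Fin 2)) → ℝ} {B R : ℝ} (hB : 0 ≤ B)
    (hg0 : ∀ x, 0 ≤ g x) (hsupp : ∀ x, x ∉ Metric.closedBall 0 R → g x = 0)
    (hg : ∀ x, g x ≤ B * pairEnergy η x) :
    ∫ x, g x ≤ B * (Finset.univ : Finset (Fin (n + 1))).offDiag.card *
      volume.real (Metric.closedBall (0 : Fin n → EuclideanSpace ℝ (Fin 2)) R) * δ := by
  set f : EuclideanSpace ℝ (Fin 2) → ENNReal :=
    fun y => ENNReal.ofReal (1 - η y + ‖fderiv ℝ η y‖ ^ 2) with hf_def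
  have hf : Measurable f := by
    have := hη.continuous
    have := hη.continuous_fderiv (by simp)
    exact (by fun_prop : Continuous fun y => 1 - η y + ‖fderiv ℝ η y‖ ^ 2).measurable.ennreal_ofReal
  have hlin : ∫⁻ x, ENNReal.ofReal ‖g x‖ ≤ ENNReal.ofReal
      (B * (Finset.univ : Finset (Fin (n + 1))).offDiag.card *
      volume.real (Metric.closedBall (0 : Fin n → EuclideanSpace ℝ (Fin 2)) R) * δ) := by
    calc ∫⁻ x, ENNReal.ofReal ‖g x‖
        ≤ ∫⁻ x : Fin (n + 1) → EuclideanSpace ℝ (Fin 2) in Metric.closedBall 0 R, ENNReal.ofReal B *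
            ∑ p ∈ (Finset.univ : Finset (Fin (n + 1))).offDiag, f (x p.1 - x p.2) := by
          rw [← lintegral_indicator Metric.isClosed_closedBall.measurableSet]
          refine lintegral_mono fun x => ?_
          by_cases hx : x ∈ Metric.closedBall 0 R
          · rw [Set.indicator_of_mem hx, Real.norm_of_nonneg (hg0 x), hf_def,
              ← ENNReal.ofReal_sum_of_nonneg fun p _ =>
                add_nonneg (sub_nonneg.2 (h1 _)) (sq_nonneg _), ← ENNReal.ofReal_mul hB]
            exact ENNReal.ofReal_le_ofReal (hg x)
          · simp [hsupp x hx]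
      _ = ENNReal.ofReal B * ∑ p ∈ (Finset.univ : Finset (Fin (n + 1))).offDiag,
            ∫⁻ x : Fin (n + 1) → EuclideanSpace ℝ (Fin 2) in Metric.closedBall 0 R,
              f (x p.1 - x p.2) := by
          rw [lintegral_const_mul' _ _ ENNReal.ofReal_ne_top, lintegral_finsetSum]
          exact fun p _ => hf.comp (by fun_prop)
      _ ≤ ENNReal.ofReal B * ∑ _p ∈ (Finset.univ : Finset (Fin (n + 1))).offDiag,
            volume (Metric.closedBall (0 : Fin n → EuclideanSpace ℝ (Fin 2)) R) *
              ENNReal.ofReal δ := by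
          gcongr with p hp
          refine (setLIntegral_closedBall_sub_le (by simpa using hp) hf R).trans ?_
          gcongr
      _ = _ := by
          rw [Finset.sum_const, nsmul_eq_mul, ENNReal.ofReal_mul (by positivity),
            ENNReal.ofReal_mul (by positivity), ENNReal.ofReal_mul hB, ENNReal.ofReal_natCast,
            ofReal_measureReal measure_closedBall_lt_top.ne]
          ring
  calc ∫ x, g x ≤ ‖∫ x, g x‖ := le_abs_self _
    _ ≤ (∫⁻ x, ENNReal.ofReal ‖g x‖).toReal := norm_integral_le_lintegral_norm g
    _ ≤ _ := ENNReal.toReal_le_of_le_ofReal (by positivity) hlin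

/-- Smooth compactly supported functions on `(ℝ²)^N` can be approximated, in `H¹`-norm,
by smooth compactly supported functions whose support avoids the diagonal set
`Δ = {x : ∃ j ≠ k, x_j = x_k}`; moreover symmetry/antisymmetry can be preserved.
(This expresses `H¹((ℝ²)^N) = H¹₀((ℝ²)^N \ Δ)`, and likewise for the
symmetric and antisymmetric subspaces.) -/
theorem density_away_from_diagonals
    (N : ℕ) (hN : 1 ≤ N)
    (u : (Fin N → EuclideanSpace ℝ (Fin 2)) → ℂ)
    (hu : ContDiff ℝ (⊤ : ℕ∞) u) (husupp : HasCompactSupport u)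
    (ε : ℝ) (hε : 0 < ε) :
    ∃ φ : (Fin N → EuclideanSpace ℝ (Fin 2)) → ℂ,
      ContDiff ℝ (⊤ : ℕ∞) φ ∧ HasCompactSupport φ ∧
      (∀ x ∈ tsupport φ, ∀ j k : Fin N, j ≠ k → x j ≠ x k) ∧
      (∫ x, ‖u x - φ x‖ ^ 2) +
        (∫ x, ∑ j : Fin N, ∑ i : Fin 2,
          ‖fderiv ℝ u x (Pi.single j (EuclideanSpace.single i (1 : ℝ)))
            - fderiv ℝ φ x (Pi.single j (EuclideanSpace.single i (1 : ℝ)))‖ ^ 2) < ε ∧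
      ((∀ (σ : Equiv.Perm (Fin N)) (x : Fin N → EuclideanSpace ℝ (Fin 2)),
          u (x ∘ σ) = u x) →
        (∀ (σ : Equiv.Perm (Fin N)) (x : Fin N → EuclideanSpace ℝ (Fin 2)),
          φ (x ∘ σ) = φ x)) ∧
      ((∀ (σ : Equiv.Perm (Fin N)) (x : Fin N → EuclideanSpace ℝ (Fin 2)),
          u (x ∘ σ) = (Equiv.Perm.sign σ : ℤ) • u x) →
        (∀ (σ : Equiv.Perm (Fin N)) (x : Fin N → EuclideanSpace ℝ (Fin 2)),
          φ (x ∘ σ) = (Equiv.Perm.sign σ : ℤ) • φ x)) := by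
  obtain ⟨n, rfl⟩ : ∃ n, N = n + 1 := ⟨N - 1, by omega⟩
  have hu' : Differentiable ℝ u := hu.differentiable (by simp)
  have hucont : Continuous (fderiv ℝ u) := hu.continuous_fderiv (by simp)
  obtain ⟨M₁, hM₁⟩ := hu.continuous.bounded_above_of_compact_support husupp
  obtain ⟨M₂, hM₂⟩ := hucont.bounded_above_of_compact_support (husupp.fderiv ℝ)
  set M : ℝ := max M₁ M₂
  have hM : ∀ x, ‖u x‖ ≤ M := fun x => (hM₁ x).trans (le_max_left _ _)
  have hM' : ∀ x, ‖fderiv ℝ u x‖ ≤ M := fun x => (hM₂ x).trans (le_max_right _ _)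
  obtain ⟨R, hR⟩ := husupp.isBounded.subset_closedBall 0
  have hoff : ∀ x, x ∉ Metric.closedBall 0 R → u =ᶠ[nhds x] 0 := fun x hx =>
    notMem_tsupport_iff_eventuallyEq.1 fun h => hx (hR h)
  set c : ℝ := ((Finset.univ : Finset (Fin (n + 1))).offDiag.card : ℝ)
  set V : ℝ := volume.real (Metric.closedBall (0 : Fin n → EuclideanSpace ℝ (Fin 2)) R)
  set B : ℝ := (n + 1) * (2 * ((2 + 8 * c) * M ^ 2))
  have hB : 0 ≤ B := by positivity
  set A : ℝ := (M ^ 2 * c * V + B * c * V) with hA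
  have hA0 : 0 ≤ A := by positivity
  set δ : ℝ := ε / (A + 1) with hδ_def
  have hδ : 0 < δ := by positivity
  obtain ⟨η, hη, h0, h1, hz, hint⟩ := exists_cutoff_small_energy hδ
  set φ : (Fin (n + 1) → EuclideanSpace ℝ (Fin 2)) → ℂ := fun x => pairCutoff η x • u x with hφ
  have hφoff : ∀ x, x ∉ Metric.closedBall 0 R → φ =ᶠ[nhds x] 0 := fun x hx => by
    filter_upwards [hoff x hx] with z hz
    simp [hφ, hz]
  have hnorm : ∀ (j : Fin (n + 1)) (i : Fin 2),
      ‖(Pi.single j (EuclideanSpace.single i (1 : ℝ)) :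
        Fin (n + 1) → EuclideanSpace ℝ (Fin 2))‖ ≤ 1 := fun j i => by
    rw [Pi.norm_single, PiLp.norm_single, norm_one]
  have hφsmooth : ContDiff ℝ (⊤ : ℕ∞) φ := (contDiff_pairCutoff hη).smul hu
  have hφsupp : HasCompactSupport φ := husupp.smul_left (f := pairCutoff η)
  refine ⟨φ, hφsmooth, hφsupp, ?_, ?_, ?_, ?_⟩
  · intro x hx j k hjk hxjk
    refine notMem_tsupport_iff_eventuallyEq.2 ?_ hx
    filter_upwards [pairCutoff_eventually_eq_zero hz hjk hxjk] with z hz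
    simp [hφ, hz]
  · have hI₁ : ∫ x, ‖u x - φ x‖ ^ 2 ≤ M ^ 2 * c * V * δ :=
      integral_le_of_le_pairEnergy hη h1 hδ.le hint (sq_nonneg M) (fun x => sq_nonneg _)
        (fun x hx => by simp [(hoff x hx).eq_of_nhds, (hφoff x hx).eq_of_nhds])
        fun x => norm_sub_pairCutoff_smul_sq_le h0 h1 (hM x) x
    have hI₂ : ∫ x, ∑ j : Fin (n + 1), ∑ i : Fin 2,
          ‖fderiv ℝ u x (Pi.single j (EuclideanSpace.single i (1 : ℝ)))
            - fderiv ℝ φ x (Pi.single j (EuclideanSpace.single i (1 : ℝ)))‖ ^ 2 ≤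
          B * c * V * δ := by
      refine integral_le_of_le_pairEnergy hη h1 hδ.le hint hB (fun x => by positivity)
        (fun x hx => by simp [(hoff x hx).fderiv_eq, (hφoff x hx).fderiv_eq]) fun x => ?_
      calc _ ≤ ∑ _j : Fin (n + 1), ∑ _i : Fin 2, (2 + 8 * c) * M ^ 2 * pairEnergy η x :=
            Finset.sum_le_sum fun j _ => Finset.sum_le_sum fun i _ =>
              norm_fderiv_sub_fderiv_pairCutoff_smul_sq_le hη h0 h1 (hu' x) (hM x) (hM' x)
                (hnorm j i)
        _ = B * pairEnergy η x := by
            simp only [Finset.sum_const, Finset.card_univ, Fintype.card_fin, nsmul_eq_mul, B]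
            push_cast
            ring
    calc _ ≤ M ^ 2 * c * V * δ + B * c * V * δ := add_le_add hI₁ hI₂
      _ = A * δ := by rw [hA]; ring
      _ < (A + 1) * δ := by linarith
      _ = ε := by rw [hδ_def]; field_simp
  · intro h σ x
    simp only [hφ, h σ x, pairCutoff_comp_perm]
  · intro h σ x
    simp only [hφ, h σ x, pairCutoff_comp_perm]
    exact smul_comm _ _ _
end

section
/- Let n ≥ 1, let ψ : ℝⁿ → ℂ be differentiable at a point x₀ with ψ(x₀) ≠ 0, and let a ∈ ℝⁿ. Then the function |ψ| is differentiable at x₀ with ∇|ψ|(x₀) = Re( (conj(ψ(x₀))/|ψ(x₀)|) · ∇ψ(x₀) ), and the pointwise diamagnetic inequality holds: ‖∇|ψ|(x₀)‖ ≤ ( ∑_{j=1}ⁿ | −i ∂_j ψ(x₀) + a_j ψ(x₀) |² )^{1/2}. -/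
open ComplexConjugate in
/-- The derivative of `‖f‖` at a point where the complex-valued function `f` does not vanish. -/
theorem fderiv_complex_norm_apply {E : Type*} [NormedAddCommGroup E] [NormedSpace ℝ E]
    {f : E → ℂ} {x : E} (hf : DifferentiableAt ℝ f x) (h0 : f x ≠ 0) (v : E) :
    fderiv ℝ (fun y => ‖f y‖) x v = (conj (f x) / (‖f x‖ : ℂ) * fderiv ℝ f x v).re := by
  have hnorm : ‖f x‖ ≠ 0 := norm_ne_zero_iff.mpr h0
  have hsq := congrArg (fun L => L v)
    (((hf.norm ℝ h0).hasFDerivAt.pow 2).unique hf.hasFDerivAt.norm_sq)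
  have hinner : ‖f x‖ * fderiv ℝ (fun y => ‖f y‖) x v = (conj (f x) * fderiv ℝ f x v).re := by
    simp [Complex.inner, mul_assoc] at hsq
    simp
    linarith
  rw [div_mul_eq_mul_div, Complex.div_ofReal_re, eq_div_iff hnorm, mul_comm, hinner]

open ComplexConjugate in
/-- The component of `w` along `z` is unaffected by a purely imaginary multiple of `z`. -/
theorem abs_re_conj_div_norm_mul_le {z : ℂ} (hz : z ≠ 0) (w : ℂ) (t : ℝ) :
    |(conj z / (‖z‖ : ℂ) * w).re| ≤ ‖-Complex.I * w + t * z‖ := by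
  have hnorm : (‖z‖ : ℂ) ≠ 0 := by simpa using hz
  have hunit : ‖conj z / (‖z‖ : ℂ)‖ = 1 := by simp [hz]
  have hphase : conj z / (‖z‖ : ℂ) * z = ‖z‖ := by
    rw [div_mul_eq_mul_div, Complex.conj_mul', div_eq_iff hnorm, sq]
  have hre : (conj z / (‖z‖ : ℂ) * w).re =
      (conj z / (‖z‖ : ℂ) * (Complex.I * (-Complex.I * w + t * z))).re := by
    have hexpand : conj z / (‖z‖ : ℂ) * (Complex.I * (-Complex.I * w + t * z)) =
        conj z / (‖z‖ : ℂ) * w + Complex.I * ((t * ‖z‖ : ℝ) : ℂ) := by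
      push_cast
      linear_combination (Complex.I * t) * hphase - conj z / (‖z‖ : ℂ) * w * Complex.I_sq
    rw [hexpand, Complex.add_re, Complex.I_mul_re, Complex.ofReal_im, neg_zero, add_zero]
  calc |(conj z / (‖z‖ : ℂ) * w).re|
      ≤ ‖conj z / (‖z‖ : ℂ) * (Complex.I * (-Complex.I * w + t * z))‖ :=
        hre ▸ Complex.abs_re_le_norm _
    _ = ‖-Complex.I * w + t * z‖ := by
        rw [norm_mul, norm_mul, hunit, Complex.norm_I, one_mul, one_mul]

/-- **Pointwise diamagnetic inequality.** If `ψ : ℝⁿ → ℂ` is differentiable at `x₀` with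
`ψ(x₀) ≠ 0` and `a ∈ ℝⁿ`, then `|ψ|` is differentiable at `x₀` with
`∇|ψ|(x₀) = Re((conj ψ(x₀)/|ψ(x₀)|)·∇ψ(x₀))`, and
`‖∇|ψ|(x₀)‖ ≤ (∑_j |(-i∂_j + a_j)ψ(x₀)|²)^{1/2}`. -/
theorem pointwise_diamagnetic_inequality
    (n : ℕ) (hn : 1 ≤ n) (ψ : (Fin n → ℝ) → ℂ) (x₀ : Fin n → ℝ)
    (hψ : DifferentiableAt ℝ ψ x₀) (hne : ψ x₀ ≠ 0) (a : Fin n → ℝ) :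
    DifferentiableAt ℝ (fun x => ‖ψ x‖) x₀ ∧
    (∀ j : Fin n, fderiv ℝ (fun x => ‖ψ x‖) x₀ (Pi.single j 1) =
      ((starRingEnd ℂ) (ψ x₀) / (‖ψ x₀‖ : ℂ) * fderiv ℝ ψ x₀ (Pi.single j 1)).re) ∧
    Real.sqrt (∑ j : Fin n, (fderiv ℝ (fun x => ‖ψ x‖) x₀ (Pi.single j 1)) ^ 2) ≤
      Real.sqrt (∑ j : Fin n,
        ‖(-Complex.I) * fderiv ℝ ψ x₀ (Pi.single j 1) + (a j : ℂ) * ψ x₀‖ ^ 2) := by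
  refine ⟨hψ.norm ℝ hne, fun j => fderiv_complex_norm_apply hψ hne _, ?_⟩
  refine Real.sqrt_le_sqrt (Finset.sum_le_sum fun j _ => ?_)
  rw [fderiv_complex_norm_apply hψ hne, ← sq_abs]
  gcongr
  exact abs_re_conj_div_norm_mul_le hne _ (a j)
end

section
/- Let η ≥ 0 and l > 0, and let ξ_S(ηl) be the unique t ∈ [0, π/2) with t·tan(t) = ηl. Then for every C¹ function u : [−l, l] → ℂ, ∫_{−l}^{l} |u′(r)|² dr + 2η·|u(0)|² ≥ (ξ_S(ηl)²/l²) · ∫_{−l}^{l} |u(r)|² dr. (This is the quadratic-form statement that the operator −d²/dr² + 2η·δ₀(r) on [−l,l] with Neumann boundary conditions at r = ±l is bounded below by ξ_S(ηl)²/l².) -/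
open MeasureTheory intervalIntegral

/-- Riccati (ground-state substitution) bound on the half interval `[0, l]`: if `k * l < π / 2`,
the form `∫ ‖v'‖² + k tan (k l) ‖v 0‖²` is bounded below by `k² ∫ ‖v‖²`. -/
theorem sq_mul_integral_norm_sq_le_of_robin {E : Type*} [NormedAddCommGroup E]
    [InnerProductSpace ℝ E] {k l : ℝ} (hl : 0 ≤ l) (hk : 0 ≤ k) (hkl : k * l < Real.pi / 2)
    {v : ℝ → E} (hv : ContDiff ℝ 1 v) :
    k ^ 2 * ∫ r in (0 : ℝ)..l, ‖v r‖ ^ 2 ≤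
      (∫ r in (0 : ℝ)..l, ‖deriv v r‖ ^ 2) + k * Real.tan (k * l) * ‖v 0‖ ^ 2 := by
  have hv' : Continuous (deriv v) := hv.continuous_deriv le_rfl
  have hvc : Continuous v := hv.continuous
  have hder : ∀ r ∈ Set.Icc 0 l, HasDerivAt (fun r => k * Real.tan (k * (l - r)) * ‖v r‖ ^ 2)
      (-(k ^ 2 + (k * Real.tan (k * (l - r))) ^ 2) * ‖v r‖ ^ 2 +
        k * Real.tan (k * (l - r)) * (2 * inner ℝ (v r) (deriv v r))) r := by
    intro r hr
    have hcos : Real.cos (k * (l - r)) ≠ 0 := by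
      refine (Real.cos_pos_of_mem_Ioo ⟨?_, ?_⟩).ne'
      · have := mul_nonneg hk (sub_nonneg.2 hr.2)
        linarith [Real.pi_pos]
      · nlinarith [mul_nonneg hk hr.1]
    have harg : HasDerivAt (fun r => k * (l - r)) (-k) r := by
      simpa using ((hasDerivAt_id r).const_sub l).const_mul k
    have hg : HasDerivAt (fun r => k * Real.tan (k * (l - r)))
        (-(k ^ 2 + (k * Real.tan (k * (l - r))) ^ 2)) r := by
      refine (((Real.hasDerivAt_tan hcos).comp r harg).const_mul k).congr_deriv ?_
      rw [one_div, ← Real.inv_one_add_tan_sq hcos, inv_inv]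
      ring
    exact hg.mul ((hv.differentiable one_ne_zero r).hasDerivAt.norm_sq)
  have hle := sub_le_integral_of_hasDeriv_right_of_le
    (φ := fun r => ‖deriv v r‖ ^ 2 - k ^ 2 * ‖v r‖ ^ 2) hl
    (fun r hr => (hder r hr).continuousAt.continuousWithinAt)
    (fun r hr => (hder r (Set.Ioo_subset_Icc_self hr)).hasDerivWithinAt)
    (Continuous.integrableOn_Icc (by fun_prop)) (fun r _ => by
      have h := norm_sub_sq_real (deriv v r) ((k * Real.tan (k * (l - r))) • v r)
      rw [inner_smul_right, real_inner_comm, norm_smul, mul_pow, Real.norm_eq_abs, sq_abs] at h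
      nlinarith [sq_nonneg ‖deriv v r - (k * Real.tan (k * (l - r))) • v r‖])
  rw [intervalIntegral.integral_sub (Continuous.intervalIntegrable (by fun_prop) _ _)
    (Continuous.intervalIntegrable (by fun_prop) _ _),
    intervalIntegral.integral_const_mul] at hle
  simp only [sub_self, mul_zero, Real.tan_zero, zero_mul, sub_zero] at hle
  linarith

/-- The integral over a symmetric interval, folded onto `[0, l]`. -/
theorem integral_symm_eq_add {f : ℝ → ℝ} (hf : Continuous f) (l : ℝ) :
    ∫ r in (-l)..l, f r = (∫ r in (0 : ℝ)..l, f r) + ∫ r in (0 : ℝ)..l, f (-r) := by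
  rw [intervalIntegral.integral_comp_neg, neg_zero, add_comm,
    intervalIntegral.integral_add_adjacent_intervals (hf.intervalIntegrable _ _)
      (hf.intervalIntegrable _ _)]

/-- **Pairwise relative Lieb–Liniger bound.** For `η ≥ 0`, `l > 0` and `ξ_S(ηl)` the
unique `t ∈ [0, π/2)` with `t·tan t = ηl`, every `C¹` function `u : [-l, l] → ℂ` satisfies
`∫_{-l}^{l} |u'|² + 2η|u(0)|² ≥ (ξ_S(ηl)²/l²)·∫_{-l}^{l} |u|²`, i.e. the operator
`-d²/dr² + 2η δ₀` with Neumann conditions at `±l` is bounded below by `ξ_S(ηl)²/l²`. -/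
theorem pairwise_relative_lieb_liniger
    (η l : ℝ) (hη : 0 ≤ η) (hl : 0 < l)
    (ξ : ℝ) (hξ0 : 0 ≤ ξ) (hξπ : ξ < Real.pi / 2) (hξ : ξ * Real.tan ξ = η * l)
    (u : ℝ → ℂ) (hu : ContDiff ℝ 1 u) :
    (∫ r in (-l)..l, ‖deriv u r‖ ^ 2) + 2 * η * ‖u 0‖ ^ 2 ≥
      ξ ^ 2 / l ^ 2 * ∫ r in (-l)..l, ‖u r‖ ^ 2 := by
  have hu' : Continuous (deriv u) := hu.continuous_deriv le_rfl
  have huc : Continuous u := hu.continuous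
  have hk : 0 ≤ ξ / l := by positivity
  have hkl : ξ / l * l = ξ := div_mul_cancel₀ ξ hl.ne'
  have hkη : ξ / l * Real.tan ξ = η := by
    rw [div_mul_eq_mul_div, hξ, mul_div_cancel_right₀ _ hl.ne']
  have hright := sq_mul_integral_norm_sq_le_of_robin hl.le hk (by rwa [hkl]) hu
  have hleft := sq_mul_integral_norm_sq_le_of_robin hl.le hk (by rwa [hkl])
    (hu.comp contDiff_neg)
  simp only [Function.comp_def, deriv_comp_neg, norm_neg, neg_zero, hkl, hkη] at hright hleft
  rw [integral_symm_eq_add (f := fun r => ‖deriv u r‖ ^ 2) (by fun_prop),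
    integral_symm_eq_add (f := fun r => ‖u r‖ ^ 2) (by fun_prop), ← div_pow]
  linarith
end

section
/- Let ξ : [0, ∞) → [0, π/2) be the function such that ξ(y)·tan(ξ(y)) = y for all y ≥ 0. Then: (i) the map y ↦ ξ(y)² is monotone increasing and concave on [0, ∞); consequently, for every η ≥ 0, ξ(η/x)²·x ≥ ξ(η)² for all x ≥ 1, and ξ(η/x)²·x ≤ ξ(η)² for all 0 < x ≤ 1; and (ii) for every η ≥ 0, the map x ↦ ξ(η/x)²·x³ is monotone increasing and convex on (0, ∞). -/
open Real Set Filter Topology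

/-- On `(0, π/2)` the function `tan t / t` is increasing. -/
theorem monotoneOn_tan_div_self : MonotoneOn (fun t : ℝ => tan t / t) (Ioo 0 (π / 2)) := by
  have hder : ∀ t ∈ Ioo (0 : ℝ) (π / 2), HasDerivAt (fun t : ℝ => tan t / t)
      ((1 / cos t ^ 2 * t - tan t * 1) / t ^ 2) t := fun t ht =>
    (hasDerivAt_tan (cos_pos_of_mem_Ioo ⟨by linarith [ht.1, pi_pos], ht.2⟩).ne').div
      (hasDerivAt_id t) ht.1.ne'
  refine monotoneOn_of_deriv_nonneg (convex_Ioo _ _)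
    (fun t ht => (hder t ht).continuousAt.continuousWithinAt) ?_ ?_
  · rw [interior_Ioo]
    exact fun t ht => (hder t ht).differentiableAt.differentiableWithinAt
  · rw [interior_Ioo]
    intro t ht
    rw [(hder t ht).deriv]
    have hc : 0 < cos t := cos_pos_of_mem_Ioo ⟨by linarith [ht.1, pi_pos], ht.2⟩
    have hs : 0 < sin t := sin_pos_of_pos_of_lt_pi ht.1 (by linarith [ht.2, pi_pos])
    have hst : sin t * cos t ≤ t := by
      nlinarith [sin_le ht.1.le, cos_le_one t]
    refine div_nonneg ?_ (by positivity)
    have : 1 / cos t ^ 2 * t - tan t * 1 = (t - sin t * cos t) / cos t ^ 2 := by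
      rw [tan_eq_sin_div_cos]; field_simp
    rw [this]
    exact div_nonneg (by linarith) (by positivity)

/-- The derivative of `ξ ^ 2` in terms of `t = ξ y`, where `y = t * tan t`. -/
noncomputable def sqSlope (t : ℝ) : ℝ := 2 / (tan t / t + 1 / cos t ^ 2)

theorem sqSlope_pos {t : ℝ} (ht : t ∈ Ioo 0 (π / 2)) : 0 < sqSlope t := by
  have hc : 0 < cos t := cos_pos_of_mem_Ioo ⟨by linarith [ht.1, pi_pos], ht.2⟩
  have hT : 0 < tan t := tan_pos_of_pos_of_lt_pi_div_two ht.1 ht.2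
  have h0 := ht.1
  unfold sqSlope
  positivity

theorem sqSlope_antitoneOn : AntitoneOn sqSlope (Ioo 0 (π / 2)) := by
  intro a ha b hb hab
  have hcb : 0 < cos b := cos_pos_of_mem_Ioo ⟨by linarith [hb.1, pi_pos], hb.2⟩
  have hca : 0 < cos a := cos_pos_of_mem_Ioo ⟨by linarith [ha.1, pi_pos], ha.2⟩
  have hT : 0 < tan a := tan_pos_of_pos_of_lt_pi_div_two ha.1 ha.2
  have h0 := ha.1
  have hcos : cos b ≤ cos a :=
    cos_le_cos_of_nonneg_of_le_pi ha.1.le (by linarith [hb.2, pi_pos]) hab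
  have htan : tan a / a ≤ tan b / b := monotoneOn_tan_div_self ha hb hab
  unfold sqSlope
  gcongr

/-- The derivative of `x ↦ ξ (η / x) ^ 2 * x ^ 3`, divided by `η ^ 2`, in terms of
`t = ξ (η / x)`. -/
noncomputable def cubicSlope (t : ℝ) : ℝ := (cos t / sin t) ^ 2 + sqSlope t / sin t ^ 2

theorem cubicSlope_nonneg {t : ℝ} (ht : t ∈ Ioo 0 (π / 2)) : 0 ≤ cubicSlope t := by
  have := sqSlope_pos ht
  unfold cubicSlope
  positivity

theorem cubicSlope_antitoneOn : AntitoneOn cubicSlope (Ioo 0 (π / 2)) := by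
  intro a ha b hb hab
  have hcb : 0 < cos b := cos_pos_of_mem_Ioo ⟨by linarith [hb.1, pi_pos], hb.2⟩
  have hsa : 0 < sin a := sin_pos_of_pos_of_lt_pi ha.1 (by linarith [ha.2, pi_pos])
  have hcos : cos b ≤ cos a :=
    cos_le_cos_of_nonneg_of_le_pi ha.1.le (by linarith [hb.2, pi_pos]) hab
  have hca : 0 < cos a := hcb.trans_le hcos
  have hsin : sin a ≤ sin b :=
    sin_le_sin_of_le_of_le_pi_div_two (by linarith [ha.1, pi_pos]) hb.2.le hab
  have hsb : 0 < sin b := hsa.trans_le hsin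
  have hS := sqSlope_antitoneOn ha hb hab
  have hpos := sqSlope_pos ha
  unfold cubicSlope
  gcongr

theorem strictMonoOn_mul_tan : StrictMonoOn (fun t : ℝ => t * tan t) (Ico 0 (π / 2)) := by
  intro a ha b hb hab
  have h := strictMonoOn_tan ⟨by linarith [ha.1, pi_pos], ha.2⟩
    ⟨by linarith [hb.1, pi_pos], hb.2⟩ hab
  exact mul_lt_mul'' hab h ha.1 (tan_nonneg_of_nonneg_of_le_pi_div_two ha.1 ha.2.le)

/-- On `[0, ∞)`, `ξ` is the inverse of `t ↦ t * tan t` with values in `[0, π/2)`. -/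
def IsMulTanInverse (ξ : ℝ → ℝ) : Prop :=
  ∀ y : ℝ, 0 ≤ y → 0 ≤ ξ y ∧ ξ y < π / 2 ∧ ξ y * tan (ξ y) = y

theorem xi_strictMonoOn {ξ : ℝ → ℝ} (hξ : IsMulTanInverse ξ) : StrictMonoOn ξ (Ici 0) := by
  intro a ha b hb hab
  obtain ⟨ha0, ha1, ha2⟩ := hξ a ha
  obtain ⟨hb0, hb1, hb2⟩ := hξ b hb
  refine (strictMonoOn_mul_tan.lt_iff_lt ⟨ha0, ha1⟩ ⟨hb0, hb1⟩).1 ?_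
  simpa only [ha2, hb2] using hab

theorem xi_mul_tan {ξ : ℝ → ℝ} (hξ : IsMulTanInverse ξ) {t : ℝ}
    (ht : t ∈ Ico 0 (π / 2)) : ξ (t * tan t) = t := by
  obtain ⟨h0, h1, h2⟩ := hξ (t * tan t)
    (mul_nonneg ht.1 (tan_nonneg_of_nonneg_of_le_pi_div_two ht.1 ht.2.le))
  exact strictMonoOn_mul_tan.injOn ⟨h0, h1⟩ ht h2

theorem xi_zero {ξ : ℝ → ℝ} (hξ : IsMulTanInverse ξ) : ξ 0 = 0 := by
  simpa using xi_mul_tan hξ (t := 0) ⟨le_rfl, by positivity⟩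

theorem xi_mem_Ioo {ξ : ℝ → ℝ} (hξ : IsMulTanInverse ξ) {y : ℝ} (hy : 0 < y) :
    ξ y ∈ Ioo 0 (π / 2) := by
  refine ⟨?_, (hξ y hy.le).2.1⟩
  simpa only [xi_zero hξ] using xi_strictMonoOn hξ self_mem_Ici hy.le hy

theorem xi_continuousAt {ξ : ℝ → ℝ} (hξ : IsMulTanInverse ξ) {y : ℝ} (hy : 0 < y) :
    ContinuousAt ξ y := by
  refine ((xi_strictMonoOn hξ).mono Ioi_subset_Ici_self).continuousAt_of_image_mem_nhds
    (Ioi_mem_nhds hy) ?_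
  have hmem := xi_mem_Ioo hξ hy
  refine mem_of_superset (Ioo_mem_nhds hmem.1 hmem.2) fun t ht => ?_
  exact ⟨t * tan t, mul_pos ht.1 (tan_pos_of_pos_of_lt_pi_div_two ht.1 ht.2),
    xi_mul_tan hξ ⟨ht.1.le, ht.2⟩⟩

theorem hasDerivAt_xi_sq {ξ : ℝ → ℝ} (hξ : IsMulTanInverse ξ) {y : ℝ} (hy : 0 < y) :
    HasDerivAt (fun y => ξ y ^ 2) (sqSlope (ξ y)) y := by
  have ht := xi_mem_Ioo hξ hy
  have ht0 := ht.1
  have hc : 0 < cos (ξ y) := cos_pos_of_mem_Ioo ⟨by linarith [ht.1, pi_pos], ht.2⟩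
  have hT : 0 < tan (ξ y) := tan_pos_of_pos_of_lt_pi_div_two ht.1 ht.2
  have hder : HasDerivAt (fun t => t * tan t)
      (1 * tan (ξ y) + ξ y * (1 / cos (ξ y) ^ 2)) (ξ y) :=
    (hasDerivAt_id _).mul (hasDerivAt_tan hc.ne')
  have hinv := hder.of_local_left_inverse (xi_continuousAt hξ hy) (by positivity)
    (by filter_upwards [Ioi_mem_nhds hy] with z hz using (hξ z (le_of_lt hz)).2.2)
  refine (hinv.fun_pow 2).congr_deriv ?_
  unfold sqSlope
  field_simp
  norm_num [mul_comm]

theorem xi_sq_le {ξ : ℝ → ℝ} (hξ : IsMulTanInverse ξ) {y : ℝ} (hy : 0 ≤ y) : ξ y ^ 2 ≤ y := by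
  obtain ⟨h0, h1, h2⟩ := hξ y hy
  nlinarith [le_tan h0 h1]

theorem xi_sq_continuousOn {ξ : ℝ → ℝ} (hξ : IsMulTanInverse ξ) :
    ContinuousOn (fun y => ξ y ^ 2) (Ici 0) := by
  intro y hy
  rcases (mem_Ici.1 hy).eq_or_lt with rfl | hy
  · have hlim : Tendsto (fun y => ξ y ^ 2) (𝓝[≥] 0) (𝓝 0) :=
      tendsto_of_tendsto_of_tendsto_of_le_of_le' tendsto_const_nhds
        (tendsto_id.mono_left nhdsWithin_le_nhds)
        (Eventually.of_forall fun y => sq_nonneg (ξ y))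
        (eventually_mem_nhdsWithin.mono fun y hy => xi_sq_le hξ hy)
    simpa [ContinuousWithinAt, xi_zero hξ] using hlim
  · exact ((xi_continuousAt hξ hy).pow 2).continuousWithinAt

theorem xi_sq_monotoneOn {ξ : ℝ → ℝ} (hξ : IsMulTanInverse ξ) :
    MonotoneOn (fun y => ξ y ^ 2) (Ici 0) := fun a ha _ hb hab =>
  pow_le_pow_left₀ (hξ a ha).1 ((xi_strictMonoOn hξ).monotoneOn ha hb hab) 2

theorem xi_sq_concaveOn {ξ : ℝ → ℝ} (hξ : IsMulTanInverse ξ) :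
    ConcaveOn ℝ (Ici 0) (fun y => ξ y ^ 2) := by
  refine AntitoneOn.concaveOn_of_deriv (convex_Ici 0) (xi_sq_continuousOn hξ) ?_ ?_
  · rw [interior_Ici]
    exact fun y hy => (hasDerivAt_xi_sq hξ hy).differentiableAt.differentiableWithinAt
  · rw [interior_Ici]
    intro a ha b hb hab
    rw [(hasDerivAt_xi_sq hξ ha).deriv, (hasDerivAt_xi_sq hξ hb).deriv]
    exact sqSlope_antitoneOn (xi_mem_Ioo hξ ha) (xi_mem_Ioo hξ hb)
      ((xi_strictMonoOn hξ).monotoneOn (Ioi_subset_Ici_self ha) (Ioi_subset_Ici_self hb) hab)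

theorem xi_sq_le_mul {ξ : ℝ → ℝ} (hξ : IsMulTanInverse ξ) {η x : ℝ}
    (hη : 0 ≤ η) (hx : 1 ≤ x) : ξ η ^ 2 ≤ ξ (η / x) ^ 2 * x := by
  have hx0 : 0 < x := by linarith
  have h := (xi_sq_concaveOn hξ).2 (self_mem_Ici (a := (0 : ℝ))) (mem_Ici.2 hη)
    (sub_nonneg.2 (inv_le_one_of_one_le₀ hx)) (inv_nonneg.2 hx0.le) (by ring)
  simp only [smul_eq_mul, xi_zero hξ, mul_zero, zero_add, ne_eq, OfNat.ofNat_ne_zero,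
    not_false_eq_true, zero_pow] at h
  rwa [inv_mul_eq_div, inv_mul_eq_div, div_le_iff₀ hx0] at h

theorem hasDerivAt_xi_sq_mul_cube {ξ : ℝ → ℝ} (hξ : IsMulTanInverse ξ) {η x : ℝ}
    (hη : 0 < η) (hx : 0 < x) :
    HasDerivAt (fun x => ξ (η / x) ^ 2 * x ^ 3) (η ^ 2 * cubicSlope (ξ (η / x))) x := by
  have hy : 0 < η / x := div_pos hη hx
  have ht := xi_mem_Ioo hξ hy
  have hdiv : HasDerivAt (fun x => η / x) (-η / x ^ 2) x := by
    simpa using (hasDerivAt_const x η).fun_div (hasDerivAt_id x) hx.ne'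
  refine (((hasDerivAt_xi_sq hξ hy).comp x hdiv).mul (hasDerivAt_pow 3 x)).congr_deriv ?_
  have hmul := (hξ _ hy.le).2.2
  simp only [Function.comp_apply]
  generalize ξ (η / x) = t at ht hmul ⊢
  have ht0 := ht.1
  have hc : 0 < cos t := cos_pos_of_mem_Ioo ⟨by linarith [ht.1, pi_pos], ht.2⟩
  have hs : 0 < sin t := sin_pos_of_pos_of_lt_pi ht.1 (by linarith [ht.2, pi_pos])
  have hη' : η = x * (t * (sin t / cos t)) := by
    rw [← tan_eq_sin_div_cos, hmul]; field_simp
  have hslope : sqSlope t = 2 * t * cos t ^ 2 / (sin t * cos t + t) := by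
    unfold sqSlope
    rw [tan_eq_sin_div_cos]
    field_simp
  rw [cubicSlope, hslope, hη']
  have : sin t * cos t + t ≠ 0 := by positivity
  field_simp
  push_cast
  ring

theorem xi_sq_mul_cube_monotoneOn_and_convexOn {ξ : ℝ → ℝ} (hξ : IsMulTanInverse ξ) {η : ℝ}
    (hη : 0 < η) :
    MonotoneOn (fun x => ξ (η / x) ^ 2 * x ^ 3) (Ioi 0) ∧
      ConvexOn ℝ (Ioi 0) (fun x => ξ (η / x) ^ 2 * x ^ 3) := by
  have hder := fun x (hx : x ∈ Ioi (0 : ℝ)) => hasDerivAt_xi_sq_mul_cube hξ hη hx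
  have hcont : ContinuousOn (fun x => ξ (η / x) ^ 2 * x ^ 3) (Ioi 0) :=
    fun x hx => (hder x hx).continuousAt.continuousWithinAt
  have hdiff : DifferentiableOn ℝ (fun x => ξ (η / x) ^ 2 * x ^ 3) (interior (Ioi 0)) := by
    rw [interior_Ioi]
    exact fun x hx => (hder x hx).differentiableAt.differentiableWithinAt
  refine ⟨monotoneOn_of_deriv_nonneg (convex_Ioi 0) hcont hdiff ?_,
    MonotoneOn.convexOn_of_deriv (convex_Ioi 0) hcont hdiff ?_⟩
  · rw [interior_Ioi]
    intro x hx
    rw [(hder x hx).deriv]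
    exact mul_nonneg (sq_nonneg η) (cubicSlope_nonneg (xi_mem_Ioo hξ (div_pos hη hx)))
  · rw [interior_Ioi]
    intro a ha b hb hab
    rw [(hder a ha).deriv, (hder b hb).deriv]
    have hya : 0 < η / a := div_pos hη ha
    have hyb : 0 < η / b := div_pos hη hb
    refine mul_le_mul_of_nonneg_left ?_ (sq_nonneg η)
    exact cubicSlope_antitoneOn (xi_mem_Ioo hξ hyb) (xi_mem_Ioo hξ hya)
      ((xi_strictMonoOn hξ).monotoneOn hyb.le hya.le (div_le_div_of_nonneg_left hη.le ha hab))

/-- Properties of the Lieb–Liniger exclusion function `ξ_S`: if `ξ : [0,∞) → [0,π/2)`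
satisfies `ξ(y)·tan(ξ(y)) = y` for all `y ≥ 0`, then (i) `y ↦ ξ(y)²` is monotone and
concave on `[0,∞)`, hence `ξ(η/x)²·x ≥ ξ(η)²` for `x ≥ 1` and `ξ(η/x)²·x ≤ ξ(η)²` for
`0 < x ≤ 1`; and (ii) for every `η ≥ 0` the map `x ↦ ξ(η/x)²·x³` is monotone and convex
on `(0,∞)`. -/
theorem xiS_properties
    (ξ : ℝ → ℝ)
    (hξ : ∀ y : ℝ, 0 ≤ y →
      0 ≤ ξ y ∧ ξ y < Real.pi / 2 ∧ ξ y * Real.tan (ξ y) = y) :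
    (MonotoneOn (fun y => ξ y ^ 2) (Set.Ici 0) ∧
      ConcaveOn ℝ (Set.Ici 0) (fun y => ξ y ^ 2)) ∧
    (∀ η : ℝ, 0 ≤ η →
      (∀ x : ℝ, 1 ≤ x → ξ (η / x) ^ 2 * x ≥ ξ η ^ 2) ∧
      (∀ x : ℝ, 0 < x → x ≤ 1 → ξ (η / x) ^ 2 * x ≤ ξ η ^ 2)) ∧
    (∀ η : ℝ, 0 ≤ η →
      MonotoneOn (fun x => ξ (η / x) ^ 2 * x ^ 3) (Set.Ioi 0) ∧
      ConvexOn ℝ (Set.Ioi 0) (fun x => ξ (η / x) ^ 2 * x ^ 3)) := by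
  refine ⟨⟨xi_sq_monotoneOn hξ, xi_sq_concaveOn hξ⟩, fun η hη => ⟨fun x hx =>
    xi_sq_le_mul hξ hη hx, fun x hx hx1 => ?_⟩, fun η hη => ?_⟩
  · have h := xi_sq_le_mul hξ (div_nonneg hη hx.le) ((one_le_inv₀ hx).2 hx1)
    rwa [div_inv_eq_mul, div_mul_cancel₀ _ hx.ne', ← div_eq_mul_inv, le_div_iff₀ hx] at h
  · rcases hη.eq_or_lt with rfl | hη
    · simp only [zero_div, xi_zero hξ, ne_eq, OfNat.ofNat_ne_zero, not_false_eq_true, zero_pow,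
        zero_mul]
      exact ⟨monotoneOn_const, convexOn_const 0 (convex_Ioi 0)⟩
    · exact xi_sq_mul_cube_monotoneOn_and_convexOn hξ hη
end

section
/- Let η ≥ 0, n ≥ 1, and let Q = [a, b] ⊂ ℝ be a finite interval of length |Q| = b − a > 0. Then for every smooth symmetric function ψ : ℝⁿ → ℂ, (1/2)·∫_{Qⁿ} ∑_{j=1}ⁿ |∂_j ψ|² dx + 2η·∑_{1≤j<k≤n} ∫_{Q^{n−1}} |ψ(x)|²|_{x_j = x_k = t} dt ∏_{l≠j,k} dx_l ≥ (n−1)·(ξ_S(η|Q|)²/|Q|²)·∫_{Qⁿ} |ψ|² dx, where the middle term integrates |ψ|² over the set where the j-th and k-th coordinates coincide (both equal to t ∈ Q) and the remaining coordinates range over Q. -/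
open MeasureTheory

/-- The point of `ℝⁿ` whose `j`-th and `k`-th coordinates equal `t` and whose remaining
coordinates are given by `z`. -/
def insertPair {N : ℕ} (j k : Fin N) (t : ℝ)
    (z : {l : Fin N // l ≠ j ∧ l ≠ k} → ℝ) : Fin N → ℝ :=
  fun l => if h : l = j ∨ l = k then t else z ⟨l, not_or.mp h⟩

/-- Integrated Riccati bound: a function `F` with `F' + F² ≤ -lam` bounds the Dirichlet energy
of `u` from below by `lam` times its mass, up to boundary terms. -/
lemma riccati_energy_bound {u u' : ℝ → ℂ} {F F' : ℝ → ℝ} {c d lam : ℝ} (hcd : c ≤ d)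
    (hu : ∀ t, HasDerivAt u (u' t) t) (hu' : Continuous u')
    (hF : ∀ t ∈ Set.Icc c d, HasDerivAt F (F' t) t) (hF' : ContinuousOn F' (Set.Icc c d))
    (hle : ∀ t ∈ Set.Icc c d, F' t + F t ^ 2 ≤ -lam) :
    lam * ∫ t in c..d, ‖u t‖ ^ 2 ≤
      (∫ t in c..d, ‖u' t‖ ^ 2) + F c * ‖u c‖ ^ 2 - F d * ‖u d‖ ^ 2 := by
  have huc : Continuous u := continuous_iff_continuousAt.2 fun t => (hu t).continuousAt
  have hFc : ContinuousOn F (Set.Icc c d) := fun t ht => (hF t ht).continuousAt.continuousWithinAt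
  have hint : IntervalIntegrable
      (fun t => F' t * ‖u t‖ ^ 2 + F t * (2 * inner ℝ (u t) (u' t))) volume c d := by
    apply ContinuousOn.intervalIntegrable
    rw [Set.uIcc_of_le hcd]
    have h1 : Continuous fun t => (2 : ℝ) * inner ℝ (u t) (u' t) :=
      continuous_const.mul (huc.inner hu')
    exact (hF'.mul (huc.norm.pow 2).continuousOn).add (hFc.mul h1.continuousOn)
  have hftc := intervalIntegral.integral_eq_sub_of_hasDerivAt
    (f := fun t => F t * ‖u t‖ ^ 2) (fun t ht => (hF t (by rwa [Set.uIcc_of_le hcd] at ht)).mul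
      (hu t).norm_sq) hint
  have hi1 : IntervalIntegrable (fun t => ‖u' t‖ ^ 2) volume c d :=
    (hu'.norm.pow 2).intervalIntegrable _ _
  have hi2 : IntervalIntegrable (fun t => lam * ‖u t‖ ^ 2) volume c d :=
    (continuous_const.mul (huc.norm.pow 2)).intervalIntegrable _ _
  have hmono := intervalIntegral.integral_mono_on hcd hint (hi1.sub hi2) (fun t ht => by
    have h1 := hle t ht
    have h2 : (0 : ℝ) ≤ ‖u' t - F t • u t‖ ^ 2 := by positivity
    rw [@norm_sub_sq_real, inner_smul_right, real_inner_comm, norm_smul, mul_pow,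
      Real.norm_eq_abs, sq_abs] at h2
    have h3 := mul_le_mul_of_nonneg_right h1 (sq_nonneg ‖u t‖)
    nlinarith)
  rw [intervalIntegral.integral_sub hi1 hi2, intervalIntegral.integral_const_mul] at hmono
  linarith

lemma hasDerivAt_const_mul_tan {k c t : ℝ} (h : Real.cos (k * (t - c)) ≠ 0) :
    HasDerivAt (fun t => -(k * Real.tan (k * (t - c))))
      (-(k ^ 2 * (1 + Real.tan (k * (t - c)) ^ 2))) t := by
  have h1 : HasDerivAt (fun t : ℝ => k * (t - c)) k t := by
    simpa using ((hasDerivAt_id t).sub_const c).const_mul k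
  have h2 := ((Real.hasDerivAt_tan h).comp t h1).const_mul k |>.neg
  refine h2.congr_deriv ?_
  rw [← Real.inv_one_add_tan_sq h]
  field_simp

section Interval

variable {u u' : ℝ → ℂ} {c d L k η : ℝ}

lemma cos_ne_zero_of_abs_le {s : ℝ} (hk : 0 ≤ k) (hkL : k * L < Real.pi / 2) (hs : |s| ≤ L) :
    Real.cos (k * s) ≠ 0 := by
  have h := mul_le_mul_of_nonneg_left hs hk
  rw [← abs_of_nonneg hk, ← abs_mul, abs_of_nonneg hk] at h
  exact (Real.cos_pos_of_mem_Ioo ⟨by linarith [neg_abs_le (k * s)],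
    by linarith [le_abs_self (k * s)]⟩).ne'

lemma mul_tan_le_mul_tan {s : ℝ} (hk : 0 ≤ k) (hkL : k * L < Real.pi / 2) (hs0 : 0 ≤ s)
    (hs : s ≤ L) : k * Real.tan (k * s) ≤ k * Real.tan (k * L) := by
  refine mul_le_mul_of_nonneg_left ?_ hk
  rcases (mul_le_mul_of_nonneg_left hs hk).eq_or_lt with h | h
  · rw [h]
  · have : 0 ≤ k * s := by positivity
    exact (Real.tan_lt_tan_of_lt_of_lt_pi_div_two (by linarith [Real.pi_pos]) hkL h).le

lemma continuousOn_tan_sq (hk : 0 ≤ k) (hkL : k * L < Real.pi / 2) (hd : d - c ≤ L) (e : ℝ)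
    (he : e ∈ Set.Icc c d) :
    ContinuousOn (fun t => -(k ^ 2 * (1 + Real.tan (k * (t - e)) ^ 2))) (Set.Icc c d) := by
  intro t ht
  have h1 : Real.cos (k * (t - e)) ≠ 0 := cos_ne_zero_of_abs_le hk hkL
    (abs_le.2 ⟨by linarith [ht.1, ht.2, he.1, he.2], by linarith [ht.1, ht.2, he.1, he.2]⟩)
  have h2 : ContinuousAt (fun t : ℝ => Real.tan (k * (t - e))) t :=
    ContinuousAt.comp (g := Real.tan) (f := fun t => k * (t - e))
      (Real.continuousAt_tan.2 h1) (by fun_prop)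
  exact (continuousAt_const.mul (continuousAt_const.add (h2.pow 2))).neg.continuousWithinAt

lemma energy_bound_robin_right (hk : 0 ≤ k) (hkL : k * L < Real.pi / 2)
    (hη : k * Real.tan (k * L) = η) (hcd : c ≤ d) (hd : d - c ≤ L)
    (hu : ∀ t, HasDerivAt u (u' t) t) (hu' : Continuous u') :
    k ^ 2 * ∫ t in c..d, ‖u t‖ ^ 2 ≤ (∫ t in c..d, ‖u' t‖ ^ 2) + η * ‖u d‖ ^ 2 := by
  have h := riccati_energy_bound (lam := k ^ 2) hcd hu hu'
    (fun t ht => hasDerivAt_const_mul_tan (k := k) (c := c) (cos_ne_zero_of_abs_le hk hkL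
      (abs_le.2 ⟨by linarith [ht.1, ht.2], by linarith [ht.1, ht.2]⟩)))
    (continuousOn_tan_sq hk hkL hd c ⟨le_rfl, hcd⟩) (fun t _ => by nlinarith)
  have h2 := mul_tan_le_mul_tan hk hkL (sub_nonneg.2 hcd) hd
  rw [hη] at h2
  have h3 := mul_le_mul_of_nonneg_right h2 (sq_nonneg ‖u d‖)
  simp only [sub_self, mul_zero, Real.tan_zero, neg_zero, zero_mul, add_zero] at h
  linarith

lemma energy_bound_robin_left (hk : 0 ≤ k) (hkL : k * L < Real.pi / 2)
    (hη : k * Real.tan (k * L) = η) (hcd : c ≤ d) (hd : d - c ≤ L)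
    (hu : ∀ t, HasDerivAt u (u' t) t) (hu' : Continuous u') :
    k ^ 2 * ∫ t in c..d, ‖u t‖ ^ 2 ≤ (∫ t in c..d, ‖u' t‖ ^ 2) + η * ‖u c‖ ^ 2 := by
  have h := riccati_energy_bound (lam := k ^ 2) hcd hu hu'
    (fun t ht => hasDerivAt_const_mul_tan (k := k) (c := d) (cos_ne_zero_of_abs_le hk hkL
      (abs_le.2 ⟨by linarith [ht.1, ht.2], by linarith [ht.1, ht.2]⟩)))
    (continuousOn_tan_sq hk hkL hd d ⟨hcd, le_rfl⟩) (fun t _ => by nlinarith)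
  have h2 := mul_tan_le_mul_tan hk hkL (sub_nonneg.2 hcd) hd
  rw [hη] at h2
  have h3 := mul_le_mul_of_nonneg_right h2 (sq_nonneg ‖u c‖)
  have h4 : k * (c - d) = -(k * (d - c)) := by ring
  simp only [sub_self, mul_zero, Real.tan_zero, neg_zero, zero_mul, sub_zero, h4, Real.tan_neg,
    mul_neg, neg_neg] at h
  linarith

lemma energy_bound_robin_both (hk : 0 ≤ k) (hkL : k * L < Real.pi / 2)
    (hη : k * Real.tan (k * L) = η) (hcd : c ≤ d) (hd : d - c ≤ L)
    (hu : ∀ t, HasDerivAt u (u' t) t) (hu' : Continuous u') :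
    2 * k ^ 2 * ∫ t in c..d, ‖u t‖ ^ 2 ≤
      (∫ t in c..d, ‖u' t‖ ^ 2) + η * ‖u c‖ ^ 2 + η * ‖u d‖ ^ 2 := by
  have hsign : ∀ s, 0 ≤ s → s ≤ L → 0 ≤ k * Real.tan (k * s) := fun s hs hsL => by
    have h1 : 0 ≤ k * s := by positivity
    have h2 := mul_le_mul_of_nonneg_left hsL hk
    exact mul_nonneg hk (Real.tan_nonneg_of_nonneg_of_le_pi_div_two h1 (by linarith))
  have h := riccati_energy_bound (lam := 2 * k ^ 2) hcd hu hu'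
    (fun t ht => (hasDerivAt_const_mul_tan (k := k) (c := c) (cos_ne_zero_of_abs_le hk hkL
      (abs_le.2 ⟨by linarith [ht.1, ht.2], by linarith [ht.1, ht.2]⟩))).add
      (hasDerivAt_const_mul_tan (k := k) (c := d) (cos_ne_zero_of_abs_le hk hkL
      (abs_le.2 ⟨by linarith [ht.1, ht.2], by linarith [ht.1, ht.2]⟩))))
    ((continuousOn_tan_sq hk hkL hd c ⟨le_rfl, hcd⟩).add
      (continuousOn_tan_sq hk hkL hd d ⟨hcd, le_rfl⟩)) (fun t ht => by
      have h1 := hsign (t - c) (by linarith [ht.1]) (by linarith [ht.2])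
      have h2 := hsign (d - t) (by linarith [ht.2]) (by linarith [ht.1])
      have h4 : k * (t - d) = -(k * (d - t)) := by ring
      simp only [Pi.add_apply, h4, Real.tan_neg]
      nlinarith [mul_nonneg h1 h2])
  have h2 := mul_tan_le_mul_tan hk hkL (sub_nonneg.2 hcd) hd
  rw [hη] at h2
  have h3 := mul_le_mul_of_nonneg_right h2 (sq_nonneg ‖u c‖)
  have h3' := mul_le_mul_of_nonneg_right h2 (sq_nonneg ‖u d‖)
  have h4 : k * (c - d) = -(k * (d - c)) := by ring
  simp only [Pi.add_apply, sub_self, mul_zero, Real.tan_zero, neg_zero, zero_add, add_zero, h4,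
    Real.tan_neg, mul_neg, neg_neg] at h
  linarith

end Interval

lemma integral_norm_sq_add_adjacent {f : ℝ → ℂ} (hf : Continuous f) (a b c : ℝ) :
    (∫ t in a..b, ‖f t‖ ^ 2) + ∫ t in b..c, ‖f t‖ ^ 2 = ∫ t in a..c, ‖f t‖ ^ 2 :=
  intervalIntegral.integral_add_adjacent_intervals
    ((hf.norm.pow 2).intervalIntegrable _ _) ((hf.norm.pow 2).intervalIntegrable _ _)

section Points

variable {u u' : ℝ → ℂ} {a b k η : ℝ}

lemma energy_bound_upto_greatest (hk : 0 ≤ k) (hkL : k * (b - a) < Real.pi / 2)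
    (hη : k * Real.tan (k * (b - a)) = η) (hu : ∀ t, HasDerivAt u (u' t) t)
    (hu' : Continuous u') (S : Finset ℝ) :
    ∀ m M, IsLeast (S : Set ℝ) m → IsGreatest (S : Set ℝ) M → (∀ y ∈ S, y ∈ Set.Icc a b) →
      k ^ 2 * ((∫ t in a..M, ‖u t‖ ^ 2) - 1 / 2 * ∫ t in a..m, ‖u t‖ ^ 2)
          + 1 / 2 * (η * ‖u M‖ ^ 2) ≤
        1 / 2 * (∫ t in a..M, ‖u' t‖ ^ 2) + ∑ y ∈ S, η * ‖u y‖ ^ 2 := by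
  have huc : Continuous u := continuous_iff_continuousAt.2 fun t => (hu t).continuousAt
  induction S using Finset.induction_on_max with
  | empty => intro m M hm; simp [IsLeast] at hm
  | insert c S hc ih =>
    intro m M hm hM hS
    have hcS : c ∉ S := fun h => lt_irrefl _ (hc c h)
    have hMc : M = c := hM.unique ⟨by simp, by
      intro y hy
      rcases Finset.mem_insert.1 (Finset.mem_coe.1 hy) with h | h
      exacts [h.le, (hc y h).le]⟩
    subst hMc
    have hMab := hS M (Finset.mem_insert_self _ _)
    rw [Finset.sum_insert hcS]
    rcases S.eq_empty_or_nonempty with rfl | hne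
    · have hmM : m = M := by simpa using hm.1
      subst hmM
      have := energy_bound_robin_right hk hkL hη hMab.1 (by linarith [hMab.2]) hu hu'
      simp only [Finset.sum_empty, add_zero]
      linarith
    · have hmin : IsLeast (S : Set ℝ) (S.min' hne) := S.isLeast_min' hne
      have hmax : IsGreatest (S : Set ℝ) (S.max' hne) := S.isGreatest_max' hne
      have hm' : m = S.min' hne := by
        refine hm.unique ⟨by simp [hmin.1], ?_⟩
        intro y hy
        rcases Finset.mem_insert.1 (Finset.mem_coe.1 hy) with h | h
        · exact h ▸ (hc _ hmin.1).le
        · exact hmin.2 h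
      rw [← hm'] at hmin
      have hS' : ∀ y ∈ S, y ∈ Set.Icc a b := fun y hy => hS y (Finset.mem_insert_of_mem hy)
      have h1 := ih m _ hmin hmax hS'
      have hN := hS' _ hmax.1
      have h2 := energy_bound_robin_both hk hkL hη (hc _ hmax.1).le
        (by linarith [hN.1, hMab.2]) hu hu'
      rw [← integral_norm_sq_add_adjacent huc a (S.max' hne) M,
        ← integral_norm_sq_add_adjacent hu' a (S.max' hne) M]
      linarith

lemma energy_bound_finset (hk : 0 ≤ k) (hkL : k * (b - a) < Real.pi / 2)
    (hη : k * Real.tan (k * (b - a)) = η) (hu : ∀ t, HasDerivAt u (u' t) t)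
    (hu' : Continuous u') {S : Finset ℝ} {m M : ℝ} (hm : IsLeast (S : Set ℝ) m)
    (hM : IsGreatest (S : Set ℝ) M) (hS : ∀ y ∈ S, y ∈ Set.Icc a b) :
    k ^ 2 * ((∫ t in a..b, ‖u t‖ ^ 2) - 1 / 2 * (∫ t in a..m, ‖u t‖ ^ 2)
        - 1 / 2 * ∫ t in M..b, ‖u t‖ ^ 2) ≤
      1 / 2 * (∫ t in a..b, ‖u' t‖ ^ 2) + ∑ y ∈ S, η * ‖u y‖ ^ 2 := by
  have huc : Continuous u := continuous_iff_continuousAt.2 fun t => (hu t).continuousAt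
  have hMab := hS M hM.1
  have h1 := energy_bound_upto_greatest hk hkL hη hu hu' S m M hm hM hS
  have h2 := energy_bound_robin_left hk hkL hη hMab.2 (by linarith [hMab.1]) hu hu'
  rw [← integral_norm_sq_add_adjacent huc a M b, ← integral_norm_sq_add_adjacent hu' a M b]
  linarith

/-- A particle on `[a, b]` among fixed particles at `z`: the mass carries the weight `1` between
the outermost fixed particles and `1 / 2` outside them. -/
lemma energy_bound_points {κ : Type*} [Fintype κ] [Nonempty κ] (hk : 0 ≤ k)
    (hkL : k * (b - a) < Real.pi / 2) (hη : k * Real.tan (k * (b - a)) = η) (hη0 : 0 ≤ η)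
    (hab : a ≤ b) (hu : ∀ t, HasDerivAt u (u' t) t) (hu' : Continuous u') (z : κ → ℝ)
    (hz : ∀ i, z i ∈ Set.Icc a b) :
    k ^ 2 * ((∫ t in Set.Icc a b, ‖u t‖ ^ 2)
        - 1 / 2 * (∫ t in Set.Icc a b, {t | ∀ i, t < z i}.indicator (fun t => ‖u t‖ ^ 2) t)
        - 1 / 2 * ∫ t in Set.Icc a b, {t | ∀ i, z i < t}.indicator (fun t => ‖u t‖ ^ 2) t) ≤
      1 / 2 * (∫ t in Set.Icc a b, ‖u' t‖ ^ 2) + ∑ i, η * ‖u (z i)‖ ^ 2 := by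
  obtain ⟨i₀, hi₀⟩ := Finite.exists_min z
  obtain ⟨i₁, hi₁⟩ := Finite.exists_max z
  have hlt : {t | ∀ i, t < z i} = Set.Iio (z i₀) :=
    Set.ext fun t => ⟨fun h => h i₀, fun h i => lt_of_lt_of_le h (hi₀ i)⟩
  have hgt : {t | ∀ i, z i < t} = Set.Ioi (z i₁) :=
    Set.ext fun t => ⟨fun h => h i₁, fun h i => lt_of_le_of_lt (hi₁ i) h⟩
  have hI : Set.Icc a b ∩ Set.Iio (z i₀) = Set.Ico a (z i₀) := by
    ext t
    have := (hz i₀).2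
    simp only [Set.mem_inter_iff, Set.mem_Icc, Set.mem_Iio, Set.mem_Ico]
    constructor
    · rintro ⟨⟨h1, -⟩, h2⟩; exact ⟨h1, h2⟩
    · rintro ⟨h1, h2⟩; exact ⟨⟨h1, by linarith⟩, h2⟩
  have hJ : Set.Icc a b ∩ Set.Ioi (z i₁) = Set.Ioc (z i₁) b := by
    ext t
    have := (hz i₁).1
    simp only [Set.mem_inter_iff, Set.mem_Icc, Set.mem_Ioi, Set.mem_Ioc]
    constructor
    · rintro ⟨⟨-, h1⟩, h2⟩; exact ⟨h2, h1⟩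
    · rintro ⟨h1, h2⟩; exact ⟨⟨by linarith, h2⟩, h1⟩
  rw [hlt, hgt, setIntegral_indicator measurableSet_Iio, setIntegral_indicator measurableSet_Ioi,
    hI, hJ, integral_Ico_eq_integral_Ioc, integral_Icc_eq_integral_Ioc,
    integral_Icc_eq_integral_Ioc, ← intervalIntegral.integral_of_le hab,
    ← intervalIntegral.integral_of_le hab, ← intervalIntegral.integral_of_le (hz i₀).1,
    ← intervalIntegral.integral_of_le (hz i₁).2]
  have hm : IsLeast (Finset.univ.image z : Set ℝ) (z i₀) := by
    refine ⟨by simp, ?_⟩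
    intro y hy
    obtain ⟨i, -, rfl⟩ := Finset.mem_image.1 (Finset.mem_coe.1 hy)
    exact hi₀ i
  have hM : IsGreatest (Finset.univ.image z : Set ℝ) (z i₁) := by
    refine ⟨by simp, ?_⟩
    intro y hy
    obtain ⟨i, -, rfl⟩ := Finset.mem_image.1 (Finset.mem_coe.1 hy)
    exact hi₁ i
  have h := energy_bound_finset hk hkL hη hu hu' hm hM (by
    intro y hy
    obtain ⟨i, -, rfl⟩ := Finset.mem_image.1 hy
    exact hz i)
  have h2 : ∑ y ∈ Finset.univ.image z, η * ‖u y‖ ^ 2 ≤ ∑ i, η * ‖u (z i)‖ ^ 2 :=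
    Finset.sum_image_le_of_nonneg (fun _ _ => by positivity)
  linarith

end Points

/-- The point whose `j`-th coordinate is `t` and whose other coordinates are given by `z`. -/
def insertCoord {ι : Type*} [DecidableEq ι] (j : ι) (t : ℝ) (z : {l // l ≠ j} → ℝ) : ι → ℝ :=
  fun l => if h : l = j then t else z ⟨l, h⟩

section Fubini

variable {ι κ : Type*} {j : ι} {e : κ → ι} {Φ : ℝ × (κ → ℝ) → ι → ℝ}

lemma preimage_pi_of_option_bijective
    (hbij : Function.Bijective fun o : Option κ => o.elim j e)
    (hj : ∀ p, Φ p j = p.1) (he : ∀ p i, Φ p (e i) = p.2 i) (s : ι → Set ℝ) :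
    Φ ⁻¹' (Set.univ.pi s) = s j ×ˢ Set.univ.pi fun i => s (e i) := by
  ext p
  simp only [Set.mem_preimage, Set.mem_pi, Set.mem_univ, true_imp_iff, Set.mem_prod]
  constructor
  · intro h
    exact ⟨hj p ▸ h j, fun i => he p i ▸ h (e i)⟩
  · rintro ⟨h1, h2⟩ l
    obtain ⟨o, rfl⟩ := hbij.surjective l
    cases o with
    | none => simpa [hj] using h1
    | some i => simpa [he] using h2 i

variable [Fintype ι] [Fintype κ]

lemma measurePreserving_of_option_bijective
    (hbij : Function.Bijective fun o : Option κ => o.elim j e)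
    (hj : ∀ p, Φ p j = p.1) (he : ∀ p i, Φ p (e i) = p.2 i) :
    MeasurePreserving Φ volume volume := by
  have hmeas : Measurable Φ := by
    refine measurable_pi_iff.2 fun l => ?_
    obtain ⟨o, rfl⟩ := hbij.surjective l
    cases o with
    | none => simpa [hj] using measurable_fst
    | some i => simp only [Option.elim_some, he]; fun_prop
  refine ⟨hmeas, ?_⟩
  rw [volume_pi]
  refine (Measure.pi_eq fun s hs => ?_).symm
  rw [Measure.map_apply hmeas (MeasurableSet.univ_pi hs),
    preimage_pi_of_option_bijective hbij hj he, Measure.volume_eq_prod,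
    Measure.prod_prod, volume_pi_pi,
    ← Fintype.prod_bijective _ hbij (fun o => volume (s (o.elim j e))) _ (fun _ => rfl),
    Fintype.prod_option]
  rfl

lemma measurePreserving_restrict_box
    (hbij : Function.Bijective fun o : Option κ => o.elim j e)
    (hj : ∀ p, Φ p j = p.1) (he : ∀ p i, Φ p (e i) = p.2 i) (Q : Set ℝ) (hQ : MeasurableSet Q) :
    MeasurePreserving Φ
      ((volume.restrict Q).prod (volume.restrict (Set.univ.pi fun _ : κ => Q)))
      (volume.restrict (Set.univ.pi fun _ : ι => Q)) := by
  have h := (measurePreserving_of_option_bijective hbij hj he).restrict_preimage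
    (MeasurableSet.univ_pi fun _ : ι => hQ)
  rwa [preimage_pi_of_option_bijective hbij hj he, Measure.volume_eq_prod,
    ← Measure.prod_restrict] at h

lemma integrable_comp_box
    (hbij : Function.Bijective fun o : Option κ => o.elim j e)
    (hj : ∀ p, Φ p j = p.1) (he : ∀ p i, Φ p (e i) = p.2 i) {Q : Set ℝ} (hQ : MeasurableSet Q)
    {g : (ι → ℝ) → ℝ} (hg : IntegrableOn g (Set.univ.pi fun _ => Q)) :
    Integrable (fun p => g (Φ p))
      ((volume.restrict Q).prod (volume.restrict (Set.univ.pi fun _ : κ => Q))) :=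
  ((measurePreserving_restrict_box hbij hj he Q hQ).integrable_comp
    hg.aestronglyMeasurable).2 hg

lemma integral_comp_box
    (hbij : Function.Bijective fun o : Option κ => o.elim j e)
    (hj : ∀ p, Φ p j = p.1) (he : ∀ p i, Φ p (e i) = p.2 i) {Q : Set ℝ} (hQ : MeasurableSet Q)
    {g : (ι → ℝ) → ℝ} (hg : IntegrableOn g (Set.univ.pi fun _ => Q)) :
    ∫ x in Set.univ.pi fun _ => Q, g x =
      ∫ p, g (Φ p) ∂((volume.restrict Q).prod
        (volume.restrict (Set.univ.pi fun _ : κ => Q))) := by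
  have h := measurePreserving_restrict_box hbij hj he Q hQ
  rw [← h.map_eq, integral_map h.measurable.aemeasurable]
  rw [h.map_eq]
  exact hg.aestronglyMeasurable

end Fubini

section Coordinate

variable {ι : Type*}

lemma option_elim_subtype_bijective (j : ι) :
    Function.Bijective fun o : Option {l // l ≠ j} => o.elim j Subtype.val := by
  constructor
  · rintro (_ | ⟨x, hx⟩) (_ | ⟨y, hy⟩) h
    · rfl
    · exact absurd h.symm hy
    · exact absurd h hx
    · simpa using h
  · intro l
    by_cases h : l = j
    · exact ⟨none, h.symm⟩
    · exact ⟨some ⟨l, h⟩, rfl⟩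

lemma insertCoord_self [DecidableEq ι] (j : ι) (t : ℝ) (z : {l // l ≠ j} → ℝ) :
    insertCoord j t z j = t := by
  simp [insertCoord]

lemma insertCoord_val [DecidableEq ι] (j : ι) (t : ℝ) (z : {l // l ≠ j} → ℝ) (i : {l // l ≠ j}) :
    insertCoord j t z i = z i := by
  simp [insertCoord, i.2]

lemma continuous_insertCoord [DecidableEq ι] {X : Type*} [TopologicalSpace X] (j : ι)
    {f : X → ℝ} {z : X → {l // l ≠ j} → ℝ} (hf : Continuous f) (hz : Continuous z) :
    Continuous fun x => insertCoord j (f x) (z x) := by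
  refine continuous_pi fun l => ?_
  by_cases h : l = j
  · simpa [insertCoord, h] using hf
  · simp only [insertCoord, h, dite_false]; fun_prop

lemma hasDerivAt_insertCoord [Fintype ι] [DecidableEq ι] (j : ι) (t : ℝ) (z : {l // l ≠ j} → ℝ) :
    HasDerivAt (fun t => insertCoord j t z) (Pi.single j 1) t := by
  refine hasDerivAt_pi.2 fun l => ?_
  by_cases h : l = j
  · subst h
    simpa [insertCoord] using hasDerivAt_id' t
  · simpa [insertCoord, h] using hasDerivAt_const t _

lemma integrableOn_box [Fintype ι] {g : (ι → ℝ) → ℝ} (hg : Continuous g) (a b : ℝ) :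
    IntegrableOn g (Set.univ.pi fun _ => Set.Icc a b) :=
  hg.continuousOn.integrableOn_compact (isCompact_univ_pi fun _ => isCompact_Icc)

lemma measurableSet_strict_min [Fintype ι] (j : ι) :
    MeasurableSet {x : ι → ℝ | ∀ i : {l // l ≠ j}, x j < x i} := by
  simp only [Set.ofPred_forall]
  exact MeasurableSet.iInter fun i =>
    measurableSet_lt (measurable_pi_apply _) (measurable_pi_apply _)

lemma measurableSet_strict_max [Fintype ι] (j : ι) :
    MeasurableSet {x : ι → ℝ | ∀ i : {l // l ≠ j}, x i < x j} := by
  simp only [Set.ofPred_forall]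
  exact MeasurableSet.iInter fun i =>
    measurableSet_lt (measurable_pi_apply _) (measurable_pi_apply _)

lemma setIntegral_weighted_le {X : Type*} [MeasurableSpace X] {μ : Measure X} {s : Set X}
    (hs : MeasurableSet s) {f₀ f₁ f₂ f₃ f₄ : X → ℝ} {c η : ℝ} (h₀ : IntegrableOn f₀ s μ)
    (h₁ : IntegrableOn f₁ s μ) (h₂ : IntegrableOn f₂ s μ) (h₃ : IntegrableOn f₃ s μ)
    (h₄ : IntegrableOn f₄ s μ)
    (h : ∀ x ∈ s, c * (f₀ x - 1 / 2 * f₁ x - 1 / 2 * f₂ x) ≤ 1 / 2 * f₃ x + η * f₄ x) :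
    c * ((∫ x in s, f₀ x ∂μ) - 1 / 2 * (∫ x in s, f₁ x ∂μ) - 1 / 2 * ∫ x in s, f₂ x ∂μ) ≤
      1 / 2 * (∫ x in s, f₃ x ∂μ) + η * ∫ x in s, f₄ x ∂μ := by
  have h₀₁ : IntegrableOn (fun x => f₀ x - 1 / 2 * f₁ x) s μ := h₀.sub (h₁.const_mul _)
  have hl : IntegrableOn (fun x => f₀ x - 1 / 2 * f₁ x - 1 / 2 * f₂ x) s μ :=
    h₀₁.sub (h₂.const_mul _)
  have hr : IntegrableOn (fun x => 1 / 2 * f₃ x + η * f₄ x) s μ :=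
    (h₃.const_mul _).add (h₄.const_mul _)
  have key := setIntegral_mono_on (hl.const_mul c) hr hs h
  rwa [integral_const_mul, integral_sub h₀₁ (h₂.const_mul _), integral_sub h₀ (h₁.const_mul _),
    integral_add (h₃.const_mul _) (h₄.const_mul _), integral_const_mul, integral_const_mul,
    integral_const_mul, integral_const_mul] at key

lemma energy_bound_coordinate [Fintype ι] [DecidableEq ι] {a b k η : ℝ} (hk : 0 ≤ k)
    (hkL : k * (b - a) < Real.pi / 2) (hη : k * Real.tan (k * (b - a)) = η) (hη0 : 0 ≤ η)
    (hab : a ≤ b) {ψ : (ι → ℝ) → ℂ} (hψ : ContDiff ℝ 1 ψ) (j : ι) [Nonempty {l // l ≠ j}] :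
    k ^ 2 * ((∫ x in Set.univ.pi fun _ : ι => Set.Icc a b, ‖ψ x‖ ^ 2)
        - 1 / 2 * (∫ x in Set.univ.pi fun _ : ι => Set.Icc a b,
            {x : ι → ℝ | ∀ i : {l // l ≠ j}, x j < x i}.indicator (fun x => ‖ψ x‖ ^ 2) x)
        - 1 / 2 * ∫ x in Set.univ.pi fun _ : ι => Set.Icc a b,
            {x : ι → ℝ | ∀ i : {l // l ≠ j}, x i < x j}.indicator (fun x => ‖ψ x‖ ^ 2) x) ≤
      1 / 2 * (∫ x in Set.univ.pi fun _ : ι => Set.Icc a b, ‖fderiv ℝ ψ x (Pi.single j 1)‖ ^ 2)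
        + η * ∑ i : {l // l ≠ j}, ∫ z in Set.univ.pi fun _ : {l // l ≠ j} => Set.Icc a b,
            ‖ψ (insertCoord j (z i) z)‖ ^ 2 := by
  have hd : Continuous fun x => fderiv ℝ ψ x (Pi.single j 1) :=
    (hψ.continuous_fderiv one_ne_zero).clm_apply continuous_const
  have hψ2 : Continuous fun x => ‖ψ x‖ ^ 2 := hψ.continuous.norm.pow 2
  have hi0 := integrableOn_box hψ2 a b
  have hi1 := hi0.indicator (measurableSet_strict_min j)
  have hi2 := hi0.indicator (measurableSet_strict_max j)
  have hd2 : Continuous fun x => ‖fderiv ℝ ψ x (Pi.single j 1)‖ ^ 2 := hd.norm.pow 2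
  have hi3 := integrableOn_box hd2 a b
  have hbij := option_elim_subtype_bijective j
  have hs := fun p : ℝ × ({l // l ≠ j} → ℝ) => insertCoord_self j p.1 p.2
  have hv := fun p : ℝ × ({l // l ≠ j} → ℝ) => insertCoord_val j p.1 p.2
  have hp0 := integrable_comp_box hbij hs hv measurableSet_Icc hi0
  have hp1 := integrable_comp_box hbij hs hv measurableSet_Icc hi1
  have hp2 := integrable_comp_box hbij hs hv measurableSet_Icc hi2
  have hp3 := integrable_comp_box hbij hs hv measurableSet_Icc hi3
  rw [integral_comp_box hbij hs hv measurableSet_Icc hi0,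
    integral_comp_box hbij hs hv measurableSet_Icc hi1,
    integral_comp_box hbij hs hv measurableSet_Icc hi2,
    integral_comp_box hbij hs hv measurableSet_Icc hi3,
    integral_prod_symm _ hp0, integral_prod_symm _ hp1, integral_prod_symm _ hp2,
    integral_prod_symm _ hp3]
  have hr0 := hp0.integral_prod_right
  have hr1 := hp1.integral_prod_right
  have hr2 := hp2.integral_prod_right
  have hr3 := hp3.integral_prod_right
  have hcont : ∀ i : {l // l ≠ j}, Continuous fun z : {l // l ≠ j} → ℝ =>
      ‖ψ (insertCoord j (z i) z)‖ ^ 2 := fun i =>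
    hψ2.comp (continuous_insertCoord j (continuous_apply i) continuous_id)
  have hr4 : ∀ i : {l // l ≠ j}, IntegrableOn (fun z : {l // l ≠ j} → ℝ =>
      ‖ψ (insertCoord j (z i) z)‖ ^ 2) (Set.univ.pi fun _ => Set.Icc a b) := fun i =>
    integrableOn_box (hcont i) a b
  rw [← integral_finsetSum _ (fun i _ => hr4 i)]
  refine setIntegral_weighted_le (MeasurableSet.univ_pi fun _ => measurableSet_Icc) hr0 hr1 hr2 hr3
    (integrable_finsetSum _ fun i _ => hr4 i) fun z hz => ?_
  have hc1 : Continuous fun t => insertCoord j t z :=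
    continuous_insertCoord j continuous_id continuous_const
  have h := energy_bound_points hk hkL hη hη0 hab
    (u := fun t => ψ (insertCoord j t z))
    (u' := fun t => fderiv ℝ ψ (insertCoord j t z) (Pi.single j 1))
    (fun t => ((hψ.differentiable one_ne_zero _).hasFDerivAt.comp_hasDerivAt t
      (hasDerivAt_insertCoord j t z)))
    (hd.comp hc1) z (fun i => hz i (Set.mem_univ i))
  rw [← Finset.mul_sum] at h
  have e1 : ∀ t, {x : ι → ℝ | ∀ i : {l // l ≠ j}, x j < x i}.indicator (fun x => ‖ψ x‖ ^ 2)
      (insertCoord j t z) =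
      {t | ∀ i, t < z i}.indicator (fun t => ‖ψ (insertCoord j t z)‖ ^ 2) t := fun t => by
    simp only [Set.indicator, Set.mem_ofPred_eq, insertCoord_self, insertCoord_val]
  have e2 : ∀ t, {x : ι → ℝ | ∀ i : {l // l ≠ j}, x i < x j}.indicator (fun x => ‖ψ x‖ ^ 2)
      (insertCoord j t z) =
      {t | ∀ i, z i < t}.indicator (fun t => ‖ψ (insertCoord j t z)‖ ^ 2) t := fun t => by
    simp only [Set.indicator, Set.mem_ofPred_eq, insertCoord_self, insertCoord_val]
  simp only [e1, e2]
  exact h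

end Coordinate

/-- The integral over the diagonal `x_j = x_k`, with either of the two particles singled out. -/
lemma integral_diagonal_eq {n : ℕ} {j k j' k' : Fin n}
    (h : (j' = j ∧ k' = k) ∨ (j' = k ∧ k' = j)) (hne : k' ≠ j') {g : (Fin n → ℝ) → ℝ}
    (hg : Continuous g) (a b : ℝ) :
    ∫ y in Set.univ.pi fun _ : {l // l ≠ j'} => Set.Icc a b,
        g (insertCoord j' (y ⟨k', hne⟩) y) =
      ∫ t in Set.Icc a b, ∫ z in Set.univ.pi fun _ : {l : Fin n // l ≠ j ∧ l ≠ k} => Set.Icc a b,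
        g (insertPair j k t z) := by
  have hcont : Continuous fun y : {l // l ≠ j'} → ℝ => g (insertCoord j' (y ⟨k', hne⟩) y) :=
    hg.comp (continuous_insertCoord j' (continuous_apply _) continuous_id)
  let e : {l : Fin n // l ≠ j ∧ l ≠ k} → {l // l ≠ j'} := fun i => ⟨i, by
    rcases h with ⟨rfl, -⟩ | ⟨rfl, -⟩
    exacts [i.2.1, i.2.2]⟩
  let Φ : ℝ × ({l : Fin n // l ≠ j ∧ l ≠ k} → ℝ) → {l // l ≠ j'} → ℝ :=
    fun p l => insertPair j k p.1 p.2 l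
  have hbij : Function.Bijective
      fun o : Option {l : Fin n // l ≠ j ∧ l ≠ k} => o.elim (⟨k', hne⟩ : {l // l ≠ j'}) e := by
    constructor
    · rintro (_ | ⟨x, hx⟩) (_ | ⟨y, hy⟩) hxy
      · rfl
      · have : k' = y := congrArg Subtype.val hxy
        grind
      · have : x = k' := congrArg Subtype.val hxy
        grind
      · have : x = y := congrArg Subtype.val hxy
        subst this
        rfl
    · rintro ⟨l, hl⟩
      by_cases hlk : l = k'
      · exact ⟨none, Subtype.ext hlk.symm⟩
      · exact ⟨some ⟨l, by grind⟩, rfl⟩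
  have hs : ∀ p, Φ p ⟨k', hne⟩ = p.1 := fun p => by
    have : k' = j ∨ k' = k := by grind
    simp [Φ, insertPair, this]
  have hv : ∀ p i, Φ p (e i) = p.2 i := fun p i => by
    simp [Φ, e, insertPair, i.2.1, i.2.2]
  have hi := integrableOn_box hcont a b
  rw [integral_comp_box hbij hs hv measurableSet_Icc hi,
    integral_prod _ (integrable_comp_box hbij hs hv measurableSet_Icc hi)]
  have hΦ : ∀ p, insertCoord j' (Φ p ⟨k', hne⟩) (Φ p) = insertPair j k p.1 p.2 := fun p => by
    funext l
    by_cases hl : l = j'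
    · subst hl
      have : l = j ∨ l = k := by grind
      rw [insertCoord_self, hs]
      simp [insertPair, this]
    · exact insertCoord_val j' _ _ ⟨l, hl⟩
  simp only [hΦ]

lemma sum_integral_indicator_le {ι : Type*} [Fintype ι] {s : ι → Set (ι → ℝ)}
    (hs : ∀ j, MeasurableSet (s j)) (hdisj : ∀ i j x, x ∈ s i → x ∈ s j → i = j)
    {g : (ι → ℝ) → ℝ} (hg0 : ∀ x, 0 ≤ g x) {Q : Set (ι → ℝ)} (hg : IntegrableOn g Q) :
    ∑ j, ∫ x in Q, (s j).indicator g x ≤ ∫ x in Q, g x := by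
  rw [← integral_finsetSum _ fun j _ => hg.indicator (hs j)]
  refine integral_mono (integrable_finsetSum _ fun j _ => hg.indicator (hs j)) hg fun x => ?_
  by_cases h : ∃ j, x ∈ s j
  · obtain ⟨j, hj⟩ := h
    refine le_of_eq ?_
    rw [Finset.sum_eq_single j (fun i _ hij => Set.indicator_of_notMem
      (fun hi => hij (hdisj i j x hi hj)) g) (by simp), Set.indicator_of_mem hj]
  · push Not at h
    simp only [Set.indicator_of_notMem (h _), Finset.sum_const_zero]
    exact hg0 x

lemma sum_symm_pairs {n : ℕ} (D : Fin n → Fin n → ℝ) (C : ∀ j : Fin n, {l // l ≠ j} → ℝ)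
    (hlt : ∀ j i, j < i.1 → C j i = D j i) (hgt : ∀ j i, i.1 < j → C j i = D i j) :
    ∑ j, ∑ i, C j i = 2 * ∑ j, ∑ k ∈ Finset.univ.filter (fun k => j < k), D j k := by
  have h1 : ∀ j, ∑ i, C j i =
      ∑ k, ((if j < k then D j k else 0) + if k < j then D k j else 0) := fun j => by
    rw [← Fintype.sum_subtype_add_sum_subtype (fun k => k ≠ j)]
    rw [Fintype.sum_eq_zero (fun i : {k // ¬ k ≠ j} => _) (fun i => by
      have := not_not.1 i.2
      simp [this]), add_zero]
    refine Finset.sum_congr rfl fun i _ => ?_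
    rcases lt_or_gt_of_ne i.2 with h | h
    · simp [h, h.not_gt, hgt j i h]
    · simp [h, h.not_gt, hlt j i h]
  simp only [h1, Finset.sum_add_distrib, Finset.sum_filter]
  rw [Finset.sum_comm (f := fun j k => if k < j then D k j else 0)]
  ring

/-- **Local exclusion for the Lieb–Liniger model.** For `η ≥ 0` and a finite interval
`Q = [a,b]`, the local Lieb–Liniger energy of a symmetric wave function `ψ` of `n`
particles on `Q` (free kinetic energy plus delta-interactions of strength `2η` on the
diagonals) is at least `(n-1)·ξ_S(η|Q|)²/|Q|²` times the local mass. -/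
theorem local_exclusion_lieb_liniger
    (η : ℝ) (hη : 0 ≤ η) (n : ℕ) (hn : 1 ≤ n) (a b : ℝ) (hab : a < b)
    (ξ : ℝ) (hξ0 : 0 ≤ ξ) (hξπ : ξ < Real.pi / 2) (hξ : ξ * Real.tan ξ = η * (b - a))
    (ψ : (Fin n → ℝ) → ℂ) (hψ : ContDiff ℝ (⊤ : ℕ∞) ψ)
    (hsym : ∀ (σ : Equiv.Perm (Fin n)) (x : Fin n → ℝ), ψ (x ∘ σ) = ψ x) :
    (1 / 2) * (∫ x in Set.univ.pi fun _ : Fin n => Set.Icc a b,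
        ∑ j : Fin n, ‖fderiv ℝ ψ x (Pi.single j 1)‖ ^ 2)
      + 2 * η * ∑ j : Fin n, ∑ k ∈ Finset.univ.filter (fun k => j < k),
          ∫ t in Set.Icc a b,
            ∫ z in Set.univ.pi fun _ : {l : Fin n // l ≠ j ∧ l ≠ k} => Set.Icc a b,
              ‖ψ (insertPair j k t z)‖ ^ 2
      ≥ ((n : ℝ) - 1) * (ξ ^ 2 / (b - a) ^ 2) *
        ∫ x in Set.univ.pi fun _ : Fin n => Set.Icc a b, ‖ψ x‖ ^ 2 := by
  have hL : 0 < b - a := sub_pos.2 hab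
  have hψ1 : ContDiff ℝ 1 ψ := hψ.of_le (by exact_mod_cast le_top)
  rcases hn.eq_or_lt with rfl | hn2
  · rw [ge_iff_le, Nat.cast_one, sub_self, zero_mul, zero_mul]
    exact add_nonneg
      (mul_nonneg one_half_pos.le
        (integral_nonneg fun x => Finset.sum_nonneg fun j _ => sq_nonneg _))
      (mul_nonneg (mul_nonneg two_pos.le hη) (Finset.sum_nonneg fun j _ =>
        Finset.sum_nonneg fun k _ => integral_nonneg fun t => integral_nonneg fun z =>
          sq_nonneg _))
  have : Nontrivial (Fin n) := Fin.nontrivial_iff_two_le.2 hn2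
  have hne : ∀ j : Fin n, Nonempty {l // l ≠ j} := fun j =>
    (exists_ne j).elim fun l hl => ⟨⟨l, hl⟩⟩
  have hk : 0 ≤ ξ / (b - a) := by positivity
  have hkL : ξ / (b - a) * (b - a) = ξ := div_mul_cancel₀ _ hL.ne'
  have hη' : ξ / (b - a) * Real.tan (ξ / (b - a) * (b - a)) = η := by
    rw [hkL, div_mul_eq_mul_div, hξ, mul_div_cancel_right₀ _ hL.ne']
  have hψ2 : Continuous fun x => ‖ψ x‖ ^ 2 := hψ1.continuous.norm.pow 2
  have hsum := Finset.sum_le_sum fun (j : Fin n) (_ : j ∈ Finset.univ) =>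
    energy_bound_coordinate hk (by rwa [hkL]) hη' hη hab.le hψ1 j
  rw [← Finset.mul_sum, Finset.sum_sub_distrib, Finset.sum_sub_distrib, Finset.sum_const,
    ← Finset.mul_sum, ← Finset.mul_sum, Finset.sum_add_distrib, ← Finset.mul_sum,
    ← Finset.mul_sum, sum_symm_pairs
      (fun j k => ∫ t in Set.Icc a b,
        ∫ z in Set.univ.pi fun _ : {l : Fin n // l ≠ j ∧ l ≠ k} => Set.Icc a b,
          ‖ψ (insertPair j k t z)‖ ^ 2) _
      (fun j i _ => integral_diagonal_eq (Or.inl ⟨rfl, rfl⟩) i.2 hψ2 a b)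
      (fun j i _ => integral_diagonal_eq (Or.inr ⟨rfl, rfl⟩) i.2 hψ2 a b),
    Finset.card_univ, Fintype.card_fin, nsmul_eq_mul, div_pow] at hsum
  have hA := sum_integral_indicator_le (measurableSet_strict_min (ι := Fin n))
    (fun i j x hi hj => by
      by_contra h
      exact lt_asymm (hi ⟨j, Ne.symm h⟩) (hj ⟨i, h⟩))
    (fun x => sq_nonneg ‖ψ x‖) (integrableOn_box hψ2 a b)
  have hB := sum_integral_indicator_le (measurableSet_strict_max (ι := Fin n))
    (fun i j x hi hj => by
      by_contra h
      exact lt_asymm (hi ⟨j, Ne.symm h⟩) (hj ⟨i, h⟩))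
    (fun x => sq_nonneg ‖ψ x‖) (integrableOn_box hψ2 a b)
  have hd : ∀ j : Fin n, Continuous fun x => ‖fderiv ℝ ψ x (Pi.single j 1)‖ ^ 2 := fun j =>
    ((hψ1.continuous_fderiv one_ne_zero).clm_apply continuous_const).norm.pow 2
  rw [integral_finsetSum _ fun j _ => integrableOn_box (hd j) a b]
  have hk2 : 0 ≤ ξ ^ 2 / (b - a) ^ 2 := by positivity
  have hAB := mul_le_mul_of_nonneg_left (add_le_add hA hB) hk2
  linarith
end
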